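/- arXiv:1305.1709 — 2 statements merged into one kernel-verified Lean document; each statement's English description precedes it below -/
import Mathlib

section
/- Let (R,m,k) be a Noetherian local ring for which the order ideal conjecture holds. Let I be a proper ideal of R of finite projective dimension with grade I = d, and let x_1,…,x_s ∈ m be a set of generators of I. Then for every i ≥ d+1 the natural map K_i(x;R) ⊗_R k → Tor_i^R(R/I, k) is the zero map. -/
open IsLocalRing

universe u

variable (R : Type u) [CommRing R]

/-- Index type for the degree-`n` part of the Koszul complex on `s` generators:
`n`-element subsets of `Fin s` (i.e. strictly increasing `n`-tuples). -/
abbrev KIdx (s n : ℕ) : Type := {T : Finset (Fin s) // T.card = n}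

/-- The degree-`n` part of the Koszul complex `K_•(x₁,…,x_s; R)`:
the free `R`-module on `KIdx s n`. -/
abbrev KMod (s n : ℕ) : Type u := KIdx s n →₀ R

/-- The Koszul differential `K_{n+1}(x;R) → K_n(x;R)`,
`e_T ↦ ∑_{j ∈ T} (-1)^{#{i ∈ T : i < j}} x_j e_{T∖{j}}`. -/
noncomputable def koszulD {s : ℕ} (x : Fin s → R) (n : ℕ) :
    KMod R s (n + 1) →ₗ[R] KMod R s n :=
  Finsupp.lsum R fun T => LinearMap.toSpanSingleton R (KMod R s n)
    (∑ j ∈ T.1.attach,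
      ((-1 : R) ^ (T.1.filter (fun i => i < j.1)).card * x j.1) •
        Finsupp.single ⟨T.1.erase j.1, by
          simp [Finset.card_erase_of_mem j.2, T.2]⟩ (1 : R))

/-- A projective resolution `⋯ → F 1 → F 0 → M → 0` of an `R`-module `M`. -/
structure ProjRes (M : Type u) [AddCommGroup M] [Module R M] where
  F : ℕ → ModuleCat.{u} R
  d : ∀ n, F (n + 1) →ₗ[R] F n
  ε : F 0 →ₗ[R] M
  projective : ∀ n, Module.Projective R (F n)
  surj : Function.Surjective ε
  exact0 : LinearMap.ker ε = LinearMap.range (d 0)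
  exact : ∀ n, LinearMap.ker (d n) = LinearMap.range (d (n + 1))

/-- A chain map `ψ : K_•(x;R) → F_•` lifting the natural surjection
`R/(x₁,…,x_s) → R/I` (for `(x) ⊆ I`), where `F_•` is a projective resolution of
`R/I`.  The condition `aug` says that on `K_0 = R·e_∅` the augmentations are
compatible: `ε(ψ₀(r·e_∅)) = r mod I`. -/
structure KoszulLift {s : ℕ} (x : Fin s → R) (I : Ideal R)
    (P : ProjRes R (R ⧸ I)) where
  ψ : ∀ n, KMod R s n →ₗ[R] P.F n
  comm : ∀ n, (ψ n).comp (koszulD R x n) = (P.d n).comp (ψ (n + 1))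
  aug : ∀ v : KMod R s 0, P.ε (ψ 0 v) = Ideal.Quotient.mk I (v ⟨∅, rfl⟩)

/-- The natural map `K_i(x;R) ⊗ k → Tor_i^R(R/I, k)` is the zero map: for every
projective resolution `F_•` of `R/I` and every chain map `ψ : K_•(x;R) → F_•`
lifting the natural surjection `R/(x) → R/I`, every element of `ψ_i(K_i)` lies in
`im(d_{i+1}) + m·F_i`.  (As every element of `K_i ⊗ k` is a cycle, the induced
map on `i`-th homology `K_i ⊗ k → H_i(F_• ⊗ k) = Tor_i^R(R/I,k)` is zero exactly
when `ψ_i(K_i) ⊆ im(d_{i+1}) + m·F_i`.) -/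
def KoszulTorMapZero [IsLocalRing R] {s : ℕ} (x : Fin s → R) (I : Ideal R)
    (i : ℕ) : Prop :=
  ∀ (P : ProjRes R (R ⧸ I)) (L : KoszulLift R x I P) (v : KMod R s i),
    L.ψ i v ∈ LinearMap.range (P.d i) ⊔ (maximalIdeal R) • (⊤ : Submodule R (P.F i))

/-- The grade of the ideal `J` is at least `k`: either `J = R` (grade `+∞` by
convention), or `J` contains a weakly `R`-regular sequence of length `k`. -/
def GradeGE (J : Ideal R) (k : ℕ) : Prop :=
  J = ⊤ ∨ ∃ rs : List R, rs.length = k ∧ (∀ r ∈ rs, r ∈ J) ∧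
    RingTheory.Sequence.IsWeaklyRegular R rs

/-- The order ideal `O_M(y) = {f(y) : f ∈ Hom_R(M, R)}` of `y : M`. -/
def orderIdeal {M : Type u} [AddCommGroup M] [Module R M] (y : M) : Ideal R :=
  LinearMap.range (LinearMap.applyₗ (R := R) (M := M) (M₂ := R) y)

/-- `M` has a finite resolution by finitely generated free modules; for a
finitely generated module over a Noetherian local ring this says exactly that
`M` has finite projective dimension. -/
def HasFiniteFreeResolution (M : Type u) [AddCommGroup M] [Module R M] : Prop :=
  ∃ (P : ProjRes R M) (n : ℕ),
    (∀ j, Module.Free R (P.F j) ∧ Module.Finite R (P.F j)) ∧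
    ∀ j, n ≤ j → Subsingleton (P.F j)

/-- `M` is a `k`-th syzygy: there is an exact sequence
`0 → M → F_{k-1} → ⋯ → F_0 → N → 0` with the `F_j` finitely generated free;
equivalently (continuing the resolution), `M` is isomorphic to the `k`-th syzygy
module `im(d_{k-1})` of some resolution of `N` by finitely generated free
modules. -/
def IsSyzygy (k : ℕ) (M : Type u) [AddCommGroup M] [Module R M] : Prop :=
  match k with
  | 0 => True
  | (j + 1) => ∃ (N : Type u) (_ : AddCommGroup N) (_ : Module R N)
      (P : ProjRes R N),
        (∀ n, Module.Free R (P.F n) ∧ Module.Finite R (P.F n)) ∧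
        Nonempty (M ≃ₗ[R] ↥(LinearMap.range (P.d j)))

/-- The order ideal conjecture holds for the local ring `R`: for every finitely
generated `R`-module `M` of finite projective dimension which is a `k`-th syzygy
and every minimal generator `y` of `M` (i.e. `y ∉ mM`), the order ideal `O_M(y)`
has grade at least `k`. -/
def OrderIdealConjecture [IsLocalRing R] : Prop :=
  ∀ (M : Type u) (_ : AddCommGroup M) (_ : Module R M),
    Module.Finite R M → HasFiniteFreeResolution R M →
      ∀ k : ℕ, IsSyzygy R k M →
        ∀ y : M, y ∉ (maximalIdeal R) • (⊤ : Submodule R M) →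
          GradeGE R (orderIdeal R y) k

namespace ProjRes

variable {R} {M : Type u} [AddCommGroup M] [Module R M]

lemma isWeaklyRegular_F (P : ProjRes R M) {rs : List R}
    (h : RingTheory.Sequence.IsWeaklyRegular R rs) (j : ℕ) :
    RingTheory.Sequence.IsWeaklyRegular (P.F j) rs := by
  have := P.projective j
  exact ((TensorProduct.rid R (P.F j)).isWeaklyRegular_congr rs).mp h.isWeaklyRegular_lTensor

lemma d_comp_d (P : ProjRes R M) (n : ℕ) (c : P.F (n + 2)) : P.d n (P.d (n + 1) c) = 0 :=
  LinearMap.mem_ker.mp (P.exact n ▸ LinearMap.mem_range_self _ c)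

lemma ε_d (P : ProjRes R M) (c : P.F 1) : P.ε (P.d 0 c) = 0 :=
  LinearMap.mem_ker.mp (P.exact0 ▸ LinearMap.mem_range_self _ c)

/-- Modulo a weakly regular sequence of length `k`, a projective resolution stays exact in
degrees larger than `k`. -/
lemma exact_mod_ofList (P : ProjRes R M) {rs : List R}
    (h : RingTheory.Sequence.IsWeaklyRegular R rs) {j : ℕ} (hj : rs.length ≤ j)
    {c : P.F (j + 1)} (hc : P.d j c ∈ Ideal.ofList rs • (⊤ : Submodule R (P.F j))) :
    c ∈ LinearMap.range (P.d (j + 1)) ⊔ Ideal.ofList rs • (⊤ : Submodule R (P.F (j + 1))) := by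
  induction rs using List.reverseRecOn generalizing j with
  | nil =>
    rw [Ideal.ofList_nil, Submodule.bot_smul, Submodule.mem_bot] at hc
    exact Submodule.mem_sup_left (P.exact j ▸ LinearMap.mem_ker.mpr hc)
  | append_singleton rs a ih =>
    rw [List.length_append, List.length_singleton] at hj
    obtain ⟨j, rfl⟩ := Nat.exists_eq_add_of_le' (Nat.le_of_add_left_le hj)
    have hrs := ((RingTheory.Sequence.isWeaklyRegular_append_iff R rs [a]).mp h).1
    have ha := (RingTheory.Sequence.isWeaklyRegular_singleton_iff _ a).mp
      ((RingTheory.Sequence.isWeaklyRegular_append_iff _ rs [a]).mp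
        (P.isWeaklyRegular_F h j)).2
    rw [Ideal.ofList_append, Ideal.ofList_singleton, Submodule.sup_smul] at hc ⊢
    obtain ⟨w, hw, v, hv, hwv⟩ := Submodule.mem_sup.mp hc
    rw [Submodule.ideal_span_singleton_smul] at hv
    obtain ⟨c', -, rfl⟩ := (Submodule.mem_smul_pointwise_iff_exists _ _ _).mp hv
    have hdw : P.d j w ∈ Ideal.ofList rs • (⊤ : Submodule R (P.F j)) :=
      Submodule.smul_top_le_comap_smul_top _ (P.d j) hw
    have hdc' : P.d j c' ∈ Ideal.ofList rs • (⊤ : Submodule R (P.F j)) := by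
      rw [← Submodule.Quotient.mk_eq_zero]
      refine (isSMulRegular_iff_right_eq_zero_of_smul.mp ha) _ ?_
      rw [← Submodule.Quotient.mk_smul, Submodule.Quotient.mk_eq_zero, ← map_smul,
        eq_sub_of_add_eq' hwv, map_sub, d_comp_d, zero_sub]
      exact neg_mem hdw
    obtain ⟨_, ⟨c'', rfl⟩, w', hw', rfl⟩ := Submodule.mem_sup.mp (ih hrs (by omega) hdc')
    have key : P.d (j + 1) (c - a • c'') ∈
        Ideal.ofList rs • (⊤ : Submodule R (P.F (j + 1))) := by
      rw [map_sub, ← hwv, map_smul, smul_add, add_sub_assoc, add_sub_cancel_left]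
      exact add_mem hw (Submodule.smul_mem _ a hw')
    have := ih hrs (by omega) key
    rw [← sub_add_cancel c (a • c''), ← sup_assoc]
    exact add_mem (Submodule.mem_sup_left this) (Submodule.mem_sup_right
      (Submodule.smul_mem_smul (Ideal.mem_span_singleton_self a) trivial))

end ProjRes

open CategoryTheory Abelian in
lemma subsingleton_linearMap_quotient_ofList {R : Type u} [CommRing R] (N : ModuleCat.{u} R)
    (M : ModuleCat.{u} R) {rs : List R} (h : RingTheory.Sequence.IsWeaklyRegular M rs)
    (hext : ∀ i ≤ rs.length, Subsingleton (Ext N M i)) :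
    Subsingleton (N →ₗ[R] M ⧸ (Ideal.ofList rs • ⊤ : Submodule R M)) := by
  induction rs generalizing M with
  | nil =>
    have := hext 0 (by simp)
    have : Subsingleton (N →ₗ[R] M) :=
      (Ext.addEquiv₀.trans ModuleCat.homAddEquiv).symm.subsingleton
    have e := Submodule.quotEquivOfEqBot (Ideal.ofList ([] : List R) • ⊤ : Submodule R M) (by simp)
    exact (e.congrRight (M := N) (R := R)).toEquiv.subsingleton
  | cons a rs ih =>
    rw [RingTheory.Sequence.isWeaklyRegular_cons_iff] at h
    have := ih (ModuleCat.of R (QuotSMulTop a M)) h.2 fun i hi ↦ by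
      have zero1 := AddCommGrpCat.isZero_of_iff_subsingleton.mpr
        (hext i (hi.trans (by simp)))
      have zero2 := AddCommGrpCat.isZero_of_iff_subsingleton.mpr
        (hext (i + 1) (by simpa using hi))
      exact AddCommGrpCat.subsingleton_of_isZero <| ShortComplex.Exact.isZero_of_both_zeros
        ((Ext.covariant_sequence_exact₃' N h.1.smulShortComplex_shortExact) i (i + 1) rfl)
        (zero1.eq_zero_of_src _) (zero2.eq_zero_of_tgt _)
    have e := Submodule.quotOfListConsSMulTopEquivQuotSMulTopInner M a rs
    exact (e.congrRight (M := N) (R := R)).toEquiv.subsingleton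

/-- If an ideal `J` kills a nonzero element modulo an `R`-regular sequence in `J`, then the grade
of `J` is at most the length of that sequence. -/
lemma not_isWeaklyRegular_of_colon [IsNoetherianRing R] [IsLocalRing R] {J : Ideal R}
    {as bs : List R}
    (has : RingTheory.Sequence.IsWeaklyRegular R as)
    (hbs : RingTheory.Sequence.IsWeaklyRegular R bs) (hb : ∀ b ∈ bs, b ∈ J)
    (hlen : as.length < bs.length) {z : R} (hz : z ∉ Ideal.ofList as)
    (hJz : ∀ r ∈ J, r * z ∈ Ideal.ofList as) : False := by
  have hJ : J ≠ ⊤ := by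
    rintro rfl
    exact hz (by simpa using hJz 1 trivial)
  have hreg : RingTheory.Sequence.IsRegular R bs :=
    (IsLocalRing.isRegular_iff_isWeaklyRegular_of_subset_maximalIdeal
      fun b h ↦ le_maximalIdeal hJ (hb b h)).mpr hbs
  have hsub := subsingleton_linearMap_quotient_ofList (ModuleCat.of R (R ⧸ J)) (ModuleCat.of R R)
    has fun i hi ↦ ModuleCat.subsingleton_ext_of_exists_isRegular J _
      (by rw [Module.support_eq_zeroLocus, Ideal.annihilator_quotient]) _
      (by simpa [lt_top_iff_ne_top] using hJ) bs hb hreg i (by omega)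
  let g : R ⧸ J →ₗ[R] R ⧸ (Ideal.ofList as • ⊤ : Submodule R R) :=
    Submodule.liftQ J (LinearMap.toSpanSingleton R _ (Submodule.Quotient.mk z)) fun r hr ↦ by
      rw [LinearMap.mem_ker, LinearMap.toSpanSingleton_apply, ← Submodule.Quotient.mk_smul,
        Submodule.Quotient.mk_eq_zero]
      simpa using hJz r hr
  have h0 : g (Submodule.Quotient.mk 1) = 0 := by
    rw [hsub.elim g 0]; rfl
  rw [Submodule.liftQ_apply, LinearMap.toSpanSingleton_apply, one_smul,
    Submodule.Quotient.mk_eq_zero] at h0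
  exact hz (by simpa using h0)

/-- A maximal regular sequence in `I` admits a nonzero element modulo the sequence killed by `I`. -/
lemma exists_colon_of_not_gradeGE [IsNoetherianRing R] {I : Ideal R} {as : List R}
    (has : RingTheory.Sequence.IsWeaklyRegular R as) (ha : ∀ a ∈ as, a ∈ I)
    (hI : ¬ GradeGE R I (as.length + 1)) :
    ∃ z ∉ Ideal.ofList as, ∀ r ∈ I, r * z ∈ Ideal.ofList as := by
  have hns : ¬ Subsingleton (R ⧸ I →ₗ[R] R ⧸ (Ideal.ofList as • ⊤ : Submodule R R)) := by
    rw [IsSMulRegular.subsingleton_linearMap_iff, Ideal.annihilator_quotient]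
    rintro ⟨r, hr, hreg⟩
    refine hI (.inr ⟨as ++ [r], by simp, ?_, ?_⟩)
    · simpa [or_imp, forall_and] using ⟨ha, hr⟩
    · exact (RingTheory.Sequence.isWeaklyRegular_append_iff R as [r]).mpr
        ⟨has, (RingTheory.Sequence.isWeaklyRegular_singleton_iff _ r).mpr hreg⟩
  rw [not_subsingleton_iff_nontrivial] at hns
  obtain ⟨f, hf⟩ := exists_ne (0 : R ⧸ I →ₗ[R] R ⧸ (Ideal.ofList as • ⊤ : Submodule R R))
  obtain ⟨z, hz⟩ := Submodule.Quotient.mk_surjective _ (f (Submodule.Quotient.mk 1))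
  refine ⟨z, fun hz' ↦ hf ?_, fun r hr ↦ ?_⟩
  · have hf1 : f (Submodule.Quotient.mk 1) = 0 := by
      rw [← hz, Submodule.Quotient.mk_eq_zero]
      simpa using hz'
    refine Submodule.linearMap_qext _ (LinearMap.ext_ring ?_)
    simpa using hf1
  · have h0 : (Submodule.Quotient.mk (r • z) : R ⧸ (Ideal.ofList as • ⊤ : Submodule R R)) = 0 := by
      rw [Submodule.Quotient.mk_smul, hz, ← map_smul, ← Submodule.Quotient.mk_smul,
        (Submodule.Quotient.mk_eq_zero I).mpr (by simpa using hr), map_zero]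
    simpa using (Submodule.Quotient.mk_eq_zero _).mp h0

namespace ProjRes

variable {R} {M : Type u} [AddCommGroup M] [Module R M]

lemma exists_comp_eq (P : ProjRes R M) {n : ℕ} {A B : Type*} [AddCommGroup A] [Module R A]
    [AddCommGroup B] [Module R B] (f : P.F n →ₗ[R] B) (g : A →ₗ[R] B)
    (hf : ∀ c, f c ∈ LinearMap.range g) : ∃ k : P.F n →ₗ[R] A, g.comp k = f := by
  have := P.projective n
  obtain ⟨k, hk⟩ := Module.projective_lifting_property g.rangeRestrict
    (f.codRestrict (LinearMap.range g) hf) g.surjective_rangeRestrict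
  exact ⟨k, LinearMap.ext fun c ↦ congrArg Subtype.val (LinearMap.congr_fun hk c)⟩

/-- Comparison of projective resolutions. -/
lemma exists_lift (P Q : ProjRes R M) :
    ∃ θ : ∀ n, P.F n →ₗ[R] Q.F n, (∀ c, Q.ε (θ 0 c) = P.ε c) ∧
      ∀ n c, Q.d n (θ (n + 1) c) = θ n (P.d n c) := by
  let T (n : ℕ) := {f : P.F n →ₗ[R] Q.F n //
    ∃ g : P.F (n + 1) →ₗ[R] Q.F (n + 1), (Q.d n).comp g = f.comp (P.d n)}
  have start : ∃ t : T 0, Q.ε.comp t.1 = P.ε := by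
    have := P.projective 0
    obtain ⟨f, hf⟩ := Module.projective_lifting_property Q.ε P.ε Q.surj
    refine ⟨⟨f, P.exists_comp_eq _ _ fun c ↦ ?_⟩, hf⟩
    rw [← Q.exact0, LinearMap.mem_ker]
    exact (LinearMap.congr_fun hf _).trans (P.ε_d c)
  have step (n : ℕ) (t : T n) : ∃ t' : T (n + 1), (Q.d n).comp t'.1 = t.1.comp (P.d n) := by
    obtain ⟨f, g, hg⟩ := t
    refine ⟨⟨g, P.exists_comp_eq _ _ fun c ↦ ?_⟩, hg⟩
    rw [← Q.exact, LinearMap.mem_ker]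
    refine (LinearMap.congr_fun hg _).trans ?_
    simp [d_comp_d]
  obtain ⟨t₀, ht₀⟩ := start
  choose next hnext using step
  exact ⟨fun n ↦ (Nat.rec t₀ next n : T n).1, LinearMap.congr_fun ht₀,
    fun n ↦ LinearMap.congr_fun (hnext n _)⟩

/-- A chain endomorphism of a projective resolution lifting zero is null-homotopic. -/
lemma exists_homotopy (P : ProjRes R M) (f : ∀ n, P.F n →ₗ[R] P.F n)
    (h0 : ∀ c, P.ε (f 0 c) = 0) (hf : ∀ n c, P.d n (f (n + 1) c) = f n (P.d n c)) (n : ℕ) :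
    ∃ (h : P.F n →ₗ[R] P.F (n + 1)) (h' : P.F (n + 1) →ₗ[R] P.F (n + 2)),
      ∀ c, f (n + 1) c = P.d (n + 1) (h' c) + h (P.d n c) := by
  have step (n : ℕ) (h : P.F n →ₗ[R] P.F (n + 1))
      (hh : ∀ c, f n (P.d n c) = P.d n (h (P.d n c))) :
      ∃ h' : P.F (n + 1) →ₗ[R] P.F (n + 2),
        ∀ c, f (n + 1) c = P.d (n + 1) (h' c) + h (P.d n c) := by
    obtain ⟨h', hh'⟩ := P.exists_comp_eq (f (n + 1) - h.comp (P.d n)) (P.d (n + 1)) fun c ↦ by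
      rw [← P.exact, LinearMap.mem_ker]
      simp [hf, hh]
    exact ⟨h', fun c ↦ sub_eq_iff_eq_add.mp (LinearMap.congr_fun hh' c).symm⟩
  have all (n : ℕ) : ∃ h : P.F n →ₗ[R] P.F (n + 1),
      ∀ c, f n (P.d n c) = P.d n (h (P.d n c)) := by
    induction n with
    | zero =>
      obtain ⟨h, hh⟩ := P.exists_comp_eq (f 0) (P.d 0) fun c ↦ by
        rw [← P.exact0, LinearMap.mem_ker, h0]
      exact ⟨h, fun c ↦ (LinearMap.congr_fun hh _).symm⟩
    | succ n ih =>
      obtain ⟨h, hh⟩ := ih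
      obtain ⟨h', hh'⟩ := step n h hh
      exact ⟨h', fun c ↦ by rw [hh', d_comp_d, map_zero, add_zero]⟩
  obtain ⟨h, hh⟩ := all n
  exact ⟨h, step n h hh⟩

/-- The resolution of the syzygy module `im (d j)` obtained by truncation. -/
def syzygy (P : ProjRes R M) (j : ℕ) : ProjRes R (LinearMap.range (P.d j)) where
  F n := P.F (j + 1 + n)
  d n := P.d (j + 1 + n)
  ε := (P.d j).rangeRestrict
  projective n := P.projective _
  surj := (P.d j).surjective_rangeRestrict
  exact0 := by rw [LinearMap.ker_rangeRestrict]; exact P.exact j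
  exact n := P.exact _

/-- A resolution of `I` extends to a resolution of `R ⧸ I` with `R` in degree zero. -/
def quotient {I : Ideal R} (P : ProjRes R I) : ProjRes R (R ⧸ I) where
  F
    | 0 => ModuleCat.of R R
    | n + 1 => P.F n
  d
    | 0 => I.subtype.comp P.ε
    | n + 1 => P.d n
  ε := I.mkQ
  projective
    | 0 => inferInstanceAs (Module.Projective R R)
    | n + 1 => P.projective n
  surj := I.mkQ_surjective
  exact0 := by
    change _ = LinearMap.range (I.subtype.comp P.ε)
    rw [LinearMap.range_comp, LinearMap.range_eq_top.mpr P.surj, Submodule.map_top,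
      Submodule.range_subtype]
    exact I.ker_mkQ
  exact
    | 0 => by
      change LinearMap.ker (I.subtype.comp P.ε) = _
      rw [LinearMap.ker_comp_of_ker_eq_bot _ I.ker_subtype]
      exact P.exact0
    | n + 1 => P.exact n

end ProjRes

lemma HasFiniteFreeResolution.quotient {I : Ideal R} (h : HasFiniteFreeResolution R I) :
    HasFiniteFreeResolution R (R ⧸ I) := by
  obtain ⟨P, n, hP, hn⟩ := h
  refine ⟨P.quotient, n + 1, ?_, ?_⟩
  · rintro (_ | j)
    · exact ⟨inferInstanceAs (Module.Free R R), inferInstanceAs (Module.Finite R R)⟩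
    · exact hP j
  · rintro (_ | j) hj
    · omega
    · exact hn j (by omega)

lemma koszulD_mem {s : ℕ} (x : Fin s → R) {J : Ideal R} (hx : ∀ j, x j ∈ J) (n : ℕ)
    (v : KMod R s (n + 1)) : koszulD R x n v ∈ J • (⊤ : Submodule R (KMod R s n)) := by
  rw [koszulD, Finsupp.lsum_apply]
  refine Submodule.sum_mem _ fun T _ ↦ ?_
  exact Submodule.smul_mem _ _ (Submodule.sum_mem _ fun j _ ↦
    Submodule.smul_mem_smul (J.mul_mem_left _ (hx _)) trivial)

/-- An element `u` of positive degree `j + 1 > grade I` in a finite free resolution of `R ⧸ I`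
whose boundary has coefficients in `I` vanishes in `Tor_{j+1}(R ⧸ I, k)`. -/
lemma OrderIdealConjecture.mem_range_sup_smul [IsNoetherianRing R] [IsLocalRing R]
    (hOIC : OrderIdealConjecture R) {I : Ideal R} (hI : I ≠ ⊤) {d : ℕ}
    (hgrade_ge : GradeGE R I d) (hgrade_lt : ¬ GradeGE R I (d + 1))
    {M : Type u} [AddCommGroup M] [Module R M] (P : ProjRes R M)
    (hP : ∀ j, Module.Free R (P.F j) ∧ Module.Finite R (P.F j))
    (hfin : ∃ n, ∀ j, n ≤ j → Subsingleton (P.F j)) {j : ℕ} (hj : d ≤ j) {u : P.F (j + 1)}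
    (hu : P.d j u ∈ I • (⊤ : Submodule R (P.F j))) :
    u ∈ LinearMap.range (P.d (j + 1)) ⊔ maximalIdeal R • (⊤ : Submodule R (P.F (j + 1))) := by
  by_contra hcon
  obtain ⟨as, rfl, ha, has⟩ := hgrade_ge.resolve_left hI
  obtain ⟨z, hz, hIz⟩ := exists_colon_of_not_gradeGE R has ha hgrade_lt
  obtain ⟨n, hn⟩ := hfin
  let y : LinearMap.range (P.d j) := (P.d j).rangeRestrict u
  have hy : y ∉ maximalIdeal R • (⊤ : Submodule R (LinearMap.range (P.d j))) := by
    intro hy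
    rw [← LinearMap.range_eq_top.mpr (P.d j).surjective_rangeRestrict,
      LinearMap.range_eq_map (P.d j).rangeRestrict, ← Submodule.map_smul''] at hy
    obtain ⟨w, hw, hwy⟩ := hy
    refine hcon (sub_add_cancel u w ▸ add_mem (Submodule.mem_sup_left ?_)
      (Submodule.mem_sup_right hw))
    rw [← P.exact, LinearMap.mem_ker, map_sub, sub_eq_zero]
    exact (congrArg Subtype.val hwy).symm
  have := (hP (j + 1)).2
  have hord := hOIC (LinearMap.range (P.d j)) _ _ inferInstance
    ⟨P.syzygy j, n, fun i ↦ hP _, fun i hi ↦ hn _ (by omega)⟩ (j + 1)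
    ⟨M, _, _, P, hP, ⟨LinearEquiv.refl R _⟩⟩ y hy
  have hcolon : ∀ r ∈ orderIdeal R y, r * z ∈ Ideal.ofList as := by
    rintro _ ⟨f, rfl⟩
    have hzu : P.d j (z • u) ∈ Ideal.ofList as • (⊤ : Submodule R (P.F j)) := by
      rw [map_smul]
      refine Submodule.smul_induction_on hu (fun r hr c _ ↦ ?_) fun a b ha hb ↦ ?_
      · rw [smul_smul, mul_comm]
        exact Submodule.smul_mem_smul (hIz r hr) trivial
      · rw [smul_add]
        exact add_mem ha hb
    obtain ⟨_, ⟨e, rfl⟩, w, hw, hew⟩ := Submodule.mem_sup.mp (P.exact_mod_ofList has hj hzu)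
    have hfw : f ((P.d j).rangeRestrict w) ∈ Ideal.ofList as • (⊤ : Submodule R R) :=
      Submodule.smul_top_le_comap_smul_top _ (f.comp (P.d j).rangeRestrict) hw
    have hzy : z • y = (P.d j).rangeRestrict w := by
      rw [← map_smul, ← hew, map_add, add_eq_right]
      exact Subtype.ext (P.d_comp_d j e)
    rw [LinearMap.applyₗ_apply_apply, mul_comm, ← smul_eq_mul, ← map_smul, hzy]
    simpa using hfw
  obtain htop | ⟨bs, hlen, hb, hbs⟩ := hord
  · exact hz (by simpa using hcolon 1 (htop ▸ trivial))
  · exact not_isWeaklyRegular_of_colon R has hbs hb (by omega) hz hcolon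

/-- Let `(R,m,k)` be a Noetherian local ring for which the
order ideal conjecture holds.  Let `I` be a proper ideal of `R` of finite
projective dimension with `grade I = d`, and let `x₁,…,x_s ∈ m` be a set of
generators of `I`.  Then for every `i ≥ d + 1` the natural map
`K_i(x;R) ⊗_R k → Tor_i^R(R/I, k)` is the zero map. -/
theorem statement0
    (R : Type u) [CommRing R] [IsNoetherianRing R] [IsLocalRing R]
    (hOIC : OrderIdealConjecture R)
    (I : Ideal R) (hI : I ≠ ⊤) (hpd : HasFiniteFreeResolution R ↥I)
    (d : ℕ) (hgrade_ge : GradeGE R I d) (hgrade_lt : ¬ GradeGE R I (d + 1))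
    {s : ℕ} (x : Fin s → R) (hxm : ∀ j, x j ∈ maximalIdeal R)
    (hgen : Ideal.span (Set.range x) = I)
    (i : ℕ) (hi : d + 1 ≤ i) :
    KoszulTorMapZero R x I i := by
  intro P L v
  obtain ⟨i, rfl⟩ := Nat.exists_eq_add_of_le' (Nat.le_of_add_left_le hi)
  obtain ⟨Q, n, hQ, hn⟩ := HasFiniteFreeResolution.quotient R hpd
  obtain ⟨θ, hθ0, hθ⟩ := P.exists_lift Q
  obtain ⟨η, hη0, hη⟩ := Q.exists_lift P
  obtain ⟨h, h', hh⟩ := P.exists_homotopy (fun n ↦ LinearMap.id - (η n).comp (θ n))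
    (by simp [hθ0, hη0]) (by simp [hθ, hη]) i
  have hPd : P.d i (L.ψ (i + 1) v) = L.ψ i (koszulD R x i v) :=
    (LinearMap.congr_fun (L.comm i) v).symm
  have hu : θ (i + 1) (L.ψ (i + 1) v) ∈ LinearMap.range (Q.d (i + 1)) ⊔
      maximalIdeal R • (⊤ : Submodule R (Q.F (i + 1))) := by
    refine hOIC.mem_range_sup_smul R hI hgrade_ge hgrade_lt Q hQ ⟨n, hn⟩ (by omega) ?_
    rw [hθ, hPd]
    exact Submodule.smul_top_le_comap_smul_top _ ((θ i).comp (L.ψ i))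
      (koszulD_mem R x (fun j ↦ hgen ▸ Ideal.subset_span ⟨j, rfl⟩) i v)
  have hη' : η (i + 1) (θ (i + 1) (L.ψ (i + 1) v)) ∈ LinearMap.range (P.d (i + 1)) ⊔
      maximalIdeal R • (⊤ : Submodule R (P.F (i + 1))) := by
    obtain ⟨_, ⟨e, rfl⟩, w, hw, hew⟩ := Submodule.mem_sup.mp hu
    rw [← hew, map_add, ← hη]
    exact add_mem (Submodule.mem_sup_left ⟨_, rfl⟩) (Submodule.mem_sup_right
      (Submodule.smul_top_le_comap_smul_top _ (η (i + 1)) hw))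
  have hhom := hh (L.ψ (i + 1) v)
  rw [hPd, LinearMap.sub_apply, LinearMap.id_apply, LinearMap.comp_apply, sub_eq_iff_eq_add]
    at hhom
  rw [hhom]
  exact add_mem (add_mem (Submodule.mem_sup_left ⟨_, rfl⟩) (Submodule.mem_sup_right
    (Submodule.smul_top_le_comap_smul_top _ (h.comp (L.ψ i)) (koszulD_mem R x hxm i v)))) hη'
end

section
/- Let (R,m,k) be a regular local ring containing a field and let I be an ideal of height d. Let x_1,…,x_d ∈ I be an R-regular sequence, and set Ω̃ = ((x_1,…,x_d) :_R I), the lift to R of the canonical module Ω = Hom_{R/(x)}(R/I, R/(x)) ≅ Ext^d_R(R/I,R) of R/I regarded as an ideal of S = R/(x_1,…,x_d). Then the natural map K_d(x;R) ⊗_R k → Tor_d^R(R/Ω̃, k) (induced by a chain map lifting the natural surjection R/(x_1,…,x_d) → R/Ω̃) is the zero map. -/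
open IsLocalRing

universe u

variable (R : Type u) [CommRing R]

/-- `R` is a regular local ring: a Noetherian local ring whose maximal ideal is
generated by `dim R` elements. -/
def IsRegularLocal [IsLocalRing R] : Prop :=
  IsNoetherianRing R ∧ ∃ (n : ℕ) (x : Fin n → R),
    Ideal.span (Set.range x) = maximalIdeal R ∧ ringKrullDim R = n

/-- The ideal `I` has height `d`: `d` is the minimum of the heights of the primes
containing `I`, the height of a prime `P` being `dim R_P`. -/
def HeightEq (I : Ideal R) (d : ℕ) : Prop :=
  (∃ (P : Ideal R) (h : P.IsPrime), I ≤ P ∧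
      ringKrullDim (@Localization.AtPrime R _ P h) = d) ∧
    ∀ (P : Ideal R) (h : P.IsPrime), I ≤ P →
      (d : WithBot ℕ∞) ≤ ringKrullDim (@Localization.AtPrime R _ P h)

namespace CanonicalElement
open TensorProduct

lemma koszulD_single {A : Type u} [CommRing A] {s : ℕ} (x : Fin s → A) (n : ℕ)
    (S : KIdx s (n + 1)) :
    koszulD A x n (Finsupp.single S 1) = ∑ j ∈ S.1.attach,
      ((-1 : A) ^ (S.1.filter (fun i => i < j.1)).card * x j.1) •
        Finsupp.single ⟨S.1.erase j.1, by simp [Finset.card_erase_of_mem j.2, S.2]⟩ (1 : A) := by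
  simp [koszulD]

/-- A chain map from a complex of free modules to an exact complex which induces zero on `H_0` is
null-homotopic, in the form needed in a single degree. -/
lemma exists_homotopy {A : Type*} [CommRing A] {K G : ℕ → Type*} [∀ n, AddCommGroup (K n)]
    [∀ n, Module A (K n)] [∀ n, AddCommGroup (G n)] [∀ n, Module A (G n)]
    [∀ n, Module.Projective A (K n)]
    (δ : ∀ n, K (n + 1) →ₗ[A] K n) (d : ∀ n, G (n + 1) →ₗ[A] G n) (α : ∀ n, K n →ₗ[A] G n)
    (hδ : ∀ n, δ n ∘ₗ δ (n + 1) = 0)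
    (hd : ∀ n, LinearMap.ker (d n) ≤ LinearMap.range (d (n + 1)))
    (hα : ∀ n, α n ∘ₗ δ n = d n ∘ₗ α (n + 1))
    (h0 : LinearMap.range (α 0) ≤ LinearMap.range (d 0)) (n : ℕ) :
    ∃ h : K n →ₗ[A] G (n + 1), d n ∘ₗ (α (n + 1) - h ∘ₗ δ n) = 0 := by
  have lift : ∀ (m n : ℕ) (f : K m →ₗ[A] G n), LinearMap.range f ≤ LinearMap.range (d n) →
      ∃ h : K m →ₗ[A] G (n + 1), d n ∘ₗ h = f := by
    intro m n f hf
    obtain ⟨h, hh⟩ := Module.projective_lifting_property (d n).rangeRestrict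
      (f.codRestrict _ fun v => hf ⟨v, rfl⟩) (LinearMap.surjective_rangeRestrict _)
    refine ⟨h, ?_⟩
    ext v
    have := congrArg Subtype.val (LinearMap.congr_fun hh v)
    simpa using this
  induction n with
  | zero =>
    obtain ⟨h, hh⟩ := lift 0 0 (α 0) h0
    refine ⟨h, ?_⟩
    rw [LinearMap.comp_sub, ← LinearMap.comp_assoc, hh, hα, sub_self]
  | succ n ih =>
    obtain ⟨h, hh⟩ := ih
    obtain ⟨h', hh'⟩ := lift (n + 1) (n + 1) (α (n + 1) - h ∘ₗ δ n) (by
      refine le_trans ?_ (hd n)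
      rintro _ ⟨v, rfl⟩
      exact LinearMap.congr_fun hh v)
    refine ⟨h', ?_⟩
    rw [LinearMap.comp_sub, ← LinearMap.comp_assoc, hh', LinearMap.sub_comp, LinearMap.comp_assoc,
      hδ, hα]
    simp

open Classical in
/-- The basis vector `e_T` of the Koszul complex, extended by zero to all finsets. -/
noncomputable def koszulE (A : Type u) [CommRing A] (s n : ℕ) (T : Finset (Fin s)) : KMod A s n :=
  if h : T.card = n then Finsupp.single ⟨T, h⟩ 1 else 0

lemma koszulD_single_eq {A : Type u} [CommRing A] {s : ℕ} (x : Fin s → A) (n : ℕ)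
    (S : KIdx s (n + 1)) :
    koszulD A x n (Finsupp.single S 1) = ∑ j ∈ S.1,
      ((-1 : A) ^ (S.1.filter (fun i => i < j)).card * x j) • koszulE A s n (S.1.erase j) := by
  rw [koszulD_single, ← Finset.sum_attach S.1]
  refine Finset.sum_congr rfl fun j _ => ?_
  rw [koszulE, dif_pos]

lemma koszul_sign {s : ℕ} (S : Finset (Fin s)) {j k : Fin s} (hj : j ∈ S) (hjk : j < k) :
    ((S.erase j).filter (fun i => i < k)).card + 1 = (S.filter (fun i => i < k)).card ∧
    ((S.erase k).filter (fun i => i < j)) = (S.filter (fun i => i < j)) := by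
  constructor
  · rw [Finset.filter_erase, Finset.card_erase_add_one]
    simp [hj, hjk]
  · rw [Finset.filter_erase, Finset.erase_eq_of_notMem]
    simp [hjk.le]

lemma koszulD_comp {A : Type u} [CommRing A] {s : ℕ} (x : Fin s → A) (n : ℕ) :
    koszulD A x n ∘ₗ koszulD A x (n + 1) = 0 := by
  ext S : 2
  simp only [LinearMap.comp_apply, Finsupp.lsingle_apply, LinearMap.zero_comp,
    LinearMap.zero_apply]
  let f : Fin s → Fin s → KMod A s n := fun j k =>
    (((-1 : A) ^ (S.1.filter (fun i => i < j)).card * x j) *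
      ((-1 : A) ^ ((S.1.erase j).filter (fun i => i < k)).card * x k)) •
      koszulE A s n ((S.1.erase j).erase k)
  have h1 : koszulD A x n (koszulD A x (n + 1) (Finsupp.single S 1)) =
      ∑ j ∈ S.1, ∑ k ∈ S.1.erase j, f j k := by
    rw [koszulD_single_eq, map_sum]
    refine Finset.sum_congr rfl fun j hj => ?_
    have hc : (S.1.erase j).card = n + 1 := by simp [Finset.card_erase_of_mem hj, S.2]
    rw [map_smul, koszulE, dif_pos hc, koszulD_single_eq, Finset.smul_sum]
    simp [f, smul_smul]
  have hf : ∀ j k, j ∈ S.1 → k ∈ S.1 → j < k → f j k + f k j = 0 := by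
    intro j k hj hk hjk
    obtain ⟨h2, h3⟩ := koszul_sign S.1 hj hjk
    simp only [f]
    rw [h3, ← h2, Finset.erase_right_comm, ← add_smul]
    convert zero_smul A _
    ring
  rw [h1, Finset.sum_sigma']
  refine Finset.sum_involution (fun p _ => ⟨p.2, p.1⟩) ?_ ?_ ?_ ?_
  · rintro ⟨j, k⟩ h
    simp only [Finset.mem_sigma, Finset.mem_erase] at h
    rcases lt_or_gt_of_ne h.2.1 with h' | h'
    · rw [add_comm]; exact hf k j h.2.2 h.1 h'
    · exact hf j k h.1 h.2.2 h'
  · rintro ⟨j, k⟩ h _ h'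
    simp only [Finset.mem_sigma, Finset.mem_erase] at h
    simp only [Sigma.mk.injEq] at h'
    exact h.2.1 h'.1
  · rintro ⟨j, k⟩ h
    simp only [Finset.mem_sigma, Finset.mem_erase] at h ⊢
    exact ⟨h.2.2, h.2.1.symm, h.1⟩
  · rintro ⟨j, k⟩ h
    rfl

section main
variable {R : Type u} [CommRing R] {T : Type u} [CommRing T] [Algebra R T]

lemma tmul_mk_eq_zero (J : Ideal R) {t : T} {a : R} 
    (h : t * algebraMap R T a ∈ J.map (algebraMap R T)) :
    t ⊗ₜ[R] (Ideal.Quotient.mk J a) = 0 := by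
  have key : ∀ c ∈ J.map (algebraMap R T), c ⊗ₜ[R] (Ideal.Quotient.mk J 1) = 0 := by
    intro c hc
    rw [Ideal.map] at hc
    induction hc using Submodule.span_induction with
    | mem c hc =>
      obtain ⟨b, hb, rfl⟩ := hc
      rw [Algebra.algebraMap_eq_smul_one, TensorProduct.smul_tmul]
      have : b • (Ideal.Quotient.mk J 1) = Ideal.Quotient.mk J (b * 1) := rfl
      rw [this, mul_one, Ideal.Quotient.eq_zero_iff_mem.2 hb, tmul_zero]
    | zero => simp
    | add a b _ _ ha hb => rw [add_tmul, ha, hb, add_zero]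
    | smul a b _ hb => 
      have := congrArg (fun y => a • y) hb
      simpa [smul_tmul'] using this
  have := key _ h
  rw [mul_comm, ← Algebra.smul_def, TensorProduct.smul_tmul] at this
  have h2 : a • (Ideal.Quotient.mk J 1) = Ideal.Quotient.mk J (a * 1) := rfl
  rwa [h2, mul_one] at this

lemma tmul_one_colon_eq_zero [Module.Flat R T] (J I : Ideal R) (hI : I.FG) {t : T}
    (h : ∀ a ∈ I, t * algebraMap R T a ∈ J.map (algebraMap R T)) :
    t ⊗ₜ[R] (Ideal.Quotient.mk (J.colon I) 1) = 0 := by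
  obtain ⟨s, hs⟩ := hI
  let ρ : R →ₗ[R] (s → R ⧸ J) := LinearMap.pi fun a => 
    (Ideal.Quotient.mkₐ R J).toLinearMap ∘ₗ LinearMap.mulRight R (a : R)
  have hρ : ∀ r i, ρ r i = Ideal.Quotient.mk J (r * i) := fun r i => rfl
  have hker : J.colon I = LinearMap.ker ρ := by
    ext r
    rw [LinearMap.mem_ker, Submodule.mem_colon]
    constructor
    · intro h
      ext i
      rw [hρ]
      exact Ideal.Quotient.eq_zero_iff_mem.2 (h _ (hs ▸ Ideal.subset_span i.2))
    · intro h p hp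
      rw [← hs] at hp
      induction hp using Submodule.span_induction with
      | mem c hc => exact Ideal.Quotient.eq_zero_iff_mem.1 (congrFun h ⟨c, hc⟩)
      | zero => simp
      | add a b _ _ ha hb => rw [smul_add]; exact add_mem ha hb
      | smul a b _ hb => rw [smul_comm]; exact Submodule.smul_mem _ _ hb
  let ρ' : (R ⧸ J.colon I) →ₗ[R] (s → R ⧸ J) := Submodule.liftQ _ ρ hker.le
  have hinj : Function.Injective ρ' := by
    rw [← LinearMap.ker_eq_bot]
    exact Submodule.ker_liftQ_eq_bot _ _ _ hker.ge
  have h2 := Module.Flat.lTensor_preserves_injective_linearMap (M := T) ρ' hinj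
  apply h2
  rw [map_zero, LinearMap.lTensor_tmul]
  classical
  have : ρ' (Ideal.Quotient.mk (J.colon I) 1) =
      ∑ i : s, LinearMap.single R (fun _ => R ⧸ J) i (Ideal.Quotient.mk J i) := by
    have : ρ' (Ideal.Quotient.mk (J.colon I) 1) = ρ 1 := rfl
    rw [this]
    ext i
    simp [hρ, Finset.sum_apply, Pi.single_apply]
  rw [this, tmul_sum]
  refine Finset.sum_eq_zero fun i _ => ?_
  rw [← LinearMap.lTensor_tmul, tmul_mk_eq_zero, map_zero]
  exact h _ (hs ▸ Ideal.subset_span i.2)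

end main

end CanonicalElement

namespace CanonicalElement
open TensorProduct

/-- A vector outside `N + m M`, with `M` projective, is detected by a functional to `R`. -/
lemma exists_functional {R : Type u} [CommRing R] [IsLocalRing R] {M : Type*} [AddCommGroup M]
    [Module R M] [Module.Projective R M] (N : Submodule R M) (v : M)
    (hv : v ∉ N ⊔ maximalIdeal R • (⊤ : Submodule R M)) :
    ∃ π : M →ₗ[R] R, IsUnit (π v) ∧ ∀ n ∈ N, π n ∈ maximalIdeal R := by
  set N' := N ⊔ maximalIdeal R • (⊤ : Submodule R M)
  have htors : Module.IsTorsionBySet R (M ⧸ N') (maximalIdeal R) := by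
    intro q a
    obtain ⟨q, rfl⟩ := N'.mkQ_surjective q
    rw [← map_smul, Submodule.mkQ_apply, Submodule.Quotient.mk_eq_zero]
    exact le_sup_right (a := N) (Submodule.smul_mem_smul a.2 trivial)
  let := htors.module
  let : Field (R ⧸ maximalIdeal R) := Ideal.Quotient.field _
  have hne : N'.mkQ v ≠ 0 := by
    rwa [Submodule.mkQ_apply, Ne, Submodule.Quotient.mk_eq_zero]
  obtain ⟨f, hf⟩ : ∃ f : Module.Dual (R ⧸ maximalIdeal R) (M ⧸ N'), f (N'.mkQ v) ≠ 0 := by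
    by_contra! h
    exact hne ((Module.forall_dual_apply_eq_zero_iff _ _).1 h)
  have : IsScalarTower R (R ⧸ maximalIdeal R) (M ⧸ N') := htors.isScalarTower
  let g : M →ₗ[R] (R ⧸ maximalIdeal R) := (f.restrictScalars R) ∘ₗ N'.mkQ
  obtain ⟨π, hπ⟩ := Module.projective_lifting_property (maximalIdeal R).mkQ g
    (Submodule.mkQ_surjective _)
  have h : ∀ m, Ideal.Quotient.mk (maximalIdeal R) (π m) = g m := fun m => LinearMap.congr_fun hπ m
  refine ⟨π, ?_, ?_⟩
  · by_contra hu
    exact hf ((h v).symm.trans (Ideal.Quotient.eq_zero_iff_mem.2 hu))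
  · intro n hn
    rw [← Ideal.Quotient.eq_zero_iff_mem, h]
    have : N'.mkQ n = 0 := by
      rw [Submodule.mkQ_apply, Submodule.Quotient.mk_eq_zero]
      exact le_sup_left (a := N) hn
    simp [g, this]

theorem koszulTorMapZero_of_flat {R T : Type u} [CommRing R] [IsLocalRing R] [IsNoetherianRing R]
    [CommRing T] [Algebra R T] [Module.Flat R T] (j : R →+* T)
    (hj : ∀ a, j a ∣ algebraMap R T a) {d : ℕ} (x : Fin d → R) (I : Ideal R) (w : R)
    (hw : ∀ a ∈ I, w * a ∈ Ideal.span (Set.range x))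
    (hjw : j w ∉ (Ideal.span (Set.range x)).map j ⊔ (maximalIdeal R).map (algebraMap R T)) :
    KoszulTorMapZero R x ((Ideal.span (Set.range x)).colon I) d := by
  intro P L v
  by_contra hv
  have := P.projective
  obtain ⟨π, hπ, hπ'⟩ := exists_functional _ _ hv
  choose z hz using fun i => hj (x i)
  let G : ℕ → Type u := fun n => T ⊗[R] P.F n
  let D : ∀ n, G (n + 1) →ₗ[T] G n := fun n => (P.d n).baseChange T
  let c : Finset (Fin d) → T := fun S => j w * ∏ i ∈ Sᶜ, z i
  let α : ∀ n, KMod T d n →ₗ[T] G n := fun n =>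
    Finsupp.linearCombination T (fun S : KIdx d n => c S.1 • (1 ⊗ₜ L.ψ n (Finsupp.single S 1)))
  have hα1 : ∀ n S, α n (Finsupp.single S 1) = c S.1 • (1 ⊗ₜ L.ψ n (Finsupp.single S 1)) := by
    intro n S
    simp [α]
  have hα2 : ∀ n S, α n (koszulE T d n S) = c S • (1 ⊗ₜ L.ψ n (koszulE R d n S)) := by
    intro n S
    by_cases h : S.card = n
    · simp only [koszulE, dif_pos h, hα1]
    · simp only [koszulE, dif_neg h, map_zero, tmul_zero, smul_zero]
  have hα : ∀ n, α n ∘ₗ koszulD T (fun i => j (x i)) n = D n ∘ₗ α (n + 1) := by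
    intro n
    ext S : 2
    simp only [LinearMap.comp_apply, Finsupp.lsingle_apply]
    rw [koszulD_single_eq, hα1, map_smul, map_sum]
    have h1 : D n (1 ⊗ₜ L.ψ (n + 1) (Finsupp.single S 1)) =
        1 ⊗ₜ L.ψ n (koszulD R x n (Finsupp.single S 1)) := by
      have := LinearMap.congr_fun (L.comm n) (Finsupp.single S 1)
      simp only [LinearMap.comp_apply] at this
      rw [this]
      rfl
    rw [h1, koszulD_single_eq, map_sum, tmul_sum, Finset.smul_sum]
    refine Finset.sum_congr rfl fun i hi => ?_
    rw [map_smul, hα2, map_smul, ← smul_tmul, Algebra.smul_def, mul_one]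
    have h2 : c (S.1.erase i) = c S.1 * z i := by
      simp only [c]
      rw [Finset.compl_erase, Finset.prod_insert (by simpa using hi)]
      ring
    have h3 : ∀ (a : T) (m : P.F n), a ⊗ₜ[R] m = a • ((1 : T) ⊗ₜ[R] m) := by
      intro a m
      rw [TensorProduct.smul_tmul', smul_eq_mul, mul_one]
    rw [h3 (algebraMap R T _), smul_smul, smul_smul, h2]
    congr 1
    rw [map_mul, hz, map_pow, map_neg, map_one]
    ring
  have hD : ∀ n, LinearMap.ker (D n) ≤ LinearMap.range (D (n + 1)) := by
    intro n y hy
    have hex : Function.Exact (P.d (n + 1)) (P.d n) := LinearMap.exact_iff.2 (P.exact n)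
    exact (Module.Flat.lTensor_exact T hex y).1 hy
  have hx0 : ∀ a ∈ I, (c ∅) * algebraMap R T a ∈
      (Ideal.span (Set.range x)).map (algebraMap R T) := by
    intro a ha
    obtain ⟨t, ht⟩ := hj a
    have h1 : j (w * a) * (t * ∏ i, z i) ∈ (Ideal.span (Set.range x)).map (algebraMap R T) := by
      have h2 := Ideal.mem_map_of_mem j (hw a ha)
      have h3 : (Ideal.span (Set.range x)).map j ≤ 
          Submodule.comap (LinearMap.mulRight T (∏ i, z i))
            ((Ideal.span (Set.range x)).map (algebraMap R T)) := by
        rw [Ideal.map_span, Submodule.span_le]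
        rintro _ ⟨_, ⟨i, rfl⟩, rfl⟩
        simp only [Submodule.comap_coe, Set.mem_preimage, LinearMap.mulRight_apply, SetLike.mem_coe]
        rw [← Finset.mul_prod_erase _ _ (Finset.mem_univ i), ← mul_assoc, ← hz]
        exact Ideal.mul_mem_right _ _ (Ideal.mem_map_of_mem _ (Ideal.subset_span ⟨i, rfl⟩))
      have h4 := h3 h2
      simp only [Submodule.mem_comap, LinearMap.mulRight_apply] at h4
      have := Ideal.mul_mem_left _ t h4
      convert this using 1
      ring
    convert h1 using 1
    simp only [c, Finset.compl_empty, ht, map_mul]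
    ring
  have h0 : LinearMap.range (α 0) ≤ LinearMap.range (D 0) := by
    have hex : Function.Exact (P.d 0) P.ε := LinearMap.exact_iff.2 P.exact0
    have hex' := Module.Flat.lTensor_exact T hex
    rw [Finsupp.range_linearCombination, Submodule.span_le]
    rintro _ ⟨S, rfl⟩
    refine (hex' _).1 ?_
    have hS : S = ⟨∅, rfl⟩ := Subtype.ext (Finset.card_eq_zero.1 S.2)
    have h1 : Finsupp.single S (1 : R) ⟨∅, rfl⟩ = 1 := by rw [hS]; exact Finsupp.single_eq_same
    have h2 : c S.1 = c ∅ := by rw [hS]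
    change LinearMap.lTensor T P.ε (c S.1 • (1 ⊗ₜ L.ψ 0 (Finsupp.single S 1))) = 0
    rw [h2, smul_tmul', LinearMap.lTensor_tmul, L.aug, h1, smul_eq_mul, mul_one]
    exact tmul_one_colon_eq_zero _ _ (IsNoetherian.noetherian I) hx0
  let pT : G d →ₗ[T] T := LinearMap.liftBaseChange T (Algebra.linearMap R T ∘ₗ π)
  have hpT : ∀ t f, pT (t ⊗ₜ f) = t * algebraMap R T (π f) := by
    intro t f
    rw [LinearMap.liftBaseChange_tmul]; rfl
  have hpD : ∀ y, pT (D d y) ∈ (maximalIdeal R).map (algebraMap R T) := by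
    intro y
    induction y using TensorProduct.induction_on with
    | zero => simp
    | tmul t f =>
      have : D d (t ⊗ₜ f) = t ⊗ₜ P.d d f := rfl
      rw [this, hpT]
      exact Ideal.mul_mem_left _ _ (Ideal.mem_map_of_mem _ (hπ' _ ⟨f, rfl⟩))
    | add a b ha hb => rw [map_add, map_add]; exact add_mem ha hb
  let top : KIdx d d := ⟨Finset.univ, by simp⟩
  have hu : IsUnit (π (L.ψ d (Finsupp.single top 1))) := by
    have : v = v top • Finsupp.single top 1 := by
      ext S
      have hS : S = top := Subtype.ext ((Finset.card_eq_iff_eq_univ _).1 (by simp [S.2]))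
      simp [hS]
    rw [this, map_smul, map_smul, smul_eq_mul] at hπ
    exact isUnit_of_mul_isUnit_right hπ
  have hpα : pT (α d (Finsupp.single top 1)) ∉ 
      (Ideal.span (Set.range x)).map j ⊔ (maximalIdeal R).map (algebraMap R T) := by
    rw [hα1, map_smul, hpT, one_mul, smul_eq_mul]
    intro hmem
    rw [Ideal.mul_unit_mem_iff_mem _ (hu.map _)] at hmem
    simp [c, top] at hmem
    exact hjw hmem
  refine hpα ?_
  clear_value pT
  cases d with
  | zero =>
    obtain ⟨y, hy⟩ := h0 ⟨Finsupp.single top 1, rfl⟩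
    rw [← hy]
    exact Ideal.mem_sup_right (hpD y)
  | succ n =>
    obtain ⟨h, hh⟩ := exists_homotopy (koszulD T (fun i => j (x i))) D α 
      (koszulD_comp _) hD hα h0 n
    obtain ⟨y, hy⟩ := hD n (LinearMap.congr_fun hh (Finsupp.single top 1))
    have : α (n + 1) (Finsupp.single top 1) = D (n + 1) y + 
        h (koszulD T (fun i => j (x i)) n (Finsupp.single top 1)) := by
      rw [hy]; simp
    rw [this, map_add]
    refine add_mem (Ideal.mem_sup_right (hpD y)) (Ideal.mem_sup_left ?_)
    rw [koszulD_single_eq, map_sum, map_sum]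
    refine sum_mem fun i _ => ?_
    rw [map_smul, map_smul, smul_eq_mul]
    refine Ideal.mul_mem_right _ _ (Ideal.mul_mem_left _ _ ?_)
    exact Ideal.mem_map_of_mem _ (Ideal.subset_span ⟨i, rfl⟩)

end CanonicalElement

namespace CanonicalElement

lemma ofList_ofFn {R : Type*} [CommRing R] {d : ℕ} (x : Fin d → R) :
    Ideal.ofList (List.ofFn x) = Ideal.span (Set.range x) := by
  rw [Ideal.ofList]
  congr 1
  ext; simp [List.mem_ofFn, eq_comm]

/-- If `x` is a regular sequence of length `dim R_P` in `P`, then `P` is minimal over `(x)`. -/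
lemma mem_minimalPrimes_of_isRegular {R : Type u} [CommRing R] [IsNoetherianRing R] {d : ℕ}
    (x : Fin d → R) (hx : RingTheory.Sequence.IsRegular R (List.ofFn x)) (P : Ideal R) [P.IsPrime]
    (hxP : ∀ i, x i ∈ P) (hP : ringKrullDim (Localization.AtPrime P) = d) :
    P ∈ (Ideal.span (Set.range x)).minimalPrimes := by
  set J := Ideal.span (Set.range x)
  let S := Localization.AtPrime P
  have hreg : RingTheory.Sequence.IsRegular S ((List.ofFn x).map (algebraMap R S)) :=
    hx.toIsWeaklyRegular.isRegular_of_isLocalization_of_mem S P (by simpa [List.mem_ofFn] using hxP)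
  have hdim := ringKrullDim_add_length_eq_ringKrullDim_of_isRegular _ hreg
  rw [← Ideal.map_ofList, ofList_ofFn, List.length_map, List.length_ofFn, hP] at hdim
  have h0 : ringKrullDim (S ⧸ J.map (algebraMap R S)) = 0 := by
    have : ringKrullDim (S ⧸ J.map (algebraMap R S)) + d = 0 + d := by rw [zero_add]; exact hdim
    generalize ringKrullDim (S ⧸ J.map (algebraMap R S)) = a at this
    induction a using WithBot.recBotCoe with
    | bot => simp at this
    | coe a =>
      cases a using ENat.recTopCoe with
      | top => exact absurd this (by simp; exact fun h => by cases h)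
      | coe a => norm_cast at this ⊢; omega
  refine ⟨⟨inferInstance, Ideal.span_le.2 (by rintro _ ⟨i, rfl⟩; exact hxP i)⟩, ?_⟩
  rintro Q ⟨hQ, hJQ⟩ hQP
  have : Ring.KrullDimLE 0 (S ⧸ J.map (algebraMap R S)) := (Ring.krullDimLE_iff).2 h0.le
  have hdisj : Disjoint (P.primeCompl : Set R) Q := by
    rw [Set.disjoint_left]
    exact fun a ha hb => ha (hQP hb)
  have hQ1 := IsLocalization.isPrime_of_isPrime_disjoint P.primeCompl S Q hQ hdisj
  have hle : J.map (algebraMap R S) ≤ Q.map (algebraMap R S) := Ideal.map_mono hJQ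
  let Q' := (Q.map (algebraMap R S)).map (Ideal.Quotient.mk (J.map (algebraMap R S)))
  have hQ2 : Q'.IsPrime := Ideal.map_isPrime_of_surjective Ideal.Quotient.mk_surjective
    (by rwa [Ideal.mk_ker])
  have hQ3 : Q'.IsMaximal := Ideal.IsPrime.isMaximal' hQ2
  have hQ4 : (Q'.comap (Ideal.Quotient.mk _)).IsMaximal :=
    Ideal.comap_isMaximal_of_surjective _ Ideal.Quotient.mk_surjective
  have hQ5 : Q'.comap (Ideal.Quotient.mk _) = Q.map (algebraMap R S) := by
    rw [Ideal.comap_map_of_surjective _ Ideal.Quotient.mk_surjective, ← RingHom.ker_eq_comap_bot,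
      Ideal.mk_ker, sup_eq_left.2 hle]
  rw [hQ5] at hQ4
  have h6 := IsLocalRing.eq_maximalIdeal hQ4
  intro a ha
  have h7 : algebraMap R S a ∈ Q.map (algebraMap R S) := by
    rw [h6]
    exact (IsLocalization.AtPrime.to_map_mem_maximal_iff S P a).2 ha
  have h8 := IsLocalization.under_map_of_isPrime_disjoint P.primeCompl S hQ hdisj
  rw [← h8]
  exact h7

/-- A minimal prime `P` of `J` is of the form `J : u`. -/
lemma exists_colon_eq_of_mem_minimalPrimes {R : Type u} [CommRing R] [IsNoetherianRing R]
    {J P : Ideal R} (hP : P ∈ J.minimalPrimes) : ∃ u, ∀ a, a * u ∈ J ↔ a ∈ P := by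
  have hass : P ∈ associatedPrimes R (R ⧸ J) := by
    apply Module.associatedPrimes.minimalPrimes_annihilator_subset_associatedPrimes
    rwa [Ideal.annihilator_quotient]
  obtain ⟨-, q, hq⟩ := isAssociatedPrime_iff.1 hass
  obtain ⟨w, rfl⟩ := Ideal.Quotient.mk_surjective q
  refine ⟨w, fun a => ?_⟩
  rw [hq, Submodule.mem_colon_singleton, Submodule.mem_bot, ← Ideal.Quotient.eq_zero_iff_mem]
  rfl

lemma exists_notMem_forall_mul_mem {R : Type u} [CommRing R] [IsNoetherianRing R] {I : Ideal R}
    {d : ℕ} (hht : HeightEq R I d) (x : Fin d → R) (hxI : ∀ j, x j ∈ I)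
    (hx : RingTheory.Sequence.IsRegular R (List.ofFn x)) :
    ∃ w ∉ Ideal.span (Set.range x), ∀ a ∈ I, w * a ∈ Ideal.span (Set.range x) := by
  obtain ⟨⟨P, hP, hIP, hdim⟩, -⟩ := hht
  have hmin := mem_minimalPrimes_of_isRegular x hx P (fun i => hIP (hxI i)) hdim
  set J := Ideal.span (Set.range x)
  obtain ⟨u, hu⟩ := exists_colon_eq_of_mem_minimalPrimes hmin
  refine ⟨u, fun h => hP.ne_top ((Ideal.eq_top_iff_one P).2 ((hu 1).1 (by rwa [one_mul]))), ?_⟩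
  intro a ha
  rw [mul_comm]
  exact (hu a).2 (hIP ha)

end CanonicalElement

namespace CanonicalElement
open scoped Pointwise

/-- `R` is Noetherian of dimension at least `n` with maximal ideal generated by `n` elements. -/
def RegDim (R : Type*) [CommRing R] [IsLocalRing R] (n : ℕ) : Prop :=
  IsNoetherianRing R ∧ (∃ y : Fin n → R, Ideal.span (Set.range y) = maximalIdeal R) ∧
    (n : WithBot ℕ∞) ≤ ringKrullDim R

lemma isLocalRing_quotient {R : Type*} [CommRing R] [IsLocalRing R] {I : Ideal R}
    (hI : I ≤ maximalIdeal R) : IsLocalRing (R ⧸ I) := by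
  have : Nontrivial (R ⧸ I) := Ideal.Quotient.nontrivial_iff.2 fun h =>
    (maximalIdeal.isMaximal R).ne_top (top_le_iff.1 (h ▸ hI))
  exact IsLocalRing.of_surjective' _ Ideal.Quotient.mk_surjective

lemma map_maximalIdeal_quotient {R : Type*} [CommRing R] [IsLocalRing R] (I : Ideal R)
    [IsLocalRing (R ⧸ I)] :
    (maximalIdeal R).map (Ideal.Quotient.mk I) = maximalIdeal (R ⧸ I) := by
  have := Ideal.comap_isMaximal_of_surjective (Ideal.Quotient.mk I) Ideal.Quotient.mk_surjective
    (K := maximalIdeal (R ⧸ I))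
  rw [← IsLocalRing.eq_maximalIdeal this,
    Ideal.map_comap_of_surjective _ Ideal.Quotient.mk_surjective]

lemma RegDim.dim_eq {R : Type*} [CommRing R] [IsLocalRing R] {n : ℕ} (h : RegDim R n) :
    ringKrullDim R = n := by
  obtain ⟨_, ⟨y, hy⟩, hd⟩ := h
  refine le_antisymm ?_ hd
  refine (ringKrullDim_le_spanFinrank_maximalIdeal R).trans ?_
  rw [← hy]
  have := Submodule.spanFinrank_span_le_ncard_of_finite (R := R) (Set.finite_range y)
  have h2 : (Set.range y).ncard ≤ n := by
    rw [← Set.image_univ]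
    exact (Set.ncard_image_le).trans (by simp [Set.ncard_univ])
  exact_mod_cast this.trans h2

lemma RegDim.quot {R : Type*} [CommRing R] [IsLocalRing R] {n : ℕ} (h : RegDim R (n + 1)) {x : R}
    (hx : x ∈ maximalIdeal R) (hx2 : x ∉ maximalIdeal R ^ 2) [IsLocalRing (R ⧸ Ideal.span {x})] :
    RegDim (R ⧸ Ideal.span {x}) n := by
  obtain ⟨_, ⟨y, hy⟩, hd⟩ := h
  refine ⟨inferInstance, ?_, ?_⟩
  · have hx' := hx
    rw [← hy, Ideal.mem_span_range_iff_exists_fun] at hx'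
    obtain ⟨c, hc⟩ := hx'
    have hym : ∀ i, y i ∈ maximalIdeal R := fun i => hy ▸ Ideal.subset_span ⟨i, rfl⟩
    obtain ⟨i, hi⟩ : ∃ i, c i ∉ maximalIdeal R := by
      by_contra! hcon
      refine hx2 (hc ▸ Ideal.sum_mem _ fun i _ => ?_)
      rw [pow_two]
      exact Ideal.mul_mem_mul (hcon i) (hym i)
    have hu : IsUnit (c i) := by simpa using hi
    refine ⟨fun j => Ideal.Quotient.mk _ (y (i.succAbove j)), ?_⟩
    rw [← map_maximalIdeal_quotient, ← hy, Ideal.map_span]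
    apply le_antisymm
    · refine Ideal.span_mono ?_
      rintro _ ⟨j, rfl⟩
      exact ⟨_, ⟨_, rfl⟩, rfl⟩
    · rw [Ideal.span_le]
      rintro _ ⟨_, ⟨k, rfl⟩, rfl⟩
      rcases Fin.eq_self_or_eq_succAbove i k with rfl | ⟨j, rfl⟩
      · rw [Fin.sum_univ_succAbove _ k] at hc
        have h0 : Ideal.Quotient.mk (Ideal.span {x}) x = 0 := by
          simp
        replace hc := congrArg (Ideal.Quotient.mk (Ideal.span {x})) hc
        rw [h0, map_add, map_mul, map_sum] at hc
        have h1 := (hu.map (Ideal.Quotient.mk (Ideal.span {x})))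
        rw [SetLike.mem_coe, ← Ideal.unit_mul_mem_iff_mem _ h1, eq_neg_of_add_eq_zero_left hc]
        refine neg_mem (Ideal.sum_mem _ fun j _ => ?_)
        rw [map_mul]
        exact Ideal.mul_mem_left _ _ (Ideal.subset_span ⟨j, rfl⟩)
      · exact Ideal.subset_span ⟨j, rfl⟩
  · have h1 := ringKrullDim_le_ringKrullDim_quotSMulTop_succ hx
    have h2 : x • (⊤ : Ideal R) = Ideal.span {x} := by
      rw [← Submodule.ideal_span_singleton_smul]; simp
    rw [h2] at h1
    have := hd.trans h1
    generalize ringKrullDim (R ⧸ Ideal.span {x}) = a at this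
    induction a using WithBot.recBotCoe with
    | bot => simp at this
    | coe a =>
      cases a using ENat.recTopCoe with
      | top => exact WithBot.coe_le_coe.2 le_top
      | coe a => norm_cast at this ⊢; omega

lemma RegDim.maximalIdeal_notMem_minimalPrimes {R : Type*} [CommRing R] [IsLocalRing R] {n : ℕ}
    (h : RegDim R (n + 1)) : maximalIdeal R ∉ minimalPrimes R := by
  intro hm
  have h1 := Ideal.height_eq_zero_iff.2 hm
  have := IsLocalRing.maximalIdeal_height_eq_ringKrullDim (R := R)
  rw [h1, h.dim_eq] at this
  norm_cast at this

lemma RegDim.exists_mem_notMem_sq {R : Type*} [CommRing R] [IsLocalRing R] {n : ℕ}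
    (h : RegDim R (n + 1)) :
    ∃ x ∈ maximalIdeal R, x ∉ maximalIdeal R ^ 2 ∧ ∀ p ∈ minimalPrimes R, x ∉ p := by
  have hN := h.1
  by_contra! hcon
  have hfin := minimalPrimes.finite_of_isNoetherianRing R
  have hsub : (maximalIdeal R : Set R) ⊆
      ⋃ I ∈ ((insert (maximalIdeal R ^ 2) (minimalPrimes R)) : Set (Ideal R)), (I : Set R) := by
    intro x hx
    simp only [Set.mem_iUnion]
    by_cases hx2 : x ∈ maximalIdeal R ^ 2
    · exact ⟨_, Set.mem_insert _ _, hx2⟩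
    · obtain ⟨p, hp, hxp⟩ := hcon x hx hx2
      exact ⟨p, Set.mem_insert_of_mem _ hp, hxp⟩
  obtain ⟨I, hI, hle⟩ := (Ideal.subset_union_prime_finite (hfin.insert _)
    (maximalIdeal R ^ 2) (maximalIdeal R ^ 2) (f := id) (fun i hi h1 _ => by
      rcases Set.mem_insert_iff.1 hi with rfl | hi
      · exact absurd rfl h1
      · exact hi.1.1)).1 hsub
  rcases Set.mem_insert_iff.1 hI with rfl | hI
  · have hbot : maximalIdeal R = ⊥ := by
      refine Submodule.eq_bot_of_le_smul_of_le_jacobson_bot (maximalIdeal R) _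
        (IsNoetherian.noetherian _) ?_ (IsLocalRing.jacobson_eq_maximalIdeal _ bot_ne_top).ge
      simpa [pow_two] using hle
    apply h.maximalIdeal_notMem_minimalPrimes
    refine ⟨⟨inferInstance, bot_le⟩, fun q _ _ => by simp [hbot]⟩
  · apply h.maximalIdeal_notMem_minimalPrimes
    have : I = maximalIdeal R := le_antisymm (IsLocalRing.le_maximalIdeal hI.1.1.ne_top) hle
    rwa [← this]

lemma RegDim.isDomain {R : Type*} [CommRing R] [IsLocalRing R] {n : ℕ} (h : RegDim R n) :
    IsDomain R := by
  induction n generalizing R with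
  | zero =>
    obtain ⟨_, ⟨y, hy⟩, _⟩ := h
    have : maximalIdeal R = ⊥ := by rw [← hy]; simp
    have := IsLocalRing.isField_iff_maximalIdeal_eq.2 this
    exact this.isDomain
  | succ n ih =>
    have hN := h.1
    obtain ⟨x, hx, hx2, hxp⟩ := h.exists_mem_notMem_sq
    have := isLocalRing_quotient (I := Ideal.span {x}) (by simpa [Ideal.span_le] using hx)
    have := ih (h.quot hx hx2)
    have hprime : (Ideal.span {x}).IsPrime := (Ideal.Quotient.isDomain_iff_prime _).1 this
    obtain ⟨p, hp, hle⟩ := Ideal.exists_minimalPrimes_le (bot_le : ⊥ ≤ Ideal.span {x})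
    have hpp := hp.1.1
    have : p = ⊥ := by
      refine Submodule.eq_bot_of_le_smul_of_le_jacobson_bot (maximalIdeal R) _
        (IsNoetherian.noetherian _) ?_ (IsLocalRing.jacobson_eq_maximalIdeal _ bot_ne_top).ge
      intro a ha
      obtain ⟨b, rfl⟩ := Ideal.mem_span_singleton.1 (hle ha)
      exact Submodule.smul_mem_smul hx ((hpp.mem_or_mem ha).resolve_left (hxp p hp))
    rw [this] at hpp
    exact (IsDomain.of_bot_isPrime R)

end CanonicalElement

namespace CanonicalElement
open scoped Pointwise
open RingTheory.Sequence

lemma add_one_le_ringKrullDim_quotient {R : Type*} [CommRing R] {P Q : Ideal R} [P.IsPrime]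
    (h : P < Q) : ringKrullDim (R ⧸ Q) + 1 ≤ ringKrullDim (R ⧸ P) := by
  obtain ⟨hle, x, hxQ, hxP⟩ := SetLike.lt_iff_le_and_exists.1 h
  have hx0 : Ideal.Quotient.mk P x ∈ nonZeroDivisors (R ⧸ P) :=
    mem_nonZeroDivisors_of_ne_zero (by rwa [Ne, Ideal.Quotient.eq_zero_iff_mem])
  refine le_trans ?_ (ringKrullDim_quotient_succ_le_of_nonZeroDivisor hx0)
  gcongr
  refine ringKrullDim_le_of_surjective (Ideal.Quotient.lift (Ideal.span {Ideal.Quotient.mk P x})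
    (Ideal.Quotient.factor hle) ?_) ?_
  · intro a ha
    have : Ideal.span {Ideal.Quotient.mk P x} ≤ RingHom.ker (Ideal.Quotient.factor hle) := by
      rw [Ideal.span_singleton_le_iff_mem]
      simpa [RingHom.mem_ker, Ideal.Quotient.eq_zero_iff_mem] using hxQ
    exact this ha
  · exact Ideal.Quotient.lift_surjective_of_surjective _ _
      (Ideal.Quotient.factor_surjective hle)

lemma length_le_ringKrullDim_quotient {R : Type u} [CommRing R] [IsLocalRing R]
    [IsNoetherianRing R] {M : Type u} [AddCommGroup M] [Module R M] [Module.Finite R M]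
    (rs : List R) (hrs : ∀ r ∈ rs, r ∈ maximalIdeal R) (hreg : IsWeaklyRegular M rs)
    {P : Ideal R} (hP : P ∈ associatedPrimes R M) :
    (rs.length : WithBot ℕ∞) ≤ ringKrullDim (R ⧸ P) := by
  induction rs generalizing M P with
  | nil =>
    have := hP.1
    simpa using ringKrullDim_nonneg_of_nontrivial
  | cons x rs ih =>
    rw [isWeaklyRegular_cons_iff] at hreg
    have hPp := hP.1
    obtain ⟨-, y, hy⟩ := isAssociatedPrime_iff.1 hP
    have hxm : x ∈ maximalIdeal R := hrs x (by simp)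
    have hy' : ∀ a, a ∈ P ↔ a • y = 0 := fun a => by
      rw [hy, Submodule.mem_colon_singleton, Submodule.mem_bot]
    have hy0 : y ≠ 0 := fun h => hPp.ne_top (by ext a; simp [hy', h])
    have hxP : x ∉ P := fun h => hy0 (hreg.1 (by simpa using (hy' x).1 h))
    let N : Submodule R M := ⨅ a : P, LinearMap.ker (LinearMap.lsmul R M a)
    have hN : ∀ m, m ∈ N ↔ ∀ a ∈ P, a • m = 0 := by intro m; simp [N]
    obtain ⟨n, hn, hnx⟩ : ∃ n ∈ N, n ∉ x • (⊤ : Submodule R M) := by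
      by_contra! hcon
      have : N = ⊥ := by
        refine Submodule.eq_bot_of_le_smul_of_le_jacobson_bot (maximalIdeal R) _
          (IsNoetherian.noetherian _) ?_ (IsLocalRing.jacobson_eq_maximalIdeal _ bot_ne_top).ge
        intro n hn
        obtain ⟨m, -, rfl⟩ := hcon n hn
        refine Submodule.smul_mem_smul hxm ((hN m).2 fun a ha => hreg.1 ?_)
        change x • a • m = x • 0
        rw [smul_zero, smul_comm]
        exact (hN _).1 hn a ha
      exact hy0 ((Submodule.mem_bot R).1 (this ▸ (hN y).2 fun a ha => (hy' a).1 ha))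
    have hnb : (Submodule.Quotient.mk n : QuotSMulTop x M) ≠ 0 := by
      rwa [Ne, Submodule.Quotient.mk_eq_zero]
    obtain ⟨Q, hQ, hle⟩ := exists_le_isAssociatedPrime_of_isNoetherianRing R _ hnb
    have hPQ : P < Q := by
      refine SetLike.lt_iff_le_and_exists.2 ⟨fun a ha => hle ?_, x, hle ?_, hxP⟩
      · rw [Submodule.mem_colon_singleton, ← Submodule.Quotient.mk_smul, (hN n).1 hn a ha]
        simp
      · rw [Submodule.mem_colon_singleton, ← Submodule.Quotient.mk_smul, Submodule.mem_bot,
          Submodule.Quotient.mk_eq_zero]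
        exact ⟨n, trivial, rfl⟩
    refine le_trans ?_ (add_one_le_ringKrullDim_quotient hPQ)
    have := ih (fun r hr => hrs r (by simp [hr])) hreg.2 hQ
    push_cast [List.length_cons]
    gcongr

open CategoryTheory CategoryTheory.Abelian in
lemma le_ringKrullDim_quotient_of_ext {R : Type u} [CommRing R] [IsLocalRing R]
    [IsNoetherianRing R] (rs : List R) (n : ℕ) (M : ModuleCat.{u} R) [Module.Finite R M]
    [Nontrivial M]
    (hrs : ∀ r ∈ rs, r ∈ maximalIdeal R) (hreg : IsWeaklyRegular M rs)
    (hext : ∀ i < n + rs.length,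
      Subsingleton (Ext (ModuleCat.of R (ResidueField R)) M i))
    {P : Ideal R} (hP : P ∈ associatedPrimes R (M ⧸ (Ideal.ofList rs • ⊤ : Submodule R M))) :
    (n : WithBot ℕ∞) ≤ ringKrullDim (R ⧸ P) := by
  induction rs generalizing M with
  | nil =>
    have hP' : P ∈ associatedPrimes R M := by
      have h0 : (Ideal.ofList ([] : List R) • ⊤ : Submodule R M) = ⊥ := by
        rw [Ideal.ofList_nil, Submodule.bot_smul]
      rw [← LinearEquiv.AssociatedPrimes.eq (Submodule.quotEquivOfEqBot _ h0)]
      exact hP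
    have hlt : maximalIdeal R • (⊤ : Submodule R M) < ⊤ := by
      refine lt_top_iff_ne_top.2 fun h => ?_
      exact Submodule.top_ne_ideal_smul_of_le_jacobson_annihilator
        (IsLocalRing.maximalIdeal_le_jacobson (Module.annihilator R M)) h.symm
    have hsupp : Module.support R (ResidueField R) = PrimeSpectrum.zeroLocus (maximalIdeal R) := by
      rw [Module.support_eq_zeroLocus]
      congr 1
      exact_mod_cast Ideal.annihilator_quotient
    have : Module.Finite R (ModuleCat.of R (ResidueField R)) :=
      inferInstanceAs (Module.Finite R (R ⧸ maximalIdeal R))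
    obtain ⟨ts, hlen, hts, htreg⟩ := ModuleCat.exists_isRegular_of_exists_subsingleton_ext
      (maximalIdeal R) n M hlt (ModuleCat.of R (ResidueField R)) hsupp
      (fun i hi => hext i (by simpa using hi))
    rw [← hlen]
    exact length_le_ringKrullDim_quotient ts hts htreg.1 hP'
  | cons x rs ih =>
    rw [isWeaklyRegular_cons_iff] at hreg
    have hxm : x ∈ maximalIdeal R := hrs x (by simp)
    have : Nontrivial (QuotSMulTop x M) := nontrivial_quotSMulTop_of_mem_maximalIdeal _ hxm
    refine ih (ModuleCat.of R (QuotSMulTop x M)) (fun r hr => hrs r (by simp [hr])) hreg.2 ?_ ?_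
    · intro i hi
      have zero1 := AddCommGrpCat.isZero_of_iff_subsingleton.mpr
        (hext i (by simp only [List.length_cons]; omega))
      have zero2 := AddCommGrpCat.isZero_of_iff_subsingleton.mpr
        (hext (i + 1) (by simp only [List.length_cons]; omega))
      exact AddCommGrpCat.subsingleton_of_isZero <| ShortComplex.Exact.isZero_of_both_zeros
        ((Ext.covariant_sequence_exact₃' _ hreg.1.smulShortComplex_shortExact) i (i + 1) rfl)
        (zero1.eq_zero_of_src _) (zero2.eq_zero_of_tgt _)
    · rw [← LinearEquiv.AssociatedPrimes.eq
        (Submodule.quotOfListConsSMulTopEquivQuotSMulTopInner M x rs)]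
      exact hP

end CanonicalElement

namespace CanonicalElement
open scoped Pointwise
open RingTheory.Sequence

lemma RegDim.exists_isRegular {R : Type*} [CommRing R] [IsLocalRing R] {n : ℕ} (h : RegDim R n) :
    ∃ rs : List R, rs.length = n ∧ (∀ r ∈ rs, r ∈ maximalIdeal R) ∧ IsWeaklyRegular R rs ∧
      Ideal.ofList rs = maximalIdeal R := by
  induction n generalizing R with
  | zero =>
    obtain ⟨_, ⟨y, hy⟩, _⟩ := h
    exact ⟨[], rfl, by simp, .nil R R, by rw [← hy]; simp⟩
  | succ n ih =>
    have hdom := h.isDomain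
    obtain ⟨x, hx, hx2, -⟩ := h.exists_mem_notMem_sq
    have hx0 : x ≠ 0 := by rintro rfl; simp at hx2
    have := isLocalRing_quotient (I := Ideal.span {x}) (by simpa [Ideal.span_le] using hx)
    obtain ⟨rs, hlen, hrs, hreg, hspan⟩ := ih (h.quot hx hx2)
    choose! l hl using Ideal.Quotient.mk_surjective (I := Ideal.span {x})
    have hmap : (rs.map l).map (algebraMap R (R ⧸ Ideal.span {x})) = rs := by
      rw [List.map_map]
      exact (List.map_congr_left fun a _ => hl a).trans (List.map_id _)
    have hl' : ∀ r ∈ rs, l r ∈ maximalIdeal R := fun r hr => by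
      have h1 := hrs r hr
      rw [← hl r, ← map_maximalIdeal_quotient, Ideal.mem_quotient_iff_mem_sup,
        sup_eq_left.2 (by simpa [Ideal.span_le] using hx)] at h1
      exact h1
    refine ⟨x :: rs.map l, by simp [hlen], ?_, ?_, ?_⟩
    · intro r hr
      rcases List.mem_cons.1 hr with rfl | hr
      · exact hx
      · obtain ⟨a, ha, rfl⟩ := List.mem_map.1 hr
        exact hl' a ha
    · rw [isWeaklyRegular_cons_iff]
      refine ⟨IsSMulRegular.of_ne_zero hx0, ?_⟩
      have e : QuotSMulTop x R ≃ₗ[R] R ⧸ Ideal.span {x} :=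
        Submodule.quotEquivOfEq _ _ (by rw [← Submodule.ideal_span_singleton_smul]; simp)
      rw [e.isWeaklyRegular_congr, ← isWeaklyRegular_map_algebraMap_iff (R ⧸ Ideal.span {x}), hmap]
      exact hreg
    · rw [Ideal.ofList_cons]
      refine le_antisymm (sup_le (by simpa [Ideal.span_le] using hx) (Ideal.span_le.2 ?_)) ?_
      · intro r hr
        obtain ⟨a, ha, rfl⟩ := List.mem_map.1 hr
        exact hl' a ha
      · rw [sup_comm]
        intro r hr
        rw [← Ideal.mem_quotient_iff_mem_sup, Ideal.map_ofList]
        have hmap' : (rs.map l).map (Ideal.Quotient.mk (Ideal.span {x})) = rs := hmap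
        rw [hmap', hspan, ← map_maximalIdeal_quotient]
        exact Ideal.mem_map_of_mem _ hr

open CategoryTheory CategoryTheory.Abelian in
lemma RegDim.subsingleton_ext {R : Type u} [CommRing R] [IsLocalRing R] {n : ℕ} (h : RegDim R n)
    (i : ℕ) (hi : i < n) :
    Subsingleton (Ext (ModuleCat.of R (ResidueField R)) (ModuleCat.of R R) i) := by
  obtain ⟨rs, hlen, hrs, hreg, -⟩ := h.exists_isRegular
  have := h.1
  have hlt : maximalIdeal R • (⊤ : Submodule R R) < ⊤ := by
    refine lt_top_iff_ne_top.2 fun h => ?_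
    exact Submodule.top_ne_ideal_smul_of_le_jacobson_annihilator
      (IsLocalRing.maximalIdeal_le_jacobson (Module.annihilator R R)) h.symm
  have hsupp : Module.support R (ResidueField R) = PrimeSpectrum.zeroLocus (maximalIdeal R) := by
    rw [Module.support_eq_zeroLocus]
    congr 1
    exact_mod_cast Ideal.annihilator_quotient
  have : Module.Finite R (ModuleCat.of R (ResidueField R)) :=
    inferInstanceAs (Module.Finite R (R ⧸ maximalIdeal R))
  exact ModuleCat.subsingleton_ext_of_exists_isRegular (maximalIdeal R)
    (ModuleCat.of R (ResidueField R)) hsupp.subset (ModuleCat.of R R) hlt rs hrs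
    (.of_isWeaklyRegular_of_mem_maximalIdeal _ hrs hreg) i (hlen ▸ hi)

lemma RegDim.isRegular {R : Type*} [CommRing R] [IsLocalRing R]
    {z : List R} (hz : ∀ r ∈ z, r ∈ maximalIdeal R) (hreg : IsWeaklyRegular R z) : IsRegular R z :=
  .of_isWeaklyRegular_of_mem_maximalIdeal _ hz hreg

lemma RegDim.dim_quotient_add {R : Type*} [CommRing R] [IsLocalRing R] {n : ℕ} (h : RegDim R n)
    {z : List R} (hz : ∀ r ∈ z, r ∈ maximalIdeal R) (hreg : IsWeaklyRegular R z) :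
    ringKrullDim (R ⧸ Ideal.ofList z) + z.length = n := by
  have := h.1
  rw [← h.dim_eq]
  exact ringKrullDim_add_length_eq_ringKrullDim_of_isRegular z (RegDim.isRegular hz hreg)

lemma nat_of_add_eq {a : WithBot ℕ∞} {k n : ℕ} (h : a + k = n) : k ≤ n ∧ a = (n - k : ℕ) := by
  induction a using WithBot.recBotCoe with
  | bot => simp at h
  | coe a =>
    cases a using ENat.recTopCoe with
    | top => exact absurd h (by simp; exact fun h => by cases h)
    | coe a =>
      have h' : a + k = n := by exact_mod_cast h
      subst h'
      exact ⟨by omega, by rw [Nat.add_sub_cancel]; rfl⟩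

/-- Regular sequences in a regular local ring are unmixed. -/
lemma RegDim.le_ringKrullDim_quotient {R : Type u} [CommRing R] [IsLocalRing R] {n : ℕ}
    (h : RegDim R n) {z : List R} (hz : ∀ r ∈ z, r ∈ maximalIdeal R) (hreg : IsWeaklyRegular R z)
    {P : Ideal R} (hP : P ∈ associatedPrimes R (R ⧸ (Ideal.ofList z • ⊤ : Submodule R R))) :
    ((n - z.length : ℕ) : WithBot ℕ∞) ≤ ringKrullDim (R ⧸ P) := by
  have := h.1
  have h1 := (nat_of_add_eq (h.dim_quotient_add hz hreg)).1
  exact le_ringKrullDim_quotient_of_ext z (n - z.length) (ModuleCat.of R R) hz hreg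
    (fun i hi => h.subsingleton_ext i (by omega)) hP

lemma le_of_mem_associatedPrimes_quotient {R : Type*} [CommRing R] {I P : Ideal R}
    (hP : P ∈ associatedPrimes R (R ⧸ (I • ⊤ : Submodule R R))) : I ≤ P := by
  have h1 := IsAssociatedPrime.annihilator_le hP
  refine le_trans ?_ h1
  intro a ha
  rw [Module.mem_annihilator]
  intro m
  obtain ⟨⟨m⟩, -⟩ := m
  refine Subtype.ext ?_
  change a • Submodule.Quotient.mk m = 0
  rw [← Submodule.Quotient.mk_smul, Submodule.Quotient.mk_eq_zero]
  exact Submodule.smul_mem_smul ha trivial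

lemma RegDim.exists_append {R : Type u} [CommRing R] [IsLocalRing R] {n : ℕ}
    (h : RegDim R n) (Q : Ideal R) [hQ : Q.IsPrime] (z : List R) (hz : ∀ r ∈ z, r ∈ Q)
    (hreg : IsWeaklyRegular R z) :
    ∃ t : List R, (∀ r ∈ t, r ∈ Q) ∧ IsWeaklyRegular R (z ++ t) ∧
      Q ∈ associatedPrimes R (R ⧸ (Ideal.ofList (z ++ t) • ⊤ : Submodule R R)) := by
  have hQm : Q ≤ maximalIdeal R := IsLocalRing.le_maximalIdeal hQ.ne_top
  have hN := h.1
  obtain ⟨k, hk⟩ : ∃ k, k = n - z.length := ⟨_, rfl⟩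
  induction k using Nat.strong_induction_on generalizing z with
  | _ k ih =>
  by_cases hex : ∃ r ∈ Q, IsSMulRegular (R ⧸ (Ideal.ofList z • ⊤ : Submodule R R)) r
  · obtain ⟨r, hr, hrr⟩ := hex
    have hreg' : IsWeaklyRegular R (z ++ [r]) :=
      (isWeaklyRegular_append_iff _ _ _).2 ⟨hreg, (isWeaklyRegular_singleton_iff _ _).2 hrr⟩
    have hz' : ∀ a ∈ z ++ [r], a ∈ Q := by simpa [or_imp, forall_and, hr] using hz
    have h1 := (nat_of_add_eq (h.dim_quotient_add (fun a ha => hQm (hz' a ha)) hreg')).1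
    rw [List.length_append, List.length_singleton] at h1
    obtain ⟨t, ht, htr, htQ⟩ := ih (n - (z ++ [r]).length) (by
      rw [List.length_append, List.length_singleton]; omega) (z ++ [r]) hz' hreg' rfl
    rw [List.append_assoc] at htr htQ
    exact ⟨[r] ++ t, by simpa [hr] using ht, htr, htQ⟩
  · refine ⟨[], by simp, by simpa using hreg, ?_⟩
    rw [List.append_nil]
    have hfin := associatedPrimes.finite R (R ⧸ (Ideal.ofList z • ⊤ : Submodule R R))
    obtain ⟨P, hP, hQP⟩ := (Ideal.subset_union_prime_finite hfin ⊥ ⊥ (f := id)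
      (fun i hi _ _ => hi.1) (I := Q)).1 (by
        have := biUnion_associatedPrimes_eq_compl_regular R
          (R ⧸ (Ideal.ofList z • ⊤ : Submodule R R))
        simp only [id]
        rw [this]
        exact fun r hr hrr => hex ⟨r, hr, hrr⟩)
    have hPp := hP.1
    have hzm := fun a ha => hQm (hz a ha)
    have hd := h.le_ringKrullDim_quotient hzm hreg hP
    rcases hQP.eq_or_lt with heq | hlt
    · exact heq ▸ hP
    exfalso
    have h1 := add_one_le_ringKrullDim_quotient hlt
    have h2 := (nat_of_add_eq (h.dim_quotient_add hzm hreg)).2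
    have h3 : ringKrullDim (R ⧸ Q) ≤ ringKrullDim (R ⧸ Ideal.ofList z) :=
      ringKrullDim_le_of_surjective (Ideal.Quotient.factor (Ideal.span_le.2 hz))
        (Ideal.Quotient.factor_surjective _)
    rw [h2] at h3
    have h4 := (add_le_add_left hd 1).trans (h1.trans h3)
    norm_cast at h4
    omega

/-- Systems of parameters of a regular local ring are regular sequences. -/
lemma RegDim.isWeaklyRegular_of_le_radical {R : Type u} [CommRing R] [IsLocalRing R] {n : ℕ}
    (h : RegDim R n) (z : List R) (hlen : z.length = n) (hz : ∀ r ∈ z, r ∈ maximalIdeal R)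
    (hrad : maximalIdeal R ≤ (Ideal.ofList z).radical) : IsWeaklyRegular R z := by
  have hN := h.1
  suffices H : ∀ t s : List R, s ++ t = z → IsWeaklyRegular R s → IsWeaklyRegular R z from
    H z [] rfl (.nil R R)
  intro t
  induction t with
  | nil => rintro s hs hreg; rwa [← hs, List.append_nil]
  | cons r t ih =>
    intro s hs hreg
    refine ih (s ++ [r]) (by simpa using hs)
      ((isWeaklyRegular_append_iff _ _ _).2 ⟨hreg, (isWeaklyRegular_singleton_iff _ _).2 ?_⟩)
    by_contra hr
    have hr' : r ∈ ⋃ p ∈ associatedPrimes R (R ⧸ (Ideal.ofList s • ⊤ : Submodule R R)),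
        (p : Set R) := by
      rw [biUnion_associatedPrimes_eq_compl_regular]; exact hr
    simp only [Set.mem_iUnion] at hr'
    obtain ⟨P, hP, hrP⟩ := hr'
    have hPp := hP.1
    have hsm : ∀ a ∈ s, a ∈ maximalIdeal R := fun a ha => hz a (hs ▸ by simp [ha])
    have h1 := h.le_ringKrullDim_quotient hsm hreg hP
    have := isLocalRing_quotient (IsLocalRing.le_maximalIdeal hPp.ne_top)
    have hfin : {a | a ∈ t}.Finite := t.finite_toSet
    let T : Set (R ⧸ P) := Ideal.Quotient.mk P '' {a | a ∈ t}
    have hmin : maximalIdeal (R ⧸ P) ∈ (Ideal.span T).minimalPrimes := by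
      refine ⟨⟨inferInstance, Ideal.span_le.2 ?_⟩, ?_⟩
      · rintro _ ⟨a, ha, rfl⟩
        rw [← map_maximalIdeal_quotient]
        exact Ideal.mem_map_of_mem _ (hz a (hs ▸ by simp [show a ∈ t from ha]))
      · rintro q ⟨hq, hTq⟩ -
        rw [← map_maximalIdeal_quotient, Ideal.map_le_iff_le_comap]
        refine hrad.trans ((Ideal.IsPrime.radical_le_iff (hq.comap _)).2 ?_)
        refine Ideal.span_le.2 fun a ha => ?_
        rw [← hs] at ha
        rw [SetLike.mem_coe, Ideal.mem_comap]
        have hPa : a ∈ P → Ideal.Quotient.mk P a ∈ q := fun h => by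
          rw [Ideal.Quotient.eq_zero_iff_mem.2 h]; exact zero_mem _
        have ha' : a ∈ s ++ r :: t := ha
        rw [List.mem_append, List.mem_cons] at ha'
        rcases ha' with ha | rfl | ha
        · exact hPa (le_of_mem_associatedPrimes_quotient hP (Ideal.subset_span ha))
        · exact hPa hrP
        · exact hTq (Ideal.subset_span ⟨a, ha, rfl⟩)
    have h2 := Ideal.height_le_card_of_mem_minimalPrimes_span (hfin.image _) hmin
    have h3 : T.ncard ≤ t.length := by
      refine (Set.ncard_image_le hfin).trans ?_
      classical
      have : {a | a ∈ t} = (t.toFinset : Set R) := by ext; simp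
      rw [this, Set.ncard_coe_finset]
      exact t.toFinset_card_le
    have h4 := IsLocalRing.maximalIdeal_height_eq_ringKrullDim (R := R ⧸ P)
    rw [← h4] at h1
    have h5 := h1.trans (WithBot.coe_le_coe.2 (h2.trans (Nat.cast_le.2 h3)))
    have h6 : n = s.length + (t.length + 1) := by
      rw [← hlen, ← hs, List.length_append, List.length_cons]
    have h7 : n - s.length ≤ t.length :=
      Nat.cast_le.1 (WithBot.coe_le_coe.1 h5 : ((n - s.length : ℕ) : ℕ∞) ≤ t.length)
    omega

end CanonicalElement

namespace CanonicalElement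
open scoped Pointwise
open RingTheory.Sequence CategoryTheory CategoryTheory.Abelian

section
variable {R : Type u} [CommRing R]

/-- The sequence `R ⧸ (I : a) → R ⧸ I → R ⧸ (I + (a))`. -/
noncomputable def colonSeq {I J : Ideal R} {a : R} (h : ∀ r, r * a ∈ I ↔ r ∈ J) :
    ShortComplex (ModuleCat.{u} R) :=
  ModuleCat.shortComplexOfCompEqZero
    (Submodule.mapQ J I (LinearMap.mulRight R a) (fun r hr => (h r).2 hr))
    (Submodule.factor (le_sup_left : I ≤ I ⊔ Ideal.span {a})) (by
      ext
      exact (Submodule.Quotient.mk_eq_zero _).2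
        (Ideal.mem_sup_right (Ideal.mem_span_singleton'.2 ⟨1, rfl⟩)))

lemma colonSeq_shortExact {I J : Ideal R} {a : R} (h : ∀ r, r * a ∈ I ↔ r ∈ J) :
    (colonSeq h).ShortExact where
  exact := by
    refine ModuleCat.shortComplex_exact _ ?_
    intro y
    obtain ⟨y, rfl⟩ := Submodule.Quotient.mk_surjective _ y
    constructor
    · intro hy
      have hy : y ∈ I ⊔ Ideal.span {a} := (Submodule.Quotient.mk_eq_zero _).1 hy
      obtain ⟨b, hb, c, hc, rfl⟩ := Submodule.mem_sup.1 hy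
      obtain ⟨c, rfl⟩ := Ideal.mem_span_singleton'.1 hc
      refine ⟨Submodule.Quotient.mk c, ?_⟩
      refine (Submodule.Quotient.eq _).2 ?_
      simpa using hb
    · rintro ⟨c, hc⟩
      obtain ⟨c, rfl⟩ := Submodule.Quotient.mk_surjective _ c
      rw [← hc]
      exact (Submodule.Quotient.mk_eq_zero _).2
        (Ideal.mem_sup_right (Ideal.mem_span_singleton'.2 ⟨c, rfl⟩))
  mono_f := by
    refine (ModuleCat.mono_iff_injective _).2 ?_
    refine (injective_iff_map_eq_zero (Submodule.mapQ J I (LinearMap.mulRight R a)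
      (fun r hr => (h r).2 hr))).2 fun c hc => ?_
    obtain ⟨c, rfl⟩ := Submodule.Quotient.mk_surjective _ c
    exact (Submodule.Quotient.mk_eq_zero _).2 ((h c).1 ((Submodule.Quotient.mk_eq_zero _).1 hc))
  epi_g := (ModuleCat.epi_iff_surjective _).2 (Submodule.factor_surjective le_sup_left)

end

lemma RegDim.hasProjectiveDimensionLT {R : Type u} [CommRing R] [IsLocalRing R] {n : ℕ}
    (h : RegDim R n) (I : Ideal R) :
    HasProjectiveDimensionLT (ModuleCat.of R (R ⧸ I)) (n + 1) := by
  have := h.1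
  induction I using WellFoundedGT.induction with
  | _ I ih =>
  rcases eq_or_ne I ⊤ with rfl | htop
  · have : Subsingleton (ModuleCat.of R (R ⧸ (⊤ : Ideal R))) :=
      Submodule.Quotient.subsingleton_iff.2 rfl
    have := (ModuleCat.isZero_of_subsingleton
      (ModuleCat.of R (R ⧸ (⊤ : Ideal R)))).hasProjectiveDimensionLT_zero
    exact hasProjectiveDimensionLT_of_ge _ 0 _ (Nat.zero_le _)
  rcases (IsLocalRing.le_maximalIdeal htop).eq_or_lt with heq | hlt
  · obtain ⟨rs, hlen, hrs, hreg, hspan⟩ := h.exists_isRegular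
    have h1 := ModuleCat.projectiveDimension_quotient_eq_length rs (RegDim.isRegular hrs hreg)
    rw [ModuleCat.projectiveDimension_eq_of_linearEquiv (M := ModuleCat.of R (Shrink.{u} _))
      (N := ModuleCat.of R (R ⧸ I)) ((Shrink.linearEquiv R _).trans
      (Submodule.quotEquivOfEq _ _ (hspan.trans heq.symm)) :
        Shrink.{u} (R ⧸ Ideal.ofList rs) ≃ₗ[R] R ⧸ I), hlen] at h1
    exact (projectiveDimension_le_iff _ _).1 h1.le
  · obtain ⟨hle, a, ham, haI⟩ := SetLike.lt_iff_le_and_exists.1 hlt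
    have h3 := ih (I ⊔ Ideal.span {a}) (left_lt_sup.2 fun h => haI (h (Ideal.subset_span rfl)))
    by_cases hreg : IsSMulRegular (R ⧸ I) a
    · have e : QuotSMulTop a (R ⧸ I) ≃ₗ[R] R ⧸ (I ⊔ Ideal.span {a}) :=
        (Submodule.quotEquivOfEq _ _ (by
          rw [← Submodule.ideal_span_singleton_smul, ← Submodule.range_mkQ I,
            ← Submodule.map_top, ← Submodule.map_smul'']
          simp)).trans (Submodule.quotientQuotientEquivQuotientSup I (Ideal.span {a}))
      have h1 := ModuleCat.projectiveDimension_quotSMulTop_eq_succ_of_isSMulRegular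
        (ModuleCat.of R (R ⧸ I)) a hreg ham
      rw [ModuleCat.projectiveDimension_eq_of_linearEquiv (M := ModuleCat.of R (QuotSMulTop a _))
        (N := ModuleCat.of R (R ⧸ (I ⊔ Ideal.span {a}))) e] at h1
      have h2 := (projectiveDimension_le_iff _ _).2 h3
      rw [h1] at h2
      refine (projectiveDimension_le_iff _ _).1 (le_trans ?_ h2)
      exact le_add_of_nonneg_right zero_le_one
    · let J : Ideal R := Submodule.comap (LinearMap.mulRight R a) I
      have hJ : ∀ r, r * a ∈ I ↔ r ∈ J := fun r => Iff.rfl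
      have hIJ : I < J := by
        refine lt_of_le_of_ne (fun r hr => I.mul_mem_right a hr) fun heq => hreg ?_
        refine (isSMulRegular_iff_right_eq_zero_of_smul).2 ?_
        intro r hr
        obtain ⟨r, rfl⟩ := Submodule.Quotient.mk_surjective _ r
        rw [← Submodule.Quotient.mk_smul, Submodule.Quotient.mk_eq_zero, smul_eq_mul, mul_comm,
          hJ, ← heq] at hr
        exact (Submodule.Quotient.mk_eq_zero _).2 hr
      exact (colonSeq_shortExact hJ).hasProjectiveDimensionLT_X₂ (n + 1) (ih J hIJ) h3

end CanonicalElement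

namespace CanonicalElement
open scoped Pointwise
open RingTheory.Sequence CategoryTheory CategoryTheory.Abelian

section
variable {R : Type u} [CommRing R]

lemma subsingleton_ext_X₂ {S : ShortComplex (ModuleCat.{u} R)} (hS : S.ShortExact)
    (E : ModuleCat.{u} R) {i : ℕ} (h1 : Subsingleton (Ext S.X₁ E i))
    (h3 : Subsingleton (Ext S.X₃ E i)) : Subsingleton (Ext S.X₂ E i) := by
  refine subsingleton_of_forall_eq 0 fun x => ?_
  obtain ⟨y, rfl⟩ := Ext.contravariant_sequence_exact₂ hS E x (Subsingleton.elim _ _)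
  rw [Subsingleton.elim y 0, Ext.comp_zero]

lemma subsingleton_ext_X₁ {S : ShortComplex (ModuleCat.{u} R)} (hS : S.ShortExact)
    (E : ModuleCat.{u} R) {i : ℕ} (h2 : Subsingleton (Ext S.X₂ E i))
    (h3 : Subsingleton (Ext S.X₃ E (i + 1))) : Subsingleton (Ext S.X₁ E i) := by
  refine subsingleton_of_forall_eq 0 fun x => ?_
  obtain ⟨y, rfl⟩ := Ext.contravariant_sequence_exact₁ hS E x (add_comm 1 i) (Subsingleton.elim _ _)
  rw [Subsingleton.elim y 0, Ext.comp_zero]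

lemma subsingleton_ext_X₃ {S : ShortComplex (ModuleCat.{u} R)} (hS : S.ShortExact)
    (E : ModuleCat.{u} R) {i : ℕ} (h1 : Subsingleton (Ext S.X₁ E i))
    (h2 : Subsingleton (Ext S.X₂ E (i + 1))) : Subsingleton (Ext S.X₃ E (i + 1)) := by
  refine subsingleton_of_forall_eq 0 fun x => ?_
  obtain ⟨y, rfl⟩ := Ext.contravariant_sequence_exact₃ hS E x (Subsingleton.elim _ _) (add_comm 1 i)
  rw [Subsingleton.elim y 0, Ext.comp_zero]

lemma subsingleton_ext_one_X₃ {S : ShortComplex (ModuleCat.{u} R)} (hS : S.ShortExact)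
    (E : ModuleCat.{u} R) (h1 : ∀ f : S.X₁ ⟶ E, ∃ g : S.X₂ ⟶ E, S.f ≫ g = f)
    (h2 : Subsingleton (Ext S.X₂ E 1)) : Subsingleton (Ext S.X₃ E 1) := by
  refine subsingleton_of_forall_eq 0 fun x => ?_
  obtain ⟨y, rfl⟩ := Ext.contravariant_sequence_exact₃ hS E x (Subsingleton.elim _ _) (add_zero 1)
  obtain ⟨f, rfl⟩ := (Ext.mk₀_bijective _ _).2 y
  obtain ⟨g, rfl⟩ := h1 f
  rw [← Ext.mk₀_comp_mk₀, ShortComplex.ShortExact.extClass_comp_assoc]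

lemma extend_of_subsingleton_ext_one {S : ShortComplex (ModuleCat.{u} R)} (hS : S.ShortExact)
    (E : ModuleCat.{u} R) (h3 : Subsingleton (Ext S.X₃ E 1)) (f : S.X₁ ⟶ E) :
    ∃ g : S.X₂ ⟶ E, S.f ≫ g = f := by
  obtain ⟨y, hy⟩ := Ext.contravariant_sequence_exact₁ hS E (Ext.mk₀ f) (add_zero 1)
    (Subsingleton.elim _ _)
  obtain ⟨g, rfl⟩ := (Ext.mk₀_bijective _ _).2 y
  rw [Ext.mk₀_comp_mk₀] at hy
  exact ⟨g, (Ext.mk₀_bijective _ _).1 hy⟩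

lemma characterModule_exists_smul_eq {T : Type u} [AddCommGroup T] [Module R T] {I : Ideal R}
    {r : R} (hr : IsSMulRegular (T ⧸ (I • ⊤ : Submodule R T)) r) (c : CharacterModule T)
    (hc : ∀ a ∈ I, a • c = 0) : ∃ b : CharacterModule T, (∀ a ∈ I, a • b = 0) ∧ r • b = c := by
  have hle : (I • ⊤ : Submodule R T).toAddSubgroup ≤ (show T →+ AddCircle (1 : ℚ) from c).ker := by
    intro t ht
    refine Submodule.smul_induction_on (p := fun t => c t = 0) ht ?_ ?_
    · intro a ha t _
      exact DFunLike.congr_fun (hc a ha) t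
    · intro x y hx hy
      rw [map_add, hx, hy, add_zero]
  let c' : CharacterModule (T ⧸ (I • ⊤ : Submodule R T)) :=
    QuotientAddGroup.lift _ (show T →+ AddCircle (1 : ℚ) from c) hle
  obtain ⟨b, hb⟩ := CharacterModule.dual_surjective_of_injective
    (LinearMap.lsmul R (T ⧸ (I • ⊤ : Submodule R T)) r) hr c'
  refine ⟨CharacterModule.dual (Submodule.mkQ _) b, fun a ha => ?_, ?_⟩
  · ext t
    change b (Submodule.Quotient.mk (a • t)) = 0
    rw [(Submodule.Quotient.mk_eq_zero _).2 (Submodule.smul_mem_smul ha Submodule.mem_top),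
      map_zero]
  · ext t
    exact DFunLike.congr_fun hb (Submodule.Quotient.mk t)

lemma exists_colon_iff_of_isSMulRegular {I : Ideal R} {a : R}
    (h : IsSMulRegular (R ⧸ I) a) (r : R) : r * a ∈ I ↔ r ∈ I := by
  refine ⟨fun hr => ?_, fun hr => I.mul_mem_right a hr⟩
  rw [← Submodule.Quotient.mk_eq_zero]
  refine h.right_eq_zero_of_smul ?_
  rw [← Submodule.Quotient.mk_smul, Submodule.Quotient.mk_eq_zero, smul_eq_mul, mul_comm]
  exact hr

lemma subsingleton_ext_characterModule {T : Type u} [AddCommGroup T] [Module R T] (z : List R)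
    (hR : IsWeaklyRegular R z) (hT : IsWeaklyRegular T z) (i : ℕ) :
    Subsingleton (Ext (ModuleCat.of R (R ⧸ Ideal.ofList z))
      (ModuleCat.of R (CharacterModule T)) (i + 1)) := by
  induction z using List.reverseRecOn generalizing i with
  | nil =>
    have : Module.Projective R (R ⧸ Ideal.ofList ([] : List R)) :=
      Module.Projective.of_equiv (Submodule.quotEquivOfEqBot _ Ideal.ofList_nil).symm
    have : Projective (ModuleCat.of R (R ⧸ Ideal.ofList ([] : List R))) :=
      (IsProjective.iff_projective _).1 this
    exact Ext.subsingleton_of_projective _ _ i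
  | append_singleton z r ih =>
    rw [isWeaklyRegular_append_iff, isWeaklyRegular_singleton_iff] at hR hT
    have e : (Ideal.ofList z • ⊤ : Submodule R R) = Ideal.ofList z := by simp
    have hreg := hR.2
    rw [e] at hreg
    have hcol := exists_colon_iff_of_isSMulRegular hreg
    have hS := colonSeq_shortExact hcol
    have heq : Ideal.ofList (z ++ [r]) = Ideal.ofList z ⊔ Ideal.span {r} := by
      rw [Ideal.ofList_append, Ideal.ofList_singleton]
    rw [heq]
    cases i with
    | succ i => exact subsingleton_ext_X₃ hS _ (ih hR.1 hT.1 i) (ih hR.1 hT.1 (i + 1))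
    | zero =>
      refine subsingleton_ext_one_X₃ hS _ (fun f => ?_) (ih hR.1 hT.1 0)
      let f' : (R ⧸ Ideal.ofList z) →ₗ[R] CharacterModule T := f.hom
      obtain ⟨b, hb, hrb⟩ := characterModule_exists_smul_eq hT.2
        (f' (Submodule.Quotient.mk 1)) (fun a ha => by
          rw [← map_smul, ← Submodule.Quotient.mk_smul,
            (Submodule.Quotient.mk_eq_zero _).2 (by simpa using ha), map_zero])
      let g : (R ⧸ Ideal.ofList z) →ₗ[R] CharacterModule T :=
        Submodule.liftQ _ (LinearMap.toSpanSingleton R _ b) (fun a ha => by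
          simpa using hb a ha)
      refine ⟨ModuleCat.ofHom g, ModuleCat.hom_ext ?_⟩
      have : g.comp (Submodule.mapQ _ _ (LinearMap.mulRight R r) (fun a ha => (hcol a).2 ha))
          = f' := by
        ext1
        refine LinearMap.ext_ring ?_
        change g (Submodule.Quotient.mk (1 * r)) = f' (Submodule.Quotient.mk 1)
        rw [← hrb, one_mul]
        rfl
      exact this

end

lemma RegDim.subsingleton_ext_characterModule {R : Type u} [CommRing R] [IsLocalRing R] {n : ℕ}
    (h : RegDim R n) {T : Type u} [AddCommGroup T] [Module R T]
    (hT : ∀ z : List R, (∀ r ∈ z, r ∈ maximalIdeal R) → IsWeaklyRegular R z → IsWeaklyRegular T z)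
    (k i : ℕ) (hki : n ≤ i + k) (I : Ideal R) :
    Subsingleton (Ext (ModuleCat.of R (R ⧸ I)) (ModuleCat.of R (CharacterModule T)) (i + 1)) := by
  have := h.1
  induction k generalizing i I with
  | zero =>
    have := h.hasProjectiveDimensionLT I
    exact HasProjectiveDimensionLT.subsingleton _ (n + 1) _ (by omega) _
  | succ k ihk =>
    induction I using WellFoundedGT.induction with
    | _ I ih =>
    rcases eq_or_ne I ⊤ with rfl | htop
    · have : Subsingleton (ModuleCat.of R (R ⧸ (⊤ : Ideal R))) :=
        Submodule.Quotient.subsingleton_iff.2 rfl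
      have := (ModuleCat.isZero_of_subsingleton
        (ModuleCat.of R (R ⧸ (⊤ : Ideal R)))).hasProjectiveDimensionLT_zero
      exact HasProjectiveDimensionLT.subsingleton _ 0 _ (Nat.zero_le _) _
    by_cases hI : I.IsPrime
    · have hIm := IsLocalRing.le_maximalIdeal htop
      obtain ⟨z, hz, hreg, hass⟩ := h.exists_append I [] (by simp) (.nil R R)
      rw [List.nil_append] at hreg hass
      obtain ⟨u, hu⟩ : ∃ u : R, ∀ r, r * u ∈ Ideal.ofList z ↔ r ∈ I := by
        obtain ⟨-, u, hu⟩ := (isAssociatedPrime_iff).1 hass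
        obtain ⟨u, rfl⟩ := Submodule.Quotient.mk_surjective _ u
        refine ⟨u, fun r => ?_⟩
        rw [hu, Submodule.mem_colon_singleton, Submodule.mem_bot, ← Submodule.Quotient.mk_smul,
          Submodule.Quotient.mk_eq_zero]
        simp
      exact subsingleton_ext_X₁ (colonSeq_shortExact hu) _
        (CanonicalElement.subsingleton_ext_characterModule z hreg
          (hT z (fun r hr => hIm (hz r hr)) hreg) i) (ihk (i + 1) (by omega) _)
    · obtain ⟨a, ha, b, hb, hab⟩ := (Ideal.not_isPrime_iff.1 hI).resolve_left htop
      let J : Ideal R := Submodule.comap (LinearMap.mulRight R a) I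
      have hJ : ∀ r, r * a ∈ I ↔ r ∈ J := fun r => Iff.rfl
      have hIJ : I < J := by
        refine lt_of_le_of_ne (fun r hr => I.mul_mem_right a hr) fun heq => hb ?_
        rw [heq, ← hJ, mul_comm]
        exact hab
      exact subsingleton_ext_X₂ (colonSeq_shortExact hJ) _ (ih J hIJ)
        (ih _ (left_lt_sup.2 fun h => ha (h (Ideal.subset_span rfl))))

/-- Over a regular local ring, balanced big Cohen–Macaulay modules are flat. -/
theorem RegDim.flat {R : Type u} [CommRing R] [IsLocalRing R] {n : ℕ}
    (h : RegDim R n) {T : Type u} [AddCommGroup T] [Module R T]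
    (hT : ∀ z : List R, (∀ r ∈ z, r ∈ maximalIdeal R) → IsWeaklyRegular R z →
      IsWeaklyRegular T z) : Module.Flat R T := by
  rw [Module.Flat.iff_characterModule_baer, Module.Baer.iff_surjective]
  intro I f
  let S : ShortComplex (ModuleCat.{u} R) := ModuleCat.shortComplexOfCompEqZero
    I.subtype I.mkQ (by ext x; exact (Submodule.Quotient.mk_eq_zero _).2 x.2)
  have hS : S.ShortExact :=
    { exact := ModuleCat.shortComplex_exact _ (LinearMap.exact_subtype_mkQ I)
      mono_f := (ModuleCat.mono_iff_injective _).2 I.subtype_injective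
      epi_g := (ModuleCat.epi_iff_surjective _).2 I.mkQ_surjective }
  obtain ⟨g, hg⟩ := extend_of_subsingleton_ext_one hS (ModuleCat.of R (CharacterModule T))
    (h.subsingleton_ext_characterModule hT n 0 (by omega) I) (ModuleCat.ofHom f)
  exact ⟨g.hom, congrArg ModuleCat.Hom.hom hg⟩

end CanonicalElement

namespace CanonicalElement
open scoped Pointwise
open RingTheory.Sequence

lemma RegDim.exists_append_le_radical {R : Type u} [CommRing R] [IsLocalRing R] {n : ℕ}
    (h : RegDim R n) (z : List R) (hz : ∀ r ∈ z, r ∈ maximalIdeal R)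
    (hreg : IsWeaklyRegular R z) : ∃ t : List R, (z ++ t).length = n ∧
      (∀ r ∈ z ++ t, r ∈ maximalIdeal R) ∧ maximalIdeal R ≤ (Ideal.ofList (z ++ t)).radical := by
  have := h.1
  obtain ⟨t, ht, hzt, hass⟩ := h.exists_append (maximalIdeal R) z hz hreg
  have hm : ∀ r ∈ z ++ t, r ∈ maximalIdeal R := fun r hr =>
    (List.mem_append.1 hr).elim (hz r) (ht r)
  have h1 := h.le_ringKrullDim_quotient hm hzt hass
  have h0 : ringKrullDim (R ⧸ maximalIdeal R) = 0 :=
    ringKrullDim_eq_zero_of_isField ((Ideal.Quotient.maximal_ideal_iff_isField_quotient _).1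
      inferInstance)
  have h2 := nat_of_add_eq (h.dim_quotient_add hm hzt)
  rw [h0] at h1
  have h3 : n - (z ++ t).length = 0 := by
    have : n - (z ++ t).length ≤ 0 := by exact_mod_cast h1
    omega
  refine ⟨t, by omega, hm, ?_⟩
  rw [Ideal.radical_eq_sInf]
  refine le_sInf ?_
  rintro P ⟨hP, hPp⟩
  rcases (IsLocalRing.le_maximalIdeal hPp.ne_top).eq_or_lt with heq | hlt
  · exact heq.ge
  exfalso
  have h4 := add_one_le_ringKrullDim_quotient hlt
  have h5 : ringKrullDim (R ⧸ P) ≤ ringKrullDim (R ⧸ Ideal.ofList (z ++ t)) :=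
    ringKrullDim_le_of_surjective (Ideal.Quotient.factor hP) (Ideal.Quotient.factor_surjective _)
  rw [h2.2, h3] at h5
  rw [h0] at h4
  have h6 := h4.trans h5
  norm_cast at h6

lemma RegDim.isWeaklyRegular_map {R S : Type u} [CommRing R] [IsLocalRing R] {n : ℕ}
    (h : RegDim R n) [CommRing S] [IsLocalRing S] (hS : RegDim S n) (φ : R →+* S)
    (hφ : (maximalIdeal R).map φ ≤ maximalIdeal S)
    (hφ' : maximalIdeal S ≤ ((maximalIdeal R).map φ).radical)
    (z : List R) (hz : ∀ r ∈ z, r ∈ maximalIdeal R) (hreg : IsWeaklyRegular R z) :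
    IsWeaklyRegular S (z.map φ) := by
  obtain ⟨t, hlen, hzt, hrad⟩ := h.exists_append_le_radical z hz hreg
  have h1 : IsWeaklyRegular S ((z ++ t).map φ) := by
    refine hS.isWeaklyRegular_of_le_radical _ (by rw [List.length_map, hlen]) ?_ ?_
    · intro r hr
      obtain ⟨a, ha, rfl⟩ := List.mem_map.1 hr
      exact hφ (Ideal.mem_map_of_mem _ (hzt a ha))
    · refine hφ'.trans ?_
      rw [Ideal.radical_le_radical_iff, ← Ideal.map_ofList]
      exact (Ideal.map_mono hrad).trans (Ideal.map_radical_le _)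
  rw [List.map_append, isWeaklyRegular_append_iff] at h1
  exact h1.1

lemma RegDim.exists_iterateFrobenius {R : Type u} [CommRing R] [IsLocalRing R] [IsNoetherianRing R]
    (p : ℕ) [Fact p.Prime] [CharP R p] {I : Ideal R} {w : R} (hI : I ≤ maximalIdeal R)
    (hw : w ∉ I) :
    ∃ e : ℕ, w ∉ I ⊔ (maximalIdeal R).map (iterateFrobenius R p e) := by
  by_contra! hcon
  have := isLocalRing_quotient hI
  have hkr := Ideal.iInf_pow_eq_bot_of_isLocalRing (maximalIdeal (R ⧸ I)) (by
    exact (maximalIdeal.isMaximal _).ne_top)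
  refine hw ?_
  rw [← Ideal.Quotient.eq_zero_iff_mem, ← Ideal.mem_bot, ← hkr, Ideal.mem_iInf]
  intro i
  rw [← map_maximalIdeal_quotient I, ← Ideal.map_pow, Ideal.mem_quotient_iff_mem_sup, sup_comm]
  refine sup_le_sup_left ?_ I (hcon i)
  rw [Ideal.map_le_iff_le_comap]
  intro a ha
  rw [Ideal.mem_comap, iterateFrobenius_def]
  exact Ideal.pow_le_pow_right (Nat.lt_pow_self (Fact.out : p.Prime).one_lt).le
    (Ideal.pow_mem_pow ha _)

lemma RegDim.flat_of_le_radical {R S : Type u} [CommRing R] [IsLocalRing R] {n : ℕ}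
    (h : RegDim R n) [CommRing S] [IsLocalRing S] (hS : RegDim S n) (φ : R →+* S)
    (hφ : (maximalIdeal R).map φ ≤ maximalIdeal S)
    (hφ' : maximalIdeal S ≤ ((maximalIdeal R).map φ).radical) : φ.Flat := by
  let := φ.toAlgebra
  refine h.flat fun z hz hreg => ?_
  rw [← isWeaklyRegular_map_algebraMap_iff S]
  exact h.isWeaklyRegular_map hS φ hφ hφ' z hz hreg

lemma RegDim.flat_iterateFrobenius {R : Type u} [CommRing R] [IsLocalRing R] {n : ℕ}
    (h : RegDim R n) (p : ℕ) [Fact p.Prime] [CharP R p] (e : ℕ) :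
    (iterateFrobenius R p e).Flat := by
  have hq : p ^ e ≠ 0 := pow_ne_zero _ (Fact.out : p.Prime).ne_zero
  refine h.flat_of_le_radical h _ ?_ ?_
  · rw [Ideal.map_le_iff_le_comap]
    intro a ha
    exact Ideal.pow_mem_of_mem _ ha _ (Nat.pos_of_ne_zero hq)
  · intro a ha
    exact ⟨p ^ e, Ideal.mem_map_of_mem (iterateFrobenius R p e) ha⟩

theorem koszulTorMapZero_of_charP {R : Type u} [CommRing R] [IsLocalRing R] {n : ℕ}
    (h : RegDim R n) (p : ℕ) [Fact p.Prime] [CharP R p] {d : ℕ} (x : Fin d → R) (I : Ideal R)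
    (hx : ∀ i, x i ∈ maximalIdeal R) (w : R) (hwx : w ∉ Ideal.span (Set.range x))
    (hw : ∀ a ∈ I, w * a ∈ Ideal.span (Set.range x)) :
    KoszulTorMapZero R x ((Ideal.span (Set.range x)).colon I) d := by
  have := h.1
  obtain ⟨e, he⟩ := RegDim.exists_iterateFrobenius p
    (Ideal.span_le.2 (Set.range_subset_iff.2 hx)) hwx
  have hfl := h.flat_iterateFrobenius p e
  refine @koszulTorMapZero_of_flat R R _ _ _ _ (iterateFrobenius R p e).toAlgebra hfl
    (RingHom.id R) (fun a => ?_) d x I w hw ?_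
  · exact dvd_pow_self a (pow_ne_zero _ (Fact.out : p.Prime).ne_zero)
  · rw [Ideal.map_id]
    exact he

end CanonicalElement

namespace CanonicalElement
open scoped Pointwise
open RingTheory.Sequence

section MvPowerSeries
open MvPowerSeries

lemma le_order_of_mem_pow {σ R : Type*} [CommRing R] {n : ℕ} {f : MvPowerSeries σ R}
    (hf : f ∈ Ideal.span (Set.range (X : σ → MvPowerSeries σ R)) ^ n) : (n : ℕ∞) ≤ f.order := by
  induction n generalizing f with
  | zero => simp
  | succ n ih =>
    rw [pow_succ] at hf
    refine Submodule.mul_induction_on hf (fun a ha b hb => ?_) fun a b ha hb => ?_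
    · have hb' : (1 : ℕ∞) ≤ b.order := by
        rw [one_le_order_iff_constCoeff_eq_zero, ← RingHom.mem_ker]
        refine (Ideal.span_le (I := RingHom.ker _)).2 ?_ hb
        rintro _ ⟨i, rfl⟩
        simp
      push_cast
      exact (add_le_add (ih ha) hb').trans le_order_mul
    · exact (le_min ha hb).trans min_order_le_add

lemma mem_pow_span_X_iff {σ R : Type*} [Finite σ] [CommRing R] {n : ℕ} {f : MvPowerSeries σ R} :
    f ∈ Ideal.span (Set.range (X : σ → MvPowerSeries σ R)) ^ n ↔ (n : ℕ∞) ≤ f.order := by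
  classical
  refine ⟨le_order_of_mem_pow, fun h => ?_⟩
  set I := Ideal.span (Set.range (X : σ → MvPowerSeries σ R))
  have hI : I = (MvPolynomial.idealOfVars σ R).map
      (MvPolynomial.coeToMvPowerSeries.ringHom (R := R)) := by
    rw [MvPolynomial.idealOfVars, Ideal.map_span, ← Set.range_comp]
    have : (X : σ → MvPowerSeries σ R) =
        (MvPolynomial.coeToMvPowerSeries.ringHom (R := R)) ∘ MvPolynomial.X :=
      funext fun i => (MvPolynomial.coe_X (R := R) i).symm
    rw [← this]
  have hsub : ∀ m k, m ≤ k →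
      ((truncTotal m f : MvPolynomial σ R) : MvPowerSeries σ R) - (truncTotal k f) ∈ I ^ m := by
    intro m k hmk
    rw [hI, ← Ideal.map_pow]
    have := Ideal.mem_map_of_mem (MvPolynomial.coeToMvPowerSeries.ringHom (R := R))
      (truncTotal_sub_truncTotal_mem_pow_idealOfVars le_rfl hmk f)
    rwa [map_sub] at this
  obtain ⟨L, hL⟩ := IsPrecomplete.prec (I := I) (M := MvPowerSeries σ R) inferInstance
    (f := fun k => ((truncTotal k f : MvPolynomial σ R) : MvPowerSeries σ R)) (by
      intro m k hmk
      rw [SModEq.sub_mem, smul_eq_mul, Ideal.mul_top]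
      exact hsub m k hmk)
  have hL' : ∀ k, ((truncTotal k f : MvPolynomial σ R) : MvPowerSeries σ R) - L ∈ I ^ k := by
    intro k
    have := hL k
    rwa [SModEq.sub_mem, smul_eq_mul, Ideal.mul_top] at this
  have hfL : L = f := by
    ext d
    have h1 := le_order_of_mem_pow (hL' (d.degree + 1))
    have h2 := coeff_of_lt_order (d := d) (lt_of_lt_of_le (by exact_mod_cast Nat.lt_succ_self _) h1)
    rw [map_sub, MvPolynomial.coeff_coe, coeff_truncTotal _ (Nat.lt_succ_self _)] at h2
    exact (sub_eq_zero.1 h2).symm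
  have h0 : truncTotal n f = 0 := by
    ext d
    rw [MvPolynomial.coeff_zero]
    by_cases hd : d.degree < n
    · rw [coeff_truncTotal _ hd]
      exact coeff_of_lt_order (lt_of_lt_of_le (by exact_mod_cast hd) h)
    · exact coeff_truncTotal_eq_zero _ (not_lt.1 hd)
  have := hL' n
  rw [hfL, h0] at this
  simpa using this

lemma maximalIdeal_mvPowerSeries {σ F : Type*} [Finite σ] [Field F] :
    maximalIdeal (MvPowerSeries σ F) = Ideal.span (Set.range X) := by
  ext f
  have := mem_pow_span_X_iff (n := 1) (f := f)
  rw [pow_one] at this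
  rw [this, Nat.cast_one, one_le_order_iff_constCoeff_eq_zero, mem_maximalIdeal, mem_nonunits_iff,
    isUnit_iff_constantCoeff, isUnit_iff_ne_zero, not_not]

instance henselianLocalRing_mvPowerSeries {σ F : Type*} [Finite σ] [Field F] :
    HenselianLocalRing (MvPowerSeries σ F) := by
  have h : IsAdicComplete (maximalIdeal (MvPowerSeries σ F)) (MvPowerSeries σ F) := by
    rw [maximalIdeal_mvPowerSeries]
    infer_instance
  exact { is_henselian := fun f hf a₀ h₁ h₂ => by
            refine HenselianRing.is_henselian (I := maximalIdeal (MvPowerSeries σ F)) f hf a₀ h₁ ?_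
            exact h₂.map _ }

lemma le_ringKrullDim_mvPowerSeries (F : Type*) [Field F] (n : ℕ) :
    (n : WithBot ℕ∞) ≤ ringKrullDim (MvPowerSeries (Fin n) F) := by
  induction n with
  | zero => exact ringKrullDim_nonneg_of_nontrivial
  | succ n ih =>
    rw [ringKrullDim_eq_of_ringEquiv (finSuccEquiv F n).toRingEquiv]
    refine le_trans ?_ ringKrullDim_succ_le_ringKrullDim_powerseries
    push_cast
    exact add_le_add ih le_rfl

lemma regDim_mvPowerSeries (F : Type*) [Field F] (n : ℕ) :
    RegDim (MvPowerSeries (Fin n) F) n :=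
  ⟨inferInstance, ⟨X, maximalIdeal_mvPowerSeries.symm⟩, le_ringKrullDim_mvPowerSeries F n⟩

end MvPowerSeries

end CanonicalElement

namespace CanonicalElement
open scoped Pointwise
open RingTheory.Sequence

lemma formallySmooth_of_charZero (k K : Type*) [Field k] [CharZero k] [Field K] [Algebra k K] :
    Algebra.FormallySmooth k K := by
  obtain ⟨s, hs⟩ := exists_isTranscendenceBasis k K
  have : Algebra.IsAlgebraic (IntermediateField.adjoin k (Set.range ((↑) : s → K))) K :=
    hs.isAlgebraic_field
  exact Algebra.FormallySmooth.of_algebraicIndependent_of_isSeparable hs.1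

open MvPowerSeries in
lemma exists_surjective_mvPowerSeries {S : Type*} [CommRing S] [IsLocalRing S]
    [IsAdicComplete (maximalIdeal S) S] [Algebra ℚ S] {n : ℕ} (y : Fin n → S)
    (hy : Ideal.span (Set.range y) = maximalIdeal S) :
    ∃ f : MvPowerSeries (Fin n) (ResidueField S) →+* S,
      Function.Surjective f ∧ ∀ i, f (X i) = y i := by
  have := formallySmooth_of_charZero ℚ (ResidueField S)
  obtain ⟨g, hg⟩ := Algebra.FormallySmooth.exists_mkₐ_comp_eq_of_isAdicComplete
    (R := ℚ) (I := maximalIdeal S) (AlgHom.id ℚ (ResidueField S))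
  have hg' : ∀ a, residue S (g a) = a := fun a => congr($hg a)
  let P : MvPolynomial (Fin n) (ResidueField S) →+* S := MvPolynomial.eval₂Hom g.toRingHom y
  have hP : (MvPolynomial.idealOfVars (Fin n) (ResidueField S)).map P = maximalIdeal S := by
    rw [MvPolynomial.idealOfVars, Ideal.map_span, ← Set.range_comp, ← hy]
    congr 2
    ext i
    simp [P]
  have hPk : ∀ k, MvPolynomial.idealOfVars (Fin n) (ResidueField S) ^ k ≤
      (maximalIdeal S ^ k).comap P := fun k => by
    rw [← Ideal.map_le_iff_le_comap, Ideal.map_pow, hP]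
  let f : ∀ k, MvPowerSeries (Fin n) (ResidueField S) →+* S ⧸ maximalIdeal S ^ k := fun k =>
    (Ideal.quotientMap _ P (hPk k)).comp (truncTotalAlgHom (Fin n) (ResidueField S) k).toRingHom
  have hf : ∀ {k l : ℕ} (hle : k ≤ l),
      (Ideal.Quotient.factorPow (maximalIdeal S) hle).comp (f l) = f k := by
    intro k l hle
    ext a
    have h1 : Ideal.Quotient.mk (maximalIdeal S ^ k) (P (truncTotal l a)) =
        Ideal.Quotient.mk (maximalIdeal S ^ k) (P (truncTotal k a)) := by
      rw [Ideal.Quotient.eq, ← map_sub]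
      exact hPk k (truncTotal_sub_truncTotal_mem_pow_idealOfVars hle le_rfl a)
    exact h1
  let F := IsAdicComplete.liftRingHom (maximalIdeal S) f hf
  have hF : ∀ p : MvPolynomial (Fin n) (ResidueField S), F p = P p := by
    intro p
    rw [← sub_eq_zero]
    refine IsHausdorff.haus (I := maximalIdeal S) inferInstance _ fun k => ?_
    rw [SModEq.sub_mem, smul_eq_mul, Ideal.mul_top, sub_zero, ← Ideal.Quotient.eq]
    refine (IsAdicComplete.mk_liftRingHom (maximalIdeal S) f hf k p).trans ?_
    have h2 := (truncTotalAlgHom (Fin n) (ResidueField S) k).commutes p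
    exact congrArg (Ideal.quotientMap (maximalIdeal S ^ k) P (hPk k)) h2
  have hFX : ∀ i, F (X i) = y i := by
    intro i
    rw [← MvPolynomial.coe_X, hF]
    simp [P]
  have hI : (Ideal.span (Set.range (X : Fin n → MvPowerSeries (Fin n) (ResidueField S)))).map F =
      maximalIdeal S := by
    rw [Ideal.map_span, ← Set.range_comp, ← hy]
    congr 2
    exact funext hFX
  refine ⟨F, ?_, hFX⟩
  have hH : IsHausdorff ((Ideal.span (Set.range
      (X : Fin n → MvPowerSeries (Fin n) (ResidueField S)))).map F) S := by
    rw [hI]; infer_instance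
  refine surjective_of_mk_map_comp_surjective (I := Ideal.span (Set.range X)) F fun s => ?_
  obtain ⟨s, rfl⟩ := Ideal.Quotient.mk_surjective s
  refine ⟨C (residue S s), ?_⟩
  rw [RingHom.comp_apply, Ideal.Quotient.eq, hI, ← MvPolynomial.coe_C, hF]
  rw [← residue_eq_zero_iff, map_sub, sub_eq_zero]
  simp only [P, MvPolynomial.coe_eval₂Hom, MvPolynomial.eval₂_C]
  exact hg' _

open MvPowerSeries in
theorem RegDim.exists_ringHom_mvPowerSeries {R : Type u} [CommRing R] [IsLocalRing R] {n : ℕ}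
    (h : RegDim R n) [Algebra ℚ R] :
    ∃ (K : Type u) (_ : Field K) (_ : CharZero K) (f : R →+* MvPowerSeries (Fin n) K)
      (y : Fin n → R), Ideal.span (Set.range y) = maximalIdeal R ∧ ∀ i, f (y i) = X i := by
  have := h.1
  obtain ⟨rs, hlen, hrs, hreg, hrm⟩ := h.exists_isRegular
  subst hlen
  let S := AdicCompletion (maximalIdeal R) R
  let y : Fin rs.length → R := rs.get
  have hy : Ideal.span (Set.range y) = maximalIdeal R := by
    rw [← hrm, Ideal.ofList]
    congr 1
    ext r
    simp [y, List.mem_iff_get]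
  have hyS : Ideal.span (Set.range fun i => algebraMap R S (y i)) = maximalIdeal S := by
    refine Eq.trans ?_ AdicCompletion.maximalIdeal_eq_map.symm
    refine Eq.trans ?_ (congrArg (Ideal.map (algebraMap R S)) hy)
    rw [Ideal.map_span, ← Set.range_comp]
    rfl
  let : Algebra ℚ S := ((algebraMap R S).comp (algebraMap ℚ R)).toAlgebra
  obtain ⟨F, hF, hFX⟩ := exists_surjective_mvPowerSeries _ hyS
  have hN : IsNoetherianRing S := isNoetherianRing_of_surjective _ _ F hF
  have hregS : IsWeaklyRegular S (rs.map (algebraMap R S)) := hreg.of_flat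
  have hdim : (rs.length : WithBot ℕ∞) ≤ ringKrullDim S := by
    obtain ⟨P, hP⟩ := associatedPrimes.nonempty S S
    have h1 := length_le_ringKrullDim_quotient (rs.map (algebraMap R S)) (by
      intro r hr
      obtain ⟨a, ha, rfl⟩ := List.mem_map.1 hr
      rw [AdicCompletion.maximalIdeal_eq_map]
      exact Ideal.mem_map_of_mem _ (hrs a ha)) hregS hP
    rw [List.length_map] at h1
    exact h1.trans (ringKrullDim_quotient_le P)
  have hinj : Function.Injective F := by
    rw [injective_iff_map_eq_zero]
    intro a ha
    by_contra hne
    have h1 := ringKrullDim_quotient_succ_le_of_nonZeroDivisor (mem_nonZeroDivisors_of_ne_zero hne)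
    have h2 : ringKrullDim S ≤ ringKrullDim
        (MvPowerSeries (Fin rs.length) (ResidueField S) ⧸ Ideal.span {a}) :=
      ringKrullDim_le_of_surjective (Ideal.Quotient.lift _ F
        ((Ideal.span_singleton_le_iff_mem (RingHom.ker F)).2 ha))
        (Ideal.Quotient.lift_surjective_of_surjective _ _ hF)
    rw [(regDim_mvPowerSeries _ _).dim_eq] at h1
    have h3 := (add_le_add (hdim.trans h2) le_rfl).trans h1
    have h4 : rs.length + 1 ≤ rs.length := by exact_mod_cast h3
    omega
  let E := RingEquiv.ofBijective F ⟨hinj, hF⟩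
  refine ⟨ResidueField S, inferInstance, ?_, E.symm.toRingHom.comp (algebraMap R S), y, hy, ?_⟩
  · exact algebraRat.charZero _
  · intro i
    rw [RingHom.comp_apply]
    refine (RingEquiv.symm_apply_eq E).2 ?_
    exact (hFX i).symm

end CanonicalElement

namespace CanonicalElement
open scoped Pointwise

section Hensel
open Polynomial

lemma exists_eval_eq_zero_of_coeff {U : Type*} [CommRing U] [HenselianLocalRing U] (q : U[X])
    (h0 : q.coeff 0 = 1) (h1 : q.coeff 1 = 1) (h2 : ∀ i, 2 ≤ i → q.coeff i ∈ maximalIdeal U) :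
    ∃ w, q.eval w = 0 := by
  have hN : 1 ≤ q.natDegree := le_natDegree_of_ne_zero (by rw [h1]; exact one_ne_zero)
  have hmonic : q.reverse.Monic := by
    rw [Monic, reverse_leadingCoeff, trailingCoeff,
      natTrailingDegree_eq_zero.2 (Or.inr (by rw [h0]; exact one_ne_zero)), h0]
  have hmap : q.reverse.map (residue U) = X ^ (q.natDegree - 1) * (X + 1) := by
    ext j
    rw [coeff_map, coeff_reverse, mul_add, mul_one, ← pow_succ, Nat.sub_add_cancel hN, coeff_add,
      coeff_X_pow, coeff_X_pow]
    by_cases hj : j ≤ q.natDegree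
    · rw [revAt_le hj]
      rcases Nat.lt_trichotomy (q.natDegree - j) 1 with hlt | heq | hgt
      · rw [show q.natDegree - j = 0 by omega, h0, if_pos (by omega), if_neg (by omega)]
        simp
      · rw [heq, h1, if_neg (by omega), if_pos (by omega)]
        simp
      · rw [(residue_eq_zero_iff _).2 (h2 _ hgt), if_neg (by omega), if_neg (by omega), add_zero]
    · rw [revAt_eq_self_of_lt (not_le.1 hj), coeff_eq_zero_of_natDegree_lt (not_le.1 hj),
        if_neg (by omega), if_neg (by omega)]
      simp
  have hev : ∀ p : U[X], residue U (p.eval (-1)) = (p.map (residue U)).eval (-1) := by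
    intro p
    rw [eval_map, ← map_one (residue U), ← map_neg, eval₂_at_apply]
  obtain ⟨v, hv, hv1⟩ := HenselianLocalRing.is_henselian q.reverse hmonic (-1) (by
      rw [← residue_eq_zero_iff, hev, hmap]
      simp) (by
      rw [← residue_ne_zero_iff_isUnit, hev, ← derivative_map, hmap]
      simp)
  have hvu : IsUnit v := by
    by_contra hcon
    have := (maximalIdeal U).sub_mem ((mem_maximalIdeal v).2 hcon) hv1
    rw [sub_sub_cancel] at this
    exact (mem_maximalIdeal (-1 : U)).1 this (isUnit_one.neg)
  obtain ⟨v, rfl⟩ := hvu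
  refine ⟨(v⁻¹ : Uˣ), ?_⟩
  let := v⁻¹.invertible
  have := eval₂_reverse_mul_pow (RingHom.id U) ((v⁻¹ : Uˣ) : U) q
  rw [invOf_units, inv_inv] at this
  rw [eval, ← this]
  have h3 : eval₂ (RingHom.id U) (v : U) q.reverse = 0 := hv
  rw [h3, zero_mul]

lemma exists_newton_root {U : Type*} [CommRing U] [HenselianLocalRing U] (f : U[X]) (z a : U)
    (ha : a ∈ maximalIdeal U) (hf : f.eval z = (f.derivative.eval z) ^ 2 * a) :
    ∃ h, f.eval (z + f.derivative.eval z * h) = 0 ∧ a ∣ h := by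
  set δ := f.derivative.eval z with hδ
  obtain ⟨G, hG⟩ := binomExpansion (f.map C) (C z) (C δ * X)
  have hG' : (f.map C).eval (C z + C δ * X) = C (δ ^ 2) * (C a + X + G * X ^ 2) := by
    rw [hG, eval_map, eval₂_at_apply, derivative_map, eval_map, eval₂_at_apply, hf, ← hδ]
    simp only [map_mul, map_pow]
    ring
  obtain ⟨w, hw⟩ := exists_eval_eq_zero_of_coeff
    (1 + X + C a * (G.comp (C a * X) * X ^ 2)) (by simp)
    (by simp [coeff_mul_X_pow', coeff_one]) (fun i hi => by
      rw [coeff_add, coeff_add, coeff_one, coeff_X, if_neg (by omega), if_neg (by omega),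
        zero_add, zero_add, coeff_C_mul]
      exact Ideal.mul_mem_right _ _ ha)
  refine ⟨a * w, ?_, dvd_mul_right a w⟩
  have h1 := congrArg (eval (a * w)) hG'
  have h2 : eval (a * w) ((f.map C).eval (C z + C δ * X)) = f.eval (z + δ * (a * w)) := by
    rw [eval_map, ← coe_evalRingHom, hom_eval₂]
    have : (evalRingHom (a * w)).comp C = RingHom.id U := by ext; simp
    rw [this, eval₂_id]
    simp
  rw [← h2, h1]
  simp only [eval_add, eval_mul, eval_C, eval_X, eval_pow, eval_one, eval_comp] at hw ⊢
  linear_combination δ ^ 2 * a * hw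

end Hensel

end CanonicalElement

namespace CanonicalElement
open scoped Pointwise

section LiftProp
open Polynomial

lemma span_singleton_pow_le {U : Type*} [CommSemiring U] (E : U) {k l : ℕ} (h : k ≤ l) :
    Ideal.span {E ^ l} ≤ Ideal.span {E ^ k} :=
  Ideal.span_singleton_le_span_singleton.2 (pow_dvd_pow E h)

/-- Approximate ring homs from `A` to Henselian local domains, with a suitable element of `A` not
too small, are close to actual ring homs. -/
def LiftProp (A : Type u) [CommRing A] : Prop :=
  ∃ e : A, e ≠ 0 ∧ ∃ c : ℕ, ∀ (U : Type u) [CommRing U] [IsDomain U] [HenselianLocalRing U]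
    (E : U), E ≠ 0 → E ∈ maximalIdeal U → ∀ (k l : ℕ) (hkl : k ≤ l), k + c ≤ l →
    ∀ π : A →+* U ⧸ Ideal.span {E ^ l}, π e ∣ Ideal.Quotient.mk _ E →
    ∃ χ : A →+* U, (Ideal.Quotient.mk (Ideal.span {E ^ k})).comp χ =
      (Ideal.Quotient.factor (span_singleton_pow_le E hkl)).comp π

lemma liftProp_of_int {A : Type u} [CommRing A] (e : ℤ ≃+* A) : LiftProp A := by
  refine ⟨1, ?_, 0, ?_⟩
  · have : Nontrivial A := e.symm.toEquiv.nontrivial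
    exact one_ne_zero
  · intro U _ _ _ E _ _ k l hkl _ π _
    refine ⟨(Int.castRingHom U).comp e.symm.toRingHom, ?_⟩
    ext a
    obtain ⟨b, rfl⟩ := e.surjective a
    simp

lemma exists_ringHom_of_eval₂ {A A' U : Type*} [CommRing A] [CommRing A'] [CommRing U]
    (i : A →+* A') (z : A') (hz : Function.Surjective (eval₂RingHom i z)) (χ : A →+* U) (y : U)
    (h : ∀ p, eval₂ i z p = 0 → eval₂ χ y p = 0) :
    ∃ χ' : A' →+* U, χ'.comp (eval₂RingHom i z) = eval₂RingHom χ y :=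
  ⟨(eval₂RingHom i z).liftOfSurjective hz ⟨eval₂RingHom χ y, fun p hp => h p hp⟩,
    RingHom.liftOfSurjective_comp _ hz _⟩

lemma eval₂_eq_zero_of_minimal {A A' U : Type*} [CommRing A] [IsDomain A] [CommRing A']
    [CommRing U] [IsDomain U] (i : A →+* A') (z : A') (χ : A →+* U) (y : U) (f : A[X])
    (hf0 : f ≠ 0) (hfz : eval₂ i z f = 0) (hfy : eval₂ χ y f = 0)
    (hmin : ∀ p, p.degree < f.degree → eval₂ i z p = 0 → p = 0)
    (hl : χ f.leadingCoeff ≠ 0) (p : A[X]) (hp : eval₂ i z p = 0) : eval₂ χ y p = 0 := by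
  induction hn : p.degree using WellFoundedLT.induction generalizing p with
  | ind n ih =>
  subst hn
  by_cases hlt : p.degree < f.degree
  · rw [hmin p hlt hp, eval₂_zero]
  by_cases hp0 : p = 0
  · rw [hp0, eval₂_zero]
  rw [not_lt] at hlt
  have hnat : f.natDegree ≤ p.natDegree := natDegree_le_natDegree hlt
  have hd : (C f.leadingCoeff * p).degree =
      (C p.leadingCoeff * X ^ (p.natDegree - f.natDegree) * f).degree := by
    rw [degree_C_mul (leadingCoeff_ne_zero.2 hf0), degree_mul,
      degree_C_mul_X_pow _ (leadingCoeff_ne_zero.2 hp0), degree_eq_natDegree hp0,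
      degree_eq_natDegree hf0]
    norm_cast
    omega
  have hne : C f.leadingCoeff * p ≠ 0 := mul_ne_zero (by simpa using hf0) hp0
  have h1 := degree_sub_lt_left hd hne (by
    rw [leadingCoeff_mul, leadingCoeff_mul, leadingCoeff_mul, leadingCoeff_C, leadingCoeff_C,
      leadingCoeff_X_pow]; ring)
  rw [degree_C_mul (leadingCoeff_ne_zero.2 hf0)] at h1
  have h2 := ih _ h1 _ (by simp [eval₂_sub, eval₂_mul, hp, hfz]) rfl
  simp only [eval₂_sub, eval₂_mul, hfy, eval₂_C, mul_zero, sub_zero] at h2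
  exact (mul_eq_zero.1 h2).resolve_left hl

lemma LiftProp.adjoin {A A' : Type u} [CommRing A] [CommRing A'] [IsDomain A'] [CharZero A']
    (hA : LiftProp A) (i : A →+* A') (hi : Function.Injective i) (z : A')
    (hz : Function.Surjective (eval₂RingHom i z)) : LiftProp A' := by
  have : IsDomain A := hi.isDomain i
  have : CharZero A := ⟨fun a b h => by
    have := congrArg i h
    rw [map_natCast, map_natCast] at this
    exact_mod_cast this⟩
  have hX : eval₂RingHom i z X = z := by simp
  obtain ⟨e, he, c, hlift⟩ := hA
  by_cases hinj : Function.Injective (eval₂RingHom i z)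
  · refine ⟨i e, (map_ne_zero_iff i hi).2 he, c, ?_⟩
    intro U _ _ _ E hE hEm k l hkl hcl π hπ
    obtain ⟨χ, hχ⟩ := hlift U E hE hEm k l hkl hcl (π.comp i) hπ
    obtain ⟨y, hy⟩ := Ideal.Quotient.mk_surjective (π z)
    obtain ⟨χ', hχ'⟩ := exists_ringHom_of_eval₂ i z hz χ y (fun p hp => by
      rw [(injective_iff_map_eq_zero _).1 hinj p hp, eval₂_zero])
    refine ⟨χ', ?_⟩
    rw [← RingHom.cancel_right hz, RingHom.comp_assoc, hχ']
    refine Polynomial.ringHom_ext (fun a => ?_) ?_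
    · simpa using congr($hχ a)
    · simp [← hy]
  -- `z` satisfies an algebraic equation; take one of minimal degree
  obtain ⟨f, ⟨hf0, hfz⟩, hfmin⟩ := WellFounded.has_min (r := fun p q : A[X] => p.degree < q.degree)
    (InvImage.wf _ wellFounded_lt) {p | p ≠ 0 ∧ eval₂ i z p = 0} (by
      rw [injective_iff_map_eq_zero] at hinj
      push Not at hinj
      obtain ⟨p, hp, hp0⟩ := hinj
      exact ⟨p, hp0, hp⟩)
  have hmin : ∀ p, p.degree < f.degree → eval₂ i z p = 0 → p = 0 := fun p hp hpz => by
    by_contra hp0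
    exact hfmin p ⟨hp0, hpz⟩ hp
  have hD : eval₂ i z (derivative f) ≠ 0 := fun h0 => by
    have h1 := hmin _ (degree_derivative_lt hf0) h0
    have h2 := derivative_eq_zero.1 h1
    rw [eq_C_of_natDegree_eq_zero h2, eval₂_C, map_eq_zero_iff i hi] at hfz
    rw [eq_C_of_natDegree_eq_zero h2, hfz, C_0] at hf0
    exact hf0 rfl
  refine ⟨i e * i f.leadingCoeff * eval₂ i z (derivative f),
    mul_ne_zero (mul_ne_zero ((map_ne_zero_iff i hi).2 he)
      ((map_ne_zero_iff i hi).2 (leadingCoeff_ne_zero.2 hf0))) hD, c + 3, ?_⟩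
  intro U _ _ _ E hE hEm k l hkl hcl π hπ
  have hk3 : k + 3 ≤ l := by omega
  obtain ⟨χ, hχ⟩ := hlift U E hE hEm (k + 3) l hk3 (by omega) (π.comp i)
    ((Dvd.intro (π (i f.leadingCoeff * eval₂ i z (derivative f))) (by
      rw [RingHom.comp_apply, ← map_mul, mul_assoc])).trans hπ)
  obtain ⟨y, hy⟩ := Ideal.Quotient.mk_surjective (π z)
  have happrox : ∀ p, Ideal.Quotient.mk (Ideal.span {E ^ (k + 3)}) (eval₂ χ y p) =
      Ideal.Quotient.factor (span_singleton_pow_le E hk3) (π (eval₂ i z p)) := by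
    intro p
    have : (Ideal.Quotient.mk (Ideal.span {E ^ (k + 3)})).comp (eval₂RingHom χ y) =
      ((Ideal.Quotient.factor (span_singleton_pow_le E hk3)).comp π).comp (eval₂RingHom i z) := by
      refine Polynomial.ringHom_ext (fun a => ?_) ?_
      · simpa using congr($hχ a)
      · simp [← hy]
    exact congr($this p)
  have hdvd : χ e * χ f.leadingCoeff * eval₂ χ y (derivative f) ∣ E := by
    have h1 := map_dvd (Ideal.Quotient.factor (span_singleton_pow_le E hk3)) hπ
    have h2 : ∀ a, Ideal.Quotient.factor (span_singleton_pow_le E hk3) (π (i a)) =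
      Ideal.Quotient.mk _ (χ a) := fun a => congr($hχ.symm a)
    rw [map_mul, map_mul, map_mul, map_mul, h2, h2, ← happrox, Ideal.Quotient.factor_mk,
      ← map_mul, ← map_mul] at h1
    obtain ⟨v, hv⟩ := h1
    obtain ⟨v, rfl⟩ := Ideal.Quotient.mk_surjective v
    rw [← map_mul, Ideal.Quotient.eq, Ideal.mem_span_singleton] at hv
    obtain ⟨w, hw⟩ := hv
    have hu : IsUnit (1 - E ^ (k + 2) * w) := by
      by_contra hcon
      have h3 := (maximalIdeal U).add_mem ((mem_maximalIdeal _).2 hcon)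
        ((maximalIdeal U).mul_mem_right w (Ideal.pow_mem_of_mem _ hEm (k + 2) (by omega)))
      rw [sub_add_cancel] at h3
      exact (mem_maximalIdeal (1 : U)).1 h3 isUnit_one
    rw [← hu.dvd_mul_right]
    exact ⟨v, by linear_combination hw⟩
  have hlne : χ f.leadingCoeff ≠ 0 := fun h0 => hE (by
    rwa [h0, mul_zero, zero_mul, zero_dvd_iff] at hdvd)
  obtain ⟨E', hE'⟩ := (Dvd.intro_left _ rfl).trans hdvd
  have hev : ∀ x p, eval x (p.map χ) = eval₂ χ x p := fun x p => eval_map χ x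
  obtain ⟨b, hb⟩ : E ^ (k + 3) ∣ eval₂ χ y f := by
    have := happrox f
    rw [hfz, map_zero, map_zero, Ideal.Quotient.eq_zero_iff_mem, Ideal.mem_span_singleton] at this
    exact this
  obtain ⟨h, hh, hah⟩ := exists_newton_root (f.map χ) y (E ^ (k + 1) * (E' ^ 2 * b))
    ((maximalIdeal U).mul_mem_right _ (Ideal.pow_mem_of_mem _ hEm (k + 1) (by omega))) (by
      rw [derivative_map, hev, hev, hb]
      have : E ^ (k + 3) = (eval₂ χ y (derivative f) * E') ^ 2 * E ^ (k + 1) := by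
        rw [← hE']; ring
      rw [this]; ring)
  rw [hev] at hh
  set y' := y + eval y (derivative (f.map χ)) * h
  obtain ⟨χ', hχ'⟩ := exists_ringHom_of_eval₂ i z hz χ y'
    (eval₂_eq_zero_of_minimal i z χ y' f hf0 hfz hh hmin hlne)
  refine ⟨χ', ?_⟩
  rw [← RingHom.cancel_right hz, RingHom.comp_assoc, hχ']
  refine Polynomial.ringHom_ext (fun a => ?_) ?_
  · have := congrArg (Ideal.Quotient.factor (span_singleton_pow_le E (show k ≤ k + 3 by omega)))
      congr($hχ a)
    simpa using this
  · have : Ideal.Quotient.mk (Ideal.span {E ^ k}) y' = Ideal.Quotient.mk _ y := by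
      rw [Ideal.Quotient.eq, Ideal.mem_span_singleton, add_sub_cancel_left]
      exact ((pow_dvd_pow E (Nat.le_succ k)).trans ((Dvd.intro _ rfl).trans hah)).mul_left _
    simp [← hy, this]

theorem liftProp_adjoin {C : Type u} [CommRing C] [IsDomain C] [CharZero C] [Algebra ℤ C]
    (s : Finset C) : LiftProp (Algebra.adjoin ℤ (s : Set C)) := by
  classical
  induction s using Finset.induction_on with
  | empty =>
    rw [Finset.coe_empty, Algebra.adjoin_empty]
    exact liftProp_of_int (Algebra.botEquivOfInjective (R := ℤ) (A := C)
      (algebraMap ℤ C).injective_int).symm.toRingEquiv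
  | insert z s _ ih =>
    have hle : Algebra.adjoin ℤ (s : Set C) ≤ Algebra.adjoin ℤ ((insert z s : Finset C) : Set C) :=
      Algebra.adjoin_mono (by simp)
    have hz : z ∈ Algebra.adjoin ℤ ((insert z s : Finset C) : Set C) :=
      Algebra.subset_adjoin (by simp)
    refine ih.adjoin (Subalgebra.inclusion hle).toRingHom (Subalgebra.inclusion_injective hle)
      ⟨z, hz⟩ ?_
    rintro ⟨a, ha⟩
    induction ha using Algebra.adjoin_induction with
    | mem x hx =>
      rw [Finset.coe_insert] at hx
      rcases hx with rfl | hx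
      · exact ⟨X, by simp⟩
      · exact ⟨Polynomial.C ⟨x, Algebra.subset_adjoin hx⟩, by
          rw [coe_eval₂RingHom, eval₂_C]; rfl⟩
    | algebraMap r => exact ⟨(r : (Algebra.adjoin ℤ (s : Set C))[X]), by
      rw [map_intCast]; exact Subtype.ext (by simp)⟩
    | add x y hx hy h1 h2 =>
      obtain ⟨p, hp⟩ := h1
      obtain ⟨q, hq⟩ := h2
      exact ⟨p + q, by rw [map_add, hp, hq]; rfl⟩
    | mul x y hx hy h1 h2 =>
      obtain ⟨p, hp⟩ := h1
      obtain ⟨q, hq⟩ := h2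
      exact ⟨p * q, by rw [map_mul, hp, hq]; rfl⟩

end LiftProp

end CanonicalElement

namespace CanonicalElement
open scoped Pointwise

section Shift
open MvPowerSeries

lemma isHomogeneous_truncTotal {σ R : Type*} [Finite σ] [CommSemiring R] {g : MvPowerSeries σ R}
    {r : ℕ}
    (hr : g.order = r) : (g.truncTotal (r + 1)).IsHomogeneous r := by
  intro d hd
  have hlt : d.degree < r + 1 := by
    by_contra hcon
    exact hd (coeff_truncTotal_eq_zero _ (not_lt.1 hcon))
  rw [coeff_truncTotal _ hlt] at hd
  have h := order_le hd
  rw [hr, Nat.cast_le] at h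
  have h1 : Finsupp.weight 1 d = d.degree :=
    DFunLike.congr_fun (Finsupp.degree_eq_weight_one (σ := σ) (R := ℕ)).symm d
  omega

lemma eval₂_smul_of_isHomogeneous {σ K S : Type*} [CommSemiring K] [CommSemiring S] (φ : K →+* S)
    {P : MvPolynomial σ K} {r : ℕ} (hP : P.IsHomogeneous r) (c : σ → K) (y : S) :
    P.eval₂ φ (fun i => φ (c i) * y) = φ (MvPolynomial.eval c P) * y ^ r := by
  rw [MvPolynomial.eval₂_eq, MvPolynomial.eval_eq, map_sum, Finset.sum_mul]
  refine Finset.sum_congr rfl fun d hd => ?_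
  have h1 : ∑ i ∈ d.support, d i = r := by
    rw [← hP.degree_eq_sum_deg_support hd]
  rw [map_mul, map_prod, mul_assoc, ← h1, ← Finset.prod_pow_eq_pow_sum, ← Finset.prod_mul_distrib]
  simp_rw [mul_pow, map_pow]

/-- After a linear change of coordinates, a nonzero power series is regular in the first
variable. -/
lemma exists_shift {K : Type*} [Field K] [Infinite K] {n : ℕ}
    {g : MvPowerSeries (Fin (n + 1)) K} (hg : g ≠ 0) :
    ∃ (a : Fin n → K) (σ : MvPowerSeries (Fin (n + 1)) K →+* PowerSeries (MvPowerSeries (Fin n) K)),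
      σ (X 0) = PowerSeries.X ∧
      (∀ i, σ (X (Fin.succ i)) = PowerSeries.C (X i) + PowerSeries.C (C (a i)) * PowerSeries.X) ∧
      ∃ r, constantCoeff (PowerSeries.coeff r (σ g)) ≠ 0 := by
  obtain ⟨r, hr⟩ := ENat.ne_top_iff_exists.1 (mt order_eq_top_iff.1 hg)
  set P := g.truncTotal (r + 1)
  have hP : P.IsHomogeneous r := isHomogeneous_truncTotal hr.symm
  have hP0 : P ≠ 0 := by
    obtain ⟨d, hd, hdr⟩ := exists_coeff_ne_zero_and_order (ne_zero_iff_order_finite.1 hg)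
    intro h0
    rw [← hr, Nat.cast_inj] at hdr
    apply hd
    rw [← coeff_truncTotal (n := r + 1) _ (by omega)]
    change MvPolynomial.coeff d P = 0
    rw [h0, MvPolynomial.coeff_zero]
  obtain ⟨p, hp⟩ : ∃ p : Fin (n + 1) → K, MvPolynomial.eval p (MvPolynomial.X 0 * P) ≠ 0 := by
    by_contra! hcon
    refine mul_ne_zero (MvPolynomial.X_ne_zero 0) hP0 (MvPolynomial.funext fun x => ?_)
    rw [hcon, map_zero]
  rw [map_mul, MvPolynomial.eval_X] at hp
  have hp0 := left_ne_zero_of_mul hp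
  let a : Fin n → K := fun i => (p 0)⁻¹ * p i.succ
  let c : Fin (n + 1) → K := Fin.cons 1 a
  have hc : MvPolynomial.eval c P ≠ 0 := by
    intro h0
    apply right_ne_zero_of_mul hp
    have := eval₂_smul_of_isHomogeneous (RingHom.id K) hP c (p 0)
    rw [RingHom.id_apply, h0, zero_mul] at this
    rw [← this]
    refine congrArg (fun q => MvPolynomial.eval q P) (funext fun i => ?_)
    refine Fin.cases ?_ (fun i => ?_) i
    · simp [c]
    · simp [c, a]
      field_simp
  let b : Fin (n + 1) → MvPowerSeries (Fin (n + 1)) K :=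
    Fin.cons (X 0) fun i => X i.succ + C (a i) * X 0
  have hb : HasSubst b := hasSubst_of_constantCoeff_zero fun i => by
    refine Fin.cases ?_ (fun i => ?_) i <;> simp [b]
  let σ : MvPowerSeries (Fin (n + 1)) K →+* PowerSeries (MvPowerSeries (Fin n) K) :=
    (finSuccEquiv K n).toRingEquiv.toRingHom.comp
      (substAlgHom (R := K) hb).toRingHom
  have hσ : ∀ f, σ f = finSuccEquiv K n (substAlgHom (R := K) hb f) := fun f => rfl
  have hσ0 : σ (X 0) = PowerSeries.X := by
    rw [hσ, substAlgHom_X]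
    simp [b, finSuccEquiv_X_zero]
  have hσs : ∀ i, σ (X (Fin.succ i)) =
      PowerSeries.C (X i) + PowerSeries.C (C (a i)) * PowerSeries.X := fun i => by
    rw [hσ, substAlgHom_X]
    simp [b, finSuccEquiv_X_zero, finSuccEquiv_X_succ, finSuccEquiv_C]
  refine ⟨a, σ, hσ0, hσs, r, ?_⟩
  let κ := (PowerSeries.map (constantCoeff (σ := Fin n) (R := K))).comp σ
  have hκ : ∀ i, κ (X i) = PowerSeries.C (c i) * PowerSeries.X := fun i => by
    refine Fin.cases ?_ (fun i => ?_) i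
    · simp [κ, hσ0, c]
    · simp [κ, hσs, c]
  have hκP : κ P = PowerSeries.C (MvPolynomial.eval c P) * PowerSeries.X ^ r := by
    rw [← eval₂_smul_of_isHomogeneous _ hP]
    have : κ.comp MvPolynomial.coeToMvPowerSeries.ringHom =
        MvPolynomial.eval₂Hom PowerSeries.C fun i => PowerSeries.C (c i) * PowerSeries.X := by
      refine MvPolynomial.ringHom_ext (fun k => ?_) fun i => ?_
      · simp only [RingHom.comp_apply, MvPolynomial.coeToMvPowerSeries.ringHom_apply,
          MvPolynomial.coe_C, MvPolynomial.eval₂Hom_C, κ]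
        have h1 : substAlgHom (R := K) hb (C k) = C k := (substAlgHom (R := K) hb).commutes k
        rw [hσ, h1]
        simp [finSuccEquiv_C]
      · simp [hκ]
    exact congr($this P)
  have hrest : κ (g - P) ∈ Ideal.span {(PowerSeries.X : PowerSeries K)} ^ (r + 1) := by
    have h1 : g - P ∈ Ideal.span (Set.range (X : Fin (n + 1) → MvPowerSeries _ K)) ^ (r + 1) := by
      rw [mem_pow_span_X_iff]
      refine le_order fun d hd => ?_
      rw [map_sub, MvPolynomial.coeff_coe, coeff_truncTotal, sub_self]
      exact_mod_cast hd
    have h2 := Ideal.mem_map_of_mem κ h1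
    rw [Ideal.map_pow, Ideal.map_span] at h2
    refine Ideal.pow_right_mono (Ideal.span_le.2 ?_) _ h2
    rintro _ ⟨_, ⟨i, rfl⟩, rfl⟩
    rw [hκ]
    exact Ideal.mul_mem_left _ _ (Ideal.mem_span_singleton_self _)
  rw [Ideal.span_singleton_pow, Ideal.mem_span_singleton, PowerSeries.X_pow_dvd_iff] at hrest
  have h3 := hrest r (Nat.lt_succ_self r)
  rw [map_sub, map_sub, sub_eq_zero, hκP, PowerSeries.coeff_C_mul_X_pow, if_pos rfl] at h3
  rw [← PowerSeries.coeff_map]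
  exact h3 ▸ hc

end Shift

end CanonicalElement

namespace CanonicalElement
open scoped Pointwise

lemma exists_ringHom_of_forall_exists {A Q P V : Type*} [CommRing A] [CommRing Q] [CommRing P]
    [CommRing V] (σ : A →+* Q) (θ : P →+* Q) (l : P →+* V) (hk : ∀ p, θ p = 0 → l p = 0)
    (h : ∀ a, ∃ p, θ p = σ a) : ∃ π : A →+* V, ∀ a p, θ p = σ a → π a = l p := by
  have hs : Function.Surjective θ.rangeRestrict := θ.rangeRestrict_surjective
  let l' : θ.range →+* V := θ.rangeRestrict.liftOfSurjective hs ⟨l, fun p hp => by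
    refine hk p ?_
    exact congrArg Subtype.val (RingHom.mem_ker.1 hp)⟩
  have hl' : ∀ p, l' (θ.rangeRestrict p) = l p := fun p =>
    RingHom.liftOfSurjective_comp_apply _ hs _ p
  refine ⟨l'.comp (σ.codRestrict θ.range fun a => h a), fun a p hap => ?_⟩
  rw [← hl', RingHom.comp_apply]
  congr 1
  exact Subtype.ext hap.symm

section Reduction
open MvPowerSeries

/-- Finitely many power series over `K` can be reduced to power series over a field of positive
characteristic, keeping the variables a system of parameters. -/
def HasReduction (K : Type u) [Field K] (n : ℕ) : Prop :=
  ∀ s : Finset (MvPowerSeries (Fin n) K), ∃ (A : Subalgebra ℤ (MvPowerSeries (Fin n) K))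
    (_ : ∀ a ∈ s, a ∈ A) (hX : ∀ i, X i ∈ A) (F : Type u) (_ : Field F) (p : ℕ)
    (_ : Fact p.Prime) (_ : CharP F p) (χ : A →+* MvPowerSeries (Fin n) F),
    Ideal.span (Set.range fun i => χ ⟨X i, hX i⟩) = maximalIdeal (MvPowerSeries (Fin n) F)

lemma isJacobsonRing_int : IsJacobsonRing ℤ := by
  refine isJacobsonRing_iff_prime_eq.2 fun P hP => ?_
  by_cases h : P = ⊥
  · subst h
    refine le_antisymm (fun x hx => ?_) Ideal.le_jacobson
    have h1 := Ideal.mem_jacobson_bot.1 hx x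
    rw [Int.isUnit_iff] at h1
    rw [Ideal.mem_bot]
    rcases h1 with h1 | h1
    · exact mul_self_eq_zero.1 (by linarith)
    · nlinarith [mul_self_nonneg x]
  · have := hP.isMaximal h
    exact Ideal.jacobson_eq_self_of_isMaximal

lemma exists_charP_residue {A : Type u} [CommRing A] [Nontrivial A] [Algebra ℤ A]
    [Algebra.FiniteType ℤ A] :
    ∃ (F : Type u) (_ : Field F) (p : ℕ) (_ : Fact p.Prime) (_ : CharP F p),
      Nonempty (A →+* F) := by
  obtain ⟨M, hM⟩ := Ideal.exists_maximal A
  let : Field (A ⧸ M) := Ideal.Quotient.field M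
  have := isJacobsonRing_int
  have hfin := finite_of_finite_type_of_isJacobsonRing ℤ (A ⧸ M)
  obtain ⟨p, hp⟩ := CharP.exists (A ⧸ M)
  rcases CharP.char_is_prime_or_zero (A ⧸ M) p with h | rfl
  · exact ⟨A ⧸ M, inferInstance, p, ⟨h⟩, hp, ⟨Ideal.Quotient.mk M⟩⟩
  · have := CharP.charP_to_charZero (A ⧸ M)
    have hInt : (algebraMap ℤ (A ⧸ M)).IsIntegral :=
      RingHom.IsIntegral.of_finite (RingHom.finite_algebraMap.2 hfin)
    have : Algebra.IsIntegral ℤ (A ⧸ M) := ⟨hInt⟩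
    exact (Int.not_isField (isField_of_isIntegral_of_isField (R := ℤ) (S := A ⧸ M)
      (algebraMap ℤ (A ⧸ M)).injective_int (Field.toIsField _))).elim

lemma hasReduction_zero (K : Type u) [Field K] : HasReduction K 0 := by
  intro s
  have : Algebra.FiniteType ℤ (Algebra.adjoin ℤ (s : Set (MvPowerSeries (Fin 0) K))) :=
    (Subalgebra.fg_iff_finiteType _).1 (Subalgebra.fg_adjoin_finset s)
  obtain ⟨F, _, p, hp, hF, ⟨f⟩⟩ :=
    exists_charP_residue (A := Algebra.adjoin ℤ (s : Set (MvPowerSeries (Fin 0) K)))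
  refine ⟨_, fun a ha => Algebra.subset_adjoin ha, fun i => i.elim0, F, inferInstance, p, hp, hF,
    (C (σ := Fin 0)).comp f, ?_⟩
  rw [maximalIdeal_mvPowerSeries]
  congr 2
  exact Subsingleton.elim _ _

/-- Nakayama's lemma, in the form used to recognize systems of parameters. -/
lemma span_eq_maximalIdeal_of_sub_mem {F : Type*} [Field F] {n : ℕ}
    (ι : MvPowerSeries (Fin n) F →+* MvPowerSeries (Fin (n + 1)) F) (hι : ∀ i, ι (X i) = X i.succ)
    (y b : Fin n → MvPowerSeries (Fin n) F)
    (hy : Ideal.span (Set.range y) = maximalIdeal (MvPowerSeries (Fin n) F))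
    (w : Fin (n + 1) → MvPowerSeries (Fin (n + 1)) F)
    (h0 : w 0 - X 0 ∈ maximalIdeal (MvPowerSeries (Fin (n + 1)) F) ^ 2)
    (hs : ∀ i, w (Fin.succ i) - (ι (y i) + ι (b i) * X 0) ∈
      maximalIdeal (MvPowerSeries (Fin (n + 1)) F) ^ 2) :
    Ideal.span (Set.range w) = maximalIdeal (MvPowerSeries (Fin (n + 1)) F) := by
  set m := maximalIdeal (MvPowerSeries (Fin (n + 1)) F)
  set N := Ideal.span (Set.range w)
  have hwN : ∀ i, w i ∈ N := fun i => Ideal.subset_span ⟨i, rfl⟩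
  have hm2 : m ^ 2 ≤ m := Ideal.pow_le_self two_ne_zero
  have hX : ∀ i, X i ∈ m := fun i => by
    rw [show m = _ from maximalIdeal_mvPowerSeries]
    exact Ideal.subset_span ⟨i, rfl⟩
  have hX0 : X 0 ∈ N ⊔ m ^ 2 := by
    have := sub_mem (Ideal.mem_sup_left (hwN 0)) (Ideal.mem_sup_right h0 : _ ∈ N ⊔ m ^ 2)
    rwa [sub_sub_cancel] at this
  have hιm : maximalIdeal (MvPowerSeries (Fin n) F) ≤ (N ⊔ m ^ 2).comap ι ∧
      maximalIdeal (MvPowerSeries (Fin n) F) ≤ m.comap ι := by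
    have hle : maximalIdeal (MvPowerSeries (Fin n) F) ≤ m.comap ι := by
      rw [maximalIdeal_mvPowerSeries, Ideal.span_le]
      rintro _ ⟨i, rfl⟩
      exact Ideal.mem_comap.2 (hι i ▸ hX _)
    refine ⟨?_, hle⟩
    rw [← hy, Ideal.span_le]
    rintro _ ⟨i, rfl⟩
    refine Ideal.mem_comap.2 ?_
    have h1 := sub_mem (Ideal.mem_sup_left (hwN i.succ)) (Ideal.mem_sup_right (hs i) :
      _ ∈ N ⊔ m ^ 2)
    have h2 := sub_mem h1 ((N ⊔ m ^ 2).mul_mem_left (ι (b i)) hX0)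
    convert h2 using 1
    ring
  have hNm : N ≤ m := by
    refine Ideal.span_le.2 ?_
    rintro _ ⟨i, rfl⟩
    refine Fin.cases ?_ (fun i => ?_) i
    · have := add_mem (hm2 h0) (hX 0)
      rwa [sub_add_cancel] at this
    · have h1 : ι (y i) ∈ m := hιm.2 (hy ▸ Ideal.subset_span ⟨i, rfl⟩)
      have := add_mem (hm2 (hs i)) (add_mem h1 (m.mul_mem_left (ι (b i)) (hX 0)))
      rwa [sub_add_cancel] at this
  refine le_antisymm hNm (Submodule.le_of_le_smul_of_le_jacobson_bot (I := m)
    (IsNoetherian.noetherian _) (IsLocalRing.jacobson_eq_maximalIdeal _ bot_ne_top).ge ?_)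
  rw [smul_eq_mul, ← pow_two]
  conv_lhs => rw [show m = _ from maximalIdeal_mvPowerSeries]
  refine Ideal.span_le.2 ?_
  rintro _ ⟨i, rfl⟩
  refine Fin.cases hX0 (fun i => ?_) i
  rw [← hι]
  refine hιm.1 ?_
  rw [maximalIdeal_mvPowerSeries]
  exact Ideal.subset_span ⟨i, rfl⟩

end Reduction

end CanonicalElement

namespace CanonicalElement
open scoped Pointwise

section Reduction
open Polynomial

lemma exists_map_subtype_eq {B : Type*} [CommRing B] [Algebra ℤ B] (B₀ : Subalgebra ℤ B) (p : B[X])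
    (h : ∀ c ∈ p.coeffs, c ∈ B₀) : ∃ q : B₀[X], q.map B₀.val.toRingHom = p := by
  have h1 := (lifts_iff_coeff_lifts (f := B₀.val.toRingHom) p).2 fun n => by
    by_cases h0 : p.coeff n = 0
    · exact ⟨0, by rw [h0, map_zero]⟩
    · exact ⟨⟨p.coeff n, h _ (coeff_mem_coeffs h0)⟩, rfl⟩
  exact (mem_lifts p).1 h1

lemma _root_.Polynomial.IsDistinguishedAt.pow {B : Type*} [CommRing B] {I : Ideal B} {f : B[X]}
    (hf : f.IsDistinguishedAt I) (m : ℕ) : (f ^ m).IsDistinguishedAt I := by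
  induction m with
  | zero => exact ⟨⟨fun {n} hn => by simp at hn⟩, by simp⟩
  | succ m ih => exact pow_succ f m ▸ ih.mul hf

/-- Congruences between polynomials modulo powers of a distinguished polynomial can be transported
along any homomorphism defined on the coefficients. -/
lemma dvd_map_of_isDistinguishedAt {B V : Type*} [CommRing B] [Algebra ℤ B] [CommRing V]
    {I : Ideal B} [IsAdicComplete I B] (B₀ : Subalgebra ℤ B) (G : B₀[X])
    (hG : (G.map B₀.val.toRingHom).IsDistinguishedAt I) (l : B₀[X] →+* V) (p : B₀[X])
    (hp : Ideal.Quotient.mk (Ideal.span {((G.map B₀.val.toRingHom : B[X]) : PowerSeries B)})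
      (p.map B₀.val.toRingHom : B[X]) = 0) : l G ∣ l p := by
  refine map_dvd l ?_
  have hinj : Function.Injective B₀.val.toRingHom := Subtype.val_injective
  rw [← map_dvd_map _ hinj (monic_of_injective hinj hG.monic), ← Ideal.mem_span_singleton,
    ← Ideal.Quotient.eq_zero_iff_mem]
  apply (hG.algEquivQuotient).injective
  rw [map_zero]
  exact hp

end Reduction

section Reduction
open PowerSeries

lemma exists_weierstrass {K : Type*} [Field K] [Infinite K] {n : ℕ}
    {e : MvPowerSeries (Fin (n + 1)) K} (he : e ≠ 0) :
    ∃ (a : Fin n → K) (σ : MvPowerSeries (Fin (n + 1)) K →+* PowerSeries (MvPowerSeries (Fin n) K))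
      (E : Polynomial (MvPowerSeries (Fin n) K)) (v : PowerSeries (MvPowerSeries (Fin n) K)),
      σ (MvPowerSeries.X 0) = X ∧
      (∀ i, σ (MvPowerSeries.X (Fin.succ i)) =
        PowerSeries.C (MvPowerSeries.X i) + PowerSeries.C (MvPowerSeries.C (a i)) * X) ∧
      E.IsDistinguishedAt (maximalIdeal _) ∧
      E.coeff 0 ∈ maximalIdeal (MvPowerSeries (Fin n) K) ∧ (E : PowerSeries _) = σ e * X * v := by
  have hX0 : (MvPowerSeries.X 0 : MvPowerSeries (Fin (n + 1)) K) ≠ 0 := fun h => by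
    have h1 := MvPowerSeries.coeff_index_single_self_X (R := K) (0 : Fin (n + 1))
    rw [h, map_zero] at h1
    exact zero_ne_one h1
  obtain ⟨a, σ, h0, hs, r, hr⟩ := exists_shift (mul_ne_zero he hX0)
  have : IsAdicComplete (maximalIdeal (MvPowerSeries (Fin n) K)) (MvPowerSeries (Fin n) K) := by
    rw [maximalIdeal_mvPowerSeries]; infer_instance
  obtain ⟨E, h, hE⟩ := exists_isWeierstrassFactorization (g := σ (e * MvPowerSeries.X 0))
    (fun hcon => hr (by
      have h1 := congrArg (PowerSeries.coeff r) hcon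
      rw [PowerSeries.coeff_map, map_zero, residue_eq_zero_iff, mem_maximalIdeal, mem_nonunits_iff,
        MvPowerSeries.isUnit_iff_constantCoeff, isUnit_iff_ne_zero, not_not] at h1
      exact h1))
  obtain ⟨u, hu⟩ := hE.isUnit
  have hEq := hE.eq_mul
  rw [map_mul, h0] at hEq
  refine ⟨a, σ, E, ((u⁻¹ : (PowerSeries (MvPowerSeries (Fin n) K))ˣ) : PowerSeries _), h0, hs,
    hE.isDistinguishedAt, ?_, ?_⟩
  · refine hE.isDistinguishedAt.mem ?_
    by_contra hcon
    have h1 : E = 1 := hE.isDistinguishedAt.monic.natDegree_eq_zero.1 (by omega)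
    rw [h1, Polynomial.coe_one, one_mul] at hEq
    have h2 := congrArg (PowerSeries.constantCoeff) hEq
    rw [map_mul, PowerSeries.constantCoeff_X, mul_zero] at h2
    have h3 := hE.isUnit.map PowerSeries.constantCoeff
    rw [← h2] at h3
    exact not_isUnit_zero h3
  · rw [hEq, mul_assoc, ← hu, Units.mul_inv, mul_one]

end Reduction

end CanonicalElement

namespace CanonicalElement
open scoped Pointwise

section Reduction
open MvPowerSeries

lemma exists_map_eq_intCast {P Q : Type*} [CommRing P] [CommRing Q] (θ : P →+* Q) (k : ℤ) :
    ∃ p, θ p = k :=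
  ⟨k, map_intCast θ k⟩

lemma dvd_map_sub_map {P Q V : Type*} [CommRing P] [CommRing Q] [CommRing V] (θ : P →+* Q)
    (l : P →+* V) (g : V) (h : ∀ p, θ p = 0 → g ∣ l p) (p q : P) (hpq : θ p = θ q) :
    g ∣ l p - l q := by
  rw [← map_sub]
  exact h _ (by rw [map_sub, hpq, sub_self])

lemma hasReduction_succ (K : Type u) [Field K] [CharZero K] (n : ℕ) (ih : HasReduction K n) :
    HasReduction K (n + 1) := by
  classical
  intro s
  let C' := MvPowerSeries (Fin (n + 1)) K
  let B := MvPowerSeries (Fin n) K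
  have : CharZero C' := (constantCoeff (σ := Fin (n + 1)) (R := K)).charZero
  have : IsDomain C' := NoZeroDivisors.to_isDomain _
  let s' : Finset C' := s ∪ Finset.univ.image X
  let A := Algebra.adjoin ℤ (s' : Set C')
  have hsA : ∀ a ∈ s', a ∈ A := fun a ha => Algebra.subset_adjoin ha
  have hXs : ∀ i, X i ∈ s' := fun i =>
    Finset.mem_union_right _ (Finset.mem_image_of_mem _ (Finset.mem_univ i))
  have hXA : ∀ i, X i ∈ A := fun i => hsA _ (hXs i)
  obtain ⟨⟨e, heA⟩, he, c, hlift⟩ := liftProp_adjoin s'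
  have he0 : e ≠ 0 := fun h => he (Subtype.ext h)
  obtain ⟨a, σ, E, v, hσ0, hσs, hE, hE0, hEv⟩ := exists_weierstrass he0
  have : IsAdicComplete (maximalIdeal B) B := by
    rw [maximalIdeal_mvPowerSeries]; infer_instance
  have hG := hE.pow (2 + c)
  let Q := PowerSeries B ⧸ Ideal.span {((E ^ (2 + c) : Polynomial B) : PowerSeries B)}
  let mkQ : PowerSeries B →+* Q := Ideal.Quotient.mk _
  have hr : ∀ t : PowerSeries B, ∃ r : Polynomial B, mkQ r = mkQ t := fun t => by
    obtain ⟨r, hr⟩ := hG.algEquivQuotient.surjective (mkQ t)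
    obtain ⟨r, rfl⟩ := Ideal.Quotient.mk_surjective r
    exact ⟨r, hr⟩
  choose r hr using hr
  -- the constant coefficient of `E` is a combination of the variables
  obtain ⟨w, hw⟩ : ∃ w : Fin n → B, ∑ i, w i * X i = E.coeff 0 := by
    rw [maximalIdeal_mvPowerSeries] at hE0
    exact Ideal.mem_span_range_iff_exists_fun.1 hE0
  obtain ⟨B₀, hB₀, hXB₀, F, _, p, hp, hF, χ', hχ'⟩ := ih (E.coeffs ∪ (r v).coeffs ∪
    s'.biUnion (fun t => (r (σ t)).coeffs) ∪ Finset.univ.image w ∪ Finset.univ.image (C ∘ a))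
  simp only [Finset.mem_union] at hB₀
  obtain ⟨E₀, hE₀⟩ := exists_map_subtype_eq B₀ E fun c hc => hB₀ c (by simp [hc])
  have hw₀ : ∀ i, w i ∈ B₀ := fun i => hB₀ _ (by simp)
  have ha₀ : ∀ i, C (a i) ∈ B₀ := fun i => hB₀ _ (by simp)
  let ι := B₀.val.toRingHom
  have hι : Function.Injective ι := Subtype.val_injective
  have hE₀m : E₀.Monic := Polynomial.monic_of_injective hι (by rw [hE₀]; exact hE.monic)
  let θ : Polynomial B₀ →+* Q := mkQ.comp (Polynomial.coeToPowerSeries.ringHom.comp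
    (Polynomial.mapRingHom ι))
  have hθ : ∀ p, θ p = mkQ (p.map ι : Polynomial B) := fun p => rfl
  let U := MvPowerSeries (Fin (n + 1)) F
  have : IsDomain U := NoZeroDivisors.to_isDomain _
  let ιU : MvPowerSeries (Fin n) F →+* U :=
    (finSuccEquiv F n).symm.toRingEquiv.toRingHom.comp PowerSeries.C
  have hιU : ∀ b, ιU b = (finSuccEquiv F n).symm (PowerSeries.C b) := fun b => rfl
  have hιUX : ∀ i, ιU (X i) = X i.succ := fun i => by
    rw [hιU, ← finSuccEquiv_X_succ, AlgEquiv.symm_apply_apply]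
  let l : Polynomial B₀ →+* U := (finSuccEquiv F n).symm.toRingEquiv.toRingHom.comp
    (Polynomial.coeToPowerSeries.ringHom.comp (Polynomial.mapRingHom χ'))
  have hl : ∀ p, l p = (finSuccEquiv F n).symm (p.map χ' : Polynomial _) := fun p => rfl
  have hlX : l Polynomial.X = X 0 := by
    rw [hl, Polynomial.map_X, Polynomial.coe_X, ← finSuccEquiv_X_zero, AlgEquiv.symm_apply_apply]
  have hlC : ∀ b, l (Polynomial.C b) = ιU (χ' b) := fun b => by
    rw [hl, hιU, Polynomial.map_C, Polynomial.coe_C]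
  have hXU : ∀ i, X i ∈ maximalIdeal U := fun i => by
    rw [maximalIdeal_mvPowerSeries]
    exact Ideal.subset_span ⟨i, rfl⟩
  have hιUm : maximalIdeal (MvPowerSeries (Fin n) F) ≤ (maximalIdeal U).comap ιU := by
    rw [maximalIdeal_mvPowerSeries, Ideal.span_le]
    rintro _ ⟨i, rfl⟩
    exact Ideal.mem_comap.2 (hιUX i ▸ hXU _)
  set E' := l E₀
  have hE'0 : E' ≠ 0 := by
    change ¬ l E₀ = 0
    rw [hl, map_eq_zero_iff _ (finSuccEquiv F n).symm.injective, Polynomial.coe_eq_zero_iff]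
    exact (hE₀m.map χ').ne_zero
  have hE'm : E' ∈ maximalIdeal U := by
    have h1 : E₀.coeff 0 = ∑ i, ⟨w i, hw₀ i⟩ * ⟨X i, hXB₀ i⟩ := by
      apply hι
      rw [← Polynomial.coeff_map, hE₀, ← hw, map_sum]
      rfl
    change l E₀ ∈ _
    rw [← Polynomial.divX_mul_X_add E₀, map_add, map_mul, hlX, hlC, h1]
    refine add_mem (Ideal.mul_mem_left _ _ (hXU 0)) (hιUm ?_)
    rw [map_sum, ← hχ']
    refine sum_mem fun i _ => ?_
    rw [map_mul]
    exact Ideal.mul_mem_left _ _ (Ideal.subset_span ⟨i, rfl⟩)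
  have hGmap : (E₀ ^ (2 + c)).map ι = E ^ (2 + c) := by rw [Polynomial.map_pow, hE₀]
  have hker : ∀ p, θ p = 0 → E' ^ (2 + c) ∣ l p := fun p hp => by
    have h1 := dvd_map_of_isDistinguishedAt B₀ (E₀ ^ (2 + c)) (by rw [hGmap]; exact hG) l p (by
      rw [hGmap]; exact hp)
    rwa [map_pow] at h1
  have hrange : ∀ t, (∀ c ∈ (r t).coeffs, c ∈ B₀) → ∃ p, θ p = mkQ t := fun t ht => by
    obtain ⟨p, hp⟩ := exists_map_subtype_eq B₀ (r t) ht
    exact ⟨p, by rw [hθ, hp, hr]⟩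
  have hsurj : ∀ t : A, ∃ p, θ p = mkQ (σ t) := by
    rintro ⟨t, ht⟩
    simp only
    induction ht using Algebra.adjoin_induction with
    | mem t ht => exact hrange _ fun c hc => hB₀ c (by
        have : c ∈ s'.biUnion (fun t => (r (σ t)).coeffs) :=
          Finset.mem_biUnion.2 ⟨t, ht, hc⟩
        simp [this])
    | algebraMap k => 
      obtain ⟨p, hp⟩ := exists_map_eq_intCast (P := Polynomial B₀) (Q := Q) θ k
      exact ⟨p, by rw [hp, eq_intCast, map_intCast, map_intCast]⟩
    | add x y _ _ h1 h2 =>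
      obtain ⟨p, hp⟩ := h1
      obtain ⟨q, hq⟩ := h2
      exact ⟨p + q, by simp only [map_add, hp, hq]⟩
    | mul x y _ _ h1 h2 =>
      obtain ⟨p, hp⟩ := h1
      obtain ⟨q, hq⟩ := h2
      exact ⟨p * q, by simp only [map_mul, hp, hq]⟩
  obtain ⟨π, hπ⟩ := exists_ringHom_of_forall_exists ((mkQ.comp σ).comp A.val.toRingHom) θ
    ((Ideal.Quotient.mk (Ideal.span {E' ^ (2 + c)})).comp l)
    (fun p (hp : θ p = 0) => by
      rw [RingHom.comp_apply, Ideal.Quotient.eq_zero_iff_mem, Ideal.mem_span_singleton]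
      exact hker p hp)
    hsurj
  have hπ' : ∀ (t : A) p, θ p = mkQ (σ t) → π t = Ideal.Quotient.mk _ (l p) := hπ
  obtain ⟨pe, hpe⟩ := hsurj ⟨e, heA⟩
  obtain ⟨pv, hpv⟩ := hrange v fun c hc => hB₀ c (by simp [hc])
  have hθX : θ Polynomial.X = mkQ PowerSeries.X := by
    rw [hθ, Polynomial.map_X, Polynomial.coe_X]
  have hdvd : π ⟨e, heA⟩ ∣ Ideal.Quotient.mk (Ideal.span {E' ^ (2 + c)}) E' := by
    have h1 : θ E₀ = θ (pe * Polynomial.X * pv) := by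
      rw [map_mul, map_mul, hpe, hpv, hθX, ← map_mul, ← map_mul, ← hEv, hθ, hE₀]
    have h2 := dvd_map_sub_map (P := Polynomial B₀) (Q := Q) θ l _ hker _ _ h1
    rw [← Ideal.mem_span_singleton, ← Ideal.Quotient.eq, map_mul, map_mul, map_mul,
      map_mul, ← hπ' _ pe hpe, mul_assoc] at h2
    exact Dvd.intro _ h2.symm
  obtain ⟨χ, hχ⟩ := hlift U E' hE'0 hE'm 2 (2 + c) (by omega) le_rfl π hdvd
  have happrox : ∀ (t : A) p, θ p = mkQ (σ t) → χ t - l p ∈ maximalIdeal U ^ 2 := by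
    intro t p htp
    have h1 := congr($hχ t)
    rw [RingHom.comp_apply, RingHom.comp_apply, hπ' t p htp, Ideal.Quotient.factor_mk,
      Ideal.Quotient.eq] at h1
    refine (Ideal.span_singleton_le_iff_mem _).2 (Ideal.pow_mem_pow hE'm 2) h1
  refine ⟨A, fun t ht => hsA t (Finset.mem_union_left _ ht), hXA, F, inferInstance, p, hp, hF, χ,
    ?_⟩
  refine span_eq_maximalIdeal_of_sub_mem ιU hιUX _ (fun i => χ' ⟨C (a i), ha₀ i⟩) hχ' _ ?_ ?_
  · have := happrox ⟨X 0, hXA 0⟩ Polynomial.X (by rw [hθX, hσ0])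
    rwa [hlX] at this
  · intro i
    have := happrox ⟨X i.succ, hXA _⟩ (Polynomial.C ⟨X i, hXB₀ i⟩ +
      Polynomial.C ⟨C (a i), ha₀ i⟩ * Polynomial.X) (by
        rw [map_add, map_mul, hθX, hσs, map_add, map_mul, hθ, hθ, Polynomial.map_C,
          Polynomial.map_C, Polynomial.coe_C, Polynomial.coe_C]
        rfl)
    rwa [map_add, map_mul, hlX, hlC, hlC] at this

theorem hasReduction (K : Type u) [Field K] [CharZero K] (n : ℕ) : HasReduction K n := by
  induction n with
  | zero => exact hasReduction_zero K
  | succ n ih => exact hasReduction_succ K n ih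

end Reduction

end CanonicalElement

namespace CanonicalElement
open scoped Pointwise

section Germ
open RingTheory.Sequence

/-- The ideal of families in `Π i, S i` which are zero eventually along `l`. -/
def germIdeal {ι : Type*} (l : Filter ι) (S : ι → Type*) [∀ i, CommRing (S i)] :
    Ideal (∀ i, S i) where
  carrier := {f | ∀ᶠ i in l, f i = 0}
  zero_mem' := .of_forall fun _ => rfl
  add_mem' ha hb := by
    filter_upwards [ha, hb] with i ha hb
    rw [Pi.add_apply, ha, hb, add_zero]
  smul_mem' c a ha := by
    filter_upwards [ha] with i ha
    rw [smul_eq_mul, Pi.mul_apply, ha, mul_zero]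

lemma mem_germIdeal {ι : Type*} {l : Filter ι} {S : ι → Type*} [∀ i, CommRing (S i)]
    {f : ∀ i, S i} : f ∈ germIdeal l S ↔ ∀ᶠ i in l, f i = 0 := Iff.rfl

/-- The ring of germs along `l` of families in `Π i, S i`. -/
abbrev GermRing {ι : Type*} (l : Filter ι) (S : ι → Type*) [∀ i, CommRing (S i)] : Type _ :=
  (∀ i, S i) ⧸ germIdeal l S

/-- The germ of a family. -/
abbrev germ {ι : Type*} (l : Filter ι) {S : ι → Type*} [∀ i, CommRing (S i)] :
    (∀ i, S i) →+* GermRing l S :=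
  Ideal.Quotient.mk (germIdeal l S)

lemma germ_eq_germ {ι : Type*} {l : Filter ι} {S : ι → Type*} [∀ i, CommRing (S i)]
    {f g : ∀ i, S i} : germ l f = germ l g ↔ ∀ᶠ i in l, f i = g i := by
  rw [Ideal.Quotient.eq, mem_germIdeal]
  simp only [Pi.sub_apply, sub_eq_zero]

lemma germ_mem_ofList {ι : Type*} {l : Filter ι} {S : ι → Type*} [∀ i, CommRing (S i)]
    {a : ∀ i, S i} {fs : List (∀ i, S i)} :
    germ l a ∈ Ideal.ofList (fs.map (germ l)) ↔
      ∀ᶠ i in l, a i ∈ Ideal.ofList (fs.map fun f => f i) := by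
  induction fs generalizing a with
  | nil =>
    simp only [List.map_nil, Ideal.ofList_nil, Ideal.mem_bot]
    rw [← map_zero (germ l), germ_eq_germ]
    rfl
  | cons b bs ih =>
    simp only [List.map_cons, Ideal.ofList_cons, Ideal.mem_span_singleton_sup]
    constructor
    · rintro ⟨c, e, he, hce⟩
      obtain ⟨c, rfl⟩ := Ideal.Quotient.mk_surjective c
      obtain ⟨e, rfl⟩ := Ideal.Quotient.mk_surjective e
      have h1 := ih.1 he
      rw [← map_mul, ← map_add, germ_eq_germ] at hce
      filter_upwards [h1, hce] with i h1 h2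
      exact ⟨c i, e i, h1, h2⟩
    · intro h
      choose! c e h using fun i (hi : ∃ c, ∃ e ∈ Ideal.ofList (bs.map fun f => f i),
        c * b i + e = a i) => hi
      rename ∀ᶠ i in l, _ => h'
      refine ⟨germ l c, germ l e, ih.2 ?_, ?_⟩
      · filter_upwards [h'] with i hi using (h i hi).1
      · rw [← map_mul, ← map_add, germ_eq_germ]
        filter_upwards [h'] with i hi using (h i hi).2

lemma isWeaklyRegular_self_iff {R : Type*} [CommRing R] {rs : List R} :
    IsWeaklyRegular R rs ↔ ∀ i (h : i < rs.length) (a : R),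
      rs[i] * a ∈ Ideal.ofList (rs.take i) → a ∈ Ideal.ofList (rs.take i) := by
  rw [isWeaklyRegular_iff]
  refine forall₂_congr fun i h => ?_
  rw [isSMulRegular_on_quot_iff_lsmul_comap_le, smul_eq_mul, Ideal.mul_top]
  rfl

lemma isWeaklyRegular_map_germ {ι : Type*} {l : Filter ι} {S : ι → Type*} [∀ i, CommRing (S i)]
    {fs : List (∀ i, S i)} (h : ∀ᶠ i in l, IsWeaklyRegular (S i) (fs.map fun f => f i)) :
    IsWeaklyRegular (GermRing l S) (fs.map (germ l)) := by
  rw [isWeaklyRegular_self_iff]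
  intro k hk a ha
  obtain ⟨a, rfl⟩ := Ideal.Quotient.mk_surjective a
  rw [List.length_map] at hk
  rw [← List.map_take] at ha ⊢
  rw [List.getElem_map, ← map_mul] at ha
  rw [germ_mem_ofList] at ha ⊢
  filter_upwards [ha, h] with i h1 h2
  rw [isWeaklyRegular_self_iff] at h2
  have := h2 k (by rwa [List.length_map]) (a i)
  rw [← List.map_take, List.getElem_map] at this
  exact this h1

lemma exists_germ_ringHom {R : Type*} [CommRing R] {ι : Type*} (l : Filter ι) {S : ι → Type*}
    [∀ i, CommRing (S i)] (g : R → ∀ i, S i) (h1 : ∀ᶠ i in l, g 1 i = 1)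
    (hadd : ∀ a b, ∀ᶠ i in l, g (a + b) i = g a i + g b i)
    (hmul : ∀ a b, ∀ᶠ i in l, g (a * b) i = g a i * g b i) :
    ∃ f : R →+* GermRing l S, ∀ a, f a = germ l (g a) :=
  ⟨RingHom.mk' ⟨⟨fun a => germ l (g a), germ_eq_germ.2 h1⟩, fun a b => germ_eq_germ.2 (hmul a b)⟩
    fun a b => germ_eq_germ.2 (hadd a b), fun _ => rfl⟩

lemma eventually_mem_ofList {R : Type*} [CommRing R] {ι : Type*} {l : Filter ι} {S : ι → Type*}
    [∀ i, CommRing (S i)] {g : R → ∀ i, S i} {f : R →+* GermRing l S} (hf : ∀ a, f a = germ l (g a))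
    {a : R} {zs : List R} (ha : f a ∈ (Ideal.ofList zs).map f) :
    ∀ᶠ i in l, g a i ∈ Ideal.ofList (zs.map fun z => g z i) := by
  have h2 : zs.map f = (zs.map g).map (germ l) := by
    rw [List.map_map]
    exact List.map_congr_left fun a _ => hf a
  rw [Ideal.map_ofList, h2, hf, germ_mem_ofList] at ha
  filter_upwards [ha] with i hi
  rwa [List.map_map] at hi

lemma map_ofFn_apply {R T : Type*} {n : ℕ} (y : Fin n → R) (g : R → T) :
    (List.ofFn y).map g = List.ofFn fun i => g (y i) := by
  rw [List.map_ofFn]; rfl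

lemma eventually_mem_span {R : Type*} [CommRing R] {ι : Type*} {l : Filter ι} {S : ι → Type*}
    [∀ i, CommRing (S i)] {g : R → ∀ i, S i} {f : R →+* GermRing l S} (hf : ∀ a, f a = germ l (g a))
    {a : R} {n : ℕ} {y : Fin n → R} (ha : f a ∈ (Ideal.span (Set.range y)).map f) :
    ∀ᶠ i in l, g a i ∈ Ideal.span (Set.range fun k => g (y k) i) := by
  rw [← ofList_ofFn] at ha
  filter_upwards [eventually_mem_ofList hf ha] with i hi
  rwa [map_ofFn_apply y fun z => g z i, ofList_ofFn] at hi

variable {R : Type u} [CommRing R] [IsLocalRing R] {n : ℕ} {ι : Type u} {l : Filter ι}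
    {S : ι → Type u} [∀ i, CommRing (S i)] [∀ i, IsLocalRing (S i)]
    {g : R → ∀ i, S i} {f : R →+* GermRing l S} {y : Fin n → R}

lemma eventually_mem_maximalIdeal (hf : ∀ a, f a = germ l (g a))
    (hy : Ideal.span (Set.range y) = maximalIdeal R)
    (hg : ∀ᶠ i in l, ∀ k, g (y k) i ∈ maximalIdeal (S i)) {a : R}
    (ha : f a ∈ (maximalIdeal R).map f) : ∀ᶠ i in l, g a i ∈ maximalIdeal (S i) := by
  rw [← hy] at ha
  filter_upwards [eventually_mem_span hf ha, hg] with i h1 h2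
  exact (Ideal.span_le.2 (Set.range_subset_iff.2 h2)) h1

lemma RegDim.flat_germRing (h : RegDim R n) (hS : ∀ i, RegDim (S i) n)
    (hf : ∀ a, f a = germ l (g a)) (hy : Ideal.span (Set.range y) = maximalIdeal R)
    (hg : ∀ᶠ i in l, ∀ k, g (y k) i ∈ maximalIdeal (S i))
    (hg' : ∀ᶠ i in l, maximalIdeal (S i) ≤ (Ideal.span (Set.range fun k => g (y k) i)).radical) :
    f.Flat := by
  let := f.toAlgebra
  refine h.flat fun z hz hreg => ?_
  obtain ⟨t, hlen, hzt, hrad⟩ := h.exists_append_le_radical z hz hreg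
  have hk : ∀ k, ∃ m, y k ^ m ∈ Ideal.ofList (z ++ t) := fun k =>
    hrad (hy ▸ Ideal.subset_span ⟨k, rfl⟩)
  choose m hm using hk
  have h1 : ∀ᶠ i in l, ∀ k, g (y k) i ^ m k ∈ Ideal.ofList ((z ++ t).map fun z => g z i) := by
    rw [Filter.eventually_all]
    intro k
    have h2 : germ l (g (y k ^ m k)) = germ l (g (y k) ^ m k) := by
      rw [← hf, map_pow, map_pow, hf]
    filter_upwards [eventually_mem_ofList hf (Ideal.mem_map_of_mem f (hm k)),
      germ_eq_germ.1 h2] with i h3 h4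
    rwa [h4] at h3
  have h2 : ∀ᶠ i in l, ∀ r ∈ z ++ t, g r i ∈ maximalIdeal (S i) := by
    have := (z ++ t).finite_toSet.eventually_all (l := l)
      (p := fun r i => g r i ∈ maximalIdeal (S i))
    exact this.2 fun r hr =>
      eventually_mem_maximalIdeal hf hy hg (Ideal.mem_map_of_mem f (hzt r hr))
  rw [← isWeaklyRegular_map_algebraMap_iff (GermRing l S)]
  have h3 : z.map (algebraMap R (GermRing l S)) = (z.map g).map (germ l) := by
    rw [List.map_map]
    exact List.map_congr_left fun a _ => hf a
  rw [h3]
  refine isWeaklyRegular_map_germ ?_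
  filter_upwards [h1, h2, hg'] with i h1 h2 h3
  have h4 : IsWeaklyRegular (S i) ((z ++ t).map fun z => g z i) := by
    refine (hS i).isWeaklyRegular_of_le_radical _ (by rw [List.length_map, hlen]) ?_ ?_
    · intro r hr
      obtain ⟨a, ha, rfl⟩ := List.mem_map.1 hr
      exact h2 a ha
    · refine h3.trans ?_
      rw [Ideal.radical_le_radical_iff, Ideal.span_le]
      rintro _ ⟨k, rfl⟩
      exact ⟨m k, h1 k⟩
  rw [List.map_append, isWeaklyRegular_append_iff] at h4
  rw [List.map_map]
  exact h4.1

lemma RegDim.notMem_map_germRing [l.NeBot] (h : RegDim R n) (hS : ∀ i, RegDim (S i) n)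
    (hf : ∀ a, f a = germ l (g a)) (hy : Ideal.span (Set.range y) = maximalIdeal R)
    (hg : ∀ᶠ i in l, ∀ k, g (y k) i ∈ maximalIdeal (S i))
    (hg' : ∀ᶠ i in l, maximalIdeal (S i) ≤ (Ideal.span (Set.range fun k => g (y k) i)).radical)
    {J : Ideal R} {w : R} (hw : w ∉ J) : f w ∉ J.map f := by
  let := f.toAlgebra
  have : Module.Flat R (GermRing l S) := h.flat_germRing hS hf hy hg hg'
  have : Module.FaithfullyFlat R (GermRing l S) := by
    refine ⟨fun {M} hM htop => ?_⟩
    rw [IsLocalRing.eq_maximalIdeal hM, Ideal.smul_top_eq_map] at htop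
    have h1 : f 1 ∈ (maximalIdeal R).map f := by
      have : f 1 ∈ (⊤ : Submodule R (GermRing l S)) := trivial
      rw [← htop] at this
      exact this
    have h2 : ∀ᶠ i in l, g 1 i = 1 := germ_eq_germ.1 ((hf 1).symm.trans (map_one f))
    obtain ⟨i, h3, h4⟩ := (eventually_mem_maximalIdeal hf hy hg h1 |>.and h2).exists
    rw [h4] at h3
    exact (mem_maximalIdeal (1 : S i)).1 h3 isUnit_one
  intro hmem
  rw [← Ideal.comap_map_eq_self_of_faithfullyFlat (B := GermRing l S) J] at hw
  exact hw hmem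

end Germ

end CanonicalElement

namespace CanonicalElement
open scoped Pointwise

theorem koszulTorMapZero_of_reduction {R : Type u} [CommRing R] [IsLocalRing R] {n : ℕ}
    (h : RegDim R n) (y : Fin n → R) (hy : Ideal.span (Set.range y) = maximalIdeal R)
    (hred : ∀ D : Finset R, ∃ (A : Subring R) (_ : ∀ a ∈ D, a ∈ A) (hyA : ∀ i, y i ∈ A)
      (S : Type u) (_ : CommRing S) (_ : IsLocalRing S) (_ : RegDim S n) (p : ℕ)
      (_ : Fact p.Prime) (_ : CharP S p) (χ : A →+* S),
      Ideal.span (Set.range fun i => χ ⟨y i, hyA i⟩) = maximalIdeal S)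
    {d : ℕ} (x : Fin d → R) (I : Ideal R) (hx : ∀ i, x i ∈ maximalIdeal R) (w : R)
    (hwx : w ∉ Ideal.span (Set.range x)) (hw : ∀ a ∈ I, w * a ∈ Ideal.span (Set.range x)) :
    KoszulTorMapZero R x ((Ideal.span (Set.range x)).colon I) d := by
  classical
  have := h.1
  choose A hDA hyA S hS1 hS2 hS p hp hpS χ hχ using hred
  let l : Filter (Finset R) := Filter.atTop
  have hA : ∀ a, ∀ᶠ D in l, a ∈ A D := fun a => by
    filter_upwards [Filter.eventually_ge_atTop {a}] with D hD
    exact hDA D a (hD (Finset.mem_singleton_self a))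
  let g : R → ∀ D, S D := fun a D => if ha : a ∈ A D then χ D ⟨a, ha⟩ else 0
  have hg : ∀ D a (ha : a ∈ A D), g a D = χ D ⟨a, ha⟩ := fun D a ha => dif_pos ha
  have hgy : ∀ D i, g (y i) D = χ D ⟨y i, hyA D i⟩ := fun D i => hg D _ _
  have hgspan : ∀ D, Ideal.span (Set.range fun i => g (y i) D) = maximalIdeal (S D) := fun D => by
    rw [← hχ]
    simp only [hgy]
  have hgm : ∀ D i, g (y i) D ∈ maximalIdeal (S D) := fun D i =>
    hgspan D ▸ Ideal.subset_span ⟨i, rfl⟩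
  have hg1 : ∀ D, g 1 D = 1 := fun D => (hg D _ (one_mem _)).trans (map_one (χ D))
  have hgadd : ∀ a b, ∀ᶠ D in l, g (a + b) D = g a D + g b D := fun a b => by
    filter_upwards [hA a, hA b] with D ha hb
    rw [hg D a ha, hg D b hb, hg D _ (add_mem ha hb), ← map_add]
    rfl
  have hgmul : ∀ a b, ∀ᶠ D in l, g (a * b) D = g a D * g b D := fun a b => by
    filter_upwards [hA a, hA b] with D ha hb
    rw [hg D a ha, hg D b hb, hg D _ (mul_mem ha hb), ← map_mul]
    rfl
  obtain ⟨j, hj⟩ := exists_germ_ringHom l g (.of_forall hg1) hgadd hgmul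
  have hjw := h.notMem_map_germRing hS hj hy (.of_forall hgm)
    (.of_forall fun D => (hgspan D).ge.trans Ideal.le_radical) hwx
  have hq : ∀ D, ∃ e, (∀ i, g (x i) D ∈ maximalIdeal (S D)) →
      g w D ∈ Ideal.span (Set.range fun i => g (x i) D) ⊔
        (maximalIdeal (S D)).map (iterateFrobenius (S D) (p D) e) →
      g w D ∈ Ideal.span (Set.range fun i => g (x i) D) := fun D => by
    by_cases hxD : ∀ i, g (x i) D ∈ maximalIdeal (S D)
    · by_cases hwD : g w D ∈ Ideal.span (Set.range fun i => g (x i) D)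
      · exact ⟨0, fun _ _ => hwD⟩
      · have := (hS D).1
        obtain ⟨e, he⟩ := RegDim.exists_iterateFrobenius (p D)
          (Ideal.span_le.2 (Set.range_subset_iff.2 hxD)) hwD
        exact ⟨e, fun _ h => absurd h he⟩
    · exact ⟨0, fun h => absurd h hxD⟩
  choose e he using hq
  let φ : ∀ D, S D →+* S D := fun D => iterateFrobenius (S D) (p D) (e D)
  have hpe : ∀ D, p D ^ e D ≠ 0 := fun D => pow_ne_zero _ (hp D).out.ne_zero
  have hφ : ∀ D a, φ D a = a ^ (p D ^ e D) := fun D a => iterateFrobenius_def _ _ _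
  let g' : R → ∀ D, S D := fun a D => φ D (g a D)
  obtain ⟨f, hf⟩ := exists_germ_ringHom l g'
    (.of_forall fun D => (congrArg (φ D) (hg1 D)).trans (map_one _))
    (fun a b => (hgadd a b).mono fun D hD => (congrArg (φ D) hD).trans (map_add _ _ _))
    (fun a b => (hgmul a b).mono fun D hD => (congrArg (φ D) hD).trans (map_mul _ _ _))
  have hflat : f.Flat := by
    refine h.flat_germRing hS hf hy (.of_forall fun D i => ?_) (.of_forall fun D => ?_)
    · change φ D (g (y i) D) ∈ _
      rw [hφ]
      exact Ideal.pow_mem_of_mem _ (hgm D i) _ (Nat.pos_of_ne_zero (hpe D))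
    · rw [← hgspan D, Ideal.span_le]
      rintro _ ⟨i, rfl⟩
      refine ⟨p D ^ e D, Ideal.subset_span ⟨i, ?_⟩⟩
      exact hφ D _
  refine @koszulTorMapZero_of_flat R _ _ _ _ _ f.toAlgebra hflat j (fun a => ?_) d x I w hw ?_
  · change j a ∣ f a
    rw [hj, hf]
    refine map_dvd (germ l) ⟨fun D => g a D ^ (p D ^ e D - 1), funext fun D => ?_⟩
    change φ D (g a D) = g a D * g a D ^ (p D ^ e D - 1)
    rw [hφ, mul_pow_sub_one (hpe D)]
  · change j w ∉ (Ideal.span (Set.range x)).map j ⊔ (maximalIdeal R).map f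
    intro hmem
    refine hjw ?_
    have h1 : ∀ {m : ℕ} (z : Fin m → R) (g : R → ∀ D, S D) (j : R →+* GermRing l S)
        (hj : ∀ a, j a = germ l (g a)), (Ideal.span (Set.range z)).map j =
          Ideal.ofList ((List.ofFn fun i => g (z i)).map (germ l)) := by
      intro m z g j hj
      rw [← ofList_ofFn, Ideal.map_ofList, map_ofFn_apply, map_ofFn_apply]
      simp only [hj]
    rw [← hy, h1 x g j hj, h1 y g' f hf, ← Ideal.ofList_append, ← List.map_append, hj,
      germ_mem_ofList] at hmem
    rw [h1 x g j hj, hj, germ_mem_ofList]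
    have hxm : ∀ᶠ D in l, ∀ i, g (x i) D ∈ maximalIdeal (S D) := by
      rw [Filter.eventually_all]
      exact fun i => eventually_mem_maximalIdeal hj hy (.of_forall hgm)
        (Ideal.mem_map_of_mem j (hx i))
    filter_upwards [hmem, hxm] with D h2 h3
    rw [List.map_append, Ideal.ofList_append, map_ofFn_apply, map_ofFn_apply, ofList_ofFn,
      ofList_ofFn] at h2
    rw [map_ofFn_apply, ofList_ofFn]
    refine he D h3 (SetLike.le_def.1 (sup_le_sup le_rfl ?_) h2)
    rw [Ideal.span_le]
    rintro _ ⟨i, rfl⟩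
    exact Ideal.mem_map_of_mem (φ D) (hgm D i)

theorem koszulTorMapZero_of_algebraRat {R : Type u} [CommRing R] [IsLocalRing R] [Algebra ℚ R]
    {n : ℕ} (h : RegDim R n) {d : ℕ} (x : Fin d → R) (I : Ideal R)
    (hx : ∀ i, x i ∈ maximalIdeal R) (w : R)
    (hwx : w ∉ Ideal.span (Set.range x)) (hw : ∀ a ∈ I, w * a ∈ Ideal.span (Set.range x)) :
    KoszulTorMapZero R x ((Ideal.span (Set.range x)).colon I) d := by
  classical
  obtain ⟨K, _, _, γ, y, hy, hγ⟩ := h.exists_ringHom_mvPowerSeries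
  refine koszulTorMapZero_of_reduction h y hy (fun D => ?_) x I hx w hwx hw
  obtain ⟨A, hDA, hXA, F, _, p, hp, hF, χ, hχ⟩ := hasReduction K n (D.image γ)
  have := hp.out
  let A' : Subring R := A.toSubring.comap γ
  let γ' : A' →+* A := (γ.comp A'.subtype).codRestrict A.toSubring fun a => a.2
  refine ⟨A', fun a ha => hDA _ (Finset.mem_image_of_mem γ ha), fun i => ?_,
    MvPowerSeries (Fin n) F, inferInstance, inferInstance, regDim_mvPowerSeries F n, p, hp,
    charP_of_injective_algebraMap (algebraMap F (MvPowerSeries (Fin n) F)).injective p,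
    χ.comp γ', ?_⟩
  · change γ (y i) ∈ A
    exact hγ i ▸ hXA i
  · rw [← hχ]
    refine congrArg (fun s => Ideal.span (Set.range s)) (funext fun i => ?_)
    exact congrArg χ (Subtype.ext (hγ i))

lemma charP_or_algebra_rat {R : Type u} [CommRing R] [Nontrivial R] (K : Subring R)
    (hK : IsField K) : (∃ p, p.Prime ∧ CharP R p) ∨ Nonempty (Algebra ℚ R) := by
  let := hK.toField
  obtain ⟨p, hp⟩ := CharP.exists K
  rcases CharP.char_is_prime_or_zero K p with h | rfl
  · exact .inl ⟨p, h, charP_of_injective_ringHom (f := K.subtype) Subtype.val_injective p⟩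
  · have := CharP.charP_to_charZero K
    exact .inr ⟨(K.subtype.comp (algebraMap ℚ K)).toAlgebra⟩

end CanonicalElement

/-- Let `(R,m,k)` be a regular local ring containing a field
and let `I` be an ideal of height `d`.  Let `x₁,…,x_d ∈ I` be an `R`-regular
sequence, and set `Ω̃ = ((x₁,…,x_d) :_R I)`, the lift to `R` of the canonical
module `Ω = Hom_{R/(x)}(R/I, R/(x)) ≅ Ext^d_R(R/I,R)` of `R/I`.  Then the
natural map `K_d(x;R) ⊗_R k → Tor_d^R(R/Ω̃, k)` (induced by a chain map lifting
the natural surjection `R/(x₁,…,x_d) → R/Ω̃`) is the zero map. -/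
theorem statement2
    (R : Type u) [CommRing R] [IsLocalRing R] (hreg : IsRegularLocal R)
    (hfield : ∃ K : Subring R, IsField K)
    (I : Ideal R) (d : ℕ) (hht : HeightEq R I d)
    (x : Fin d → R) (hxI : ∀ j, x j ∈ I)
    (hxreg : RingTheory.Sequence.IsRegular R (List.ofFn x)) :
    KoszulTorMapZero R x ((Ideal.span (Set.range x)).colon I) d := by
  obtain ⟨hN, n, y, hy, hd⟩ := hreg
  have h : CanonicalElement.RegDim R n := ⟨hN, ⟨y, hy⟩, hd.ge⟩
  obtain ⟨w, hwx, hw⟩ := CanonicalElement.exists_notMem_forall_mul_mem hht x hxI hxreg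
  have hx : ∀ i, x i ∈ maximalIdeal R := fun i => by
    refine le_maximalIdeal (fun htop => hxreg.top_ne_smul ?_)
      (Ideal.subset_span (Set.mem_range_self (f := x) i))
    rw [CanonicalElement.ofList_ofFn, htop, Submodule.top_smul]
  obtain ⟨K, hK⟩ := hfield
  rcases CanonicalElement.charP_or_algebra_rat K hK with ⟨p, hp, _⟩ | hQ
  · have : Fact p.Prime := ⟨hp⟩
    exact CanonicalElement.koszulTorMapZero_of_charP h p x I hx w hwx hw
  · let := hQ.some
    exact CanonicalElement.koszulTorMapZero_of_algebraRat h x I hx w hwx hw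
end
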